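/- arXiv:2102.08568 — 3 statements merged into one kernel-verified Lean document; each statement's English description precedes it below -/
import Mathlib

section
/- Let G be an additive arithmetical semigroup satisfying Axiom A^# with parameter q, and assume ∑_{∂(g)=k} μ(g) = O(q^{ηk}) for some 0 ≤ η < 1 and the abstract PNT π^#(k) ≪ q^k/k. Then for any bounded function f with f(0) = 0 and any set S of primes, ∑_{∂(g) ≤ n} μ(g)·1_{D(G,S)}(g)·f(d_−(g)) = O(q^n / log log n). -/
open scoped Classical
open Finset Filter Finsupp

noncomputable def degG {P : Type*} (deg : P → ℕ) (g : P →₀ ℕ) : ℕ :=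
  g.sum fun p k => k * deg p

noncomputable def muG {P : Type*} (g : P →₀ ℕ) : ℤ :=
  if ∀ p, g p ≤ 1 then (-1 : ℤ) ^ g.support.card else 0

noncomputable def dmin0 {P : Type*} (deg : P → ℕ) (g : P →₀ ℕ) : ℕ :=
  if h : g.support.Nonempty then g.support.inf' h deg else 0

def inDistinguished {P : Type*} (deg : P → ℕ) (S : Set P) (g : P →₀ ℕ) : Prop :=
  g = 0 ∨ ∃ p ∈ g.support, deg p = dmin0 deg g ∧ p ∈ S ∧
    ∀ p' ∈ g.support, deg p' = dmin0 deg g → p' = p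

section Aux
variable {P : Type*} (deg : P → ℕ)

lemma degG_add' (g h : P →₀ ℕ) : degG deg (g + h) = degG deg g + degG deg h := by
  unfold degG
  exact Finsupp.sum_add_index' (by simp) (by intros; ring)

lemma degG_single' (p : P) : degG deg (Finsupp.single p 1) = deg p := by
  unfold degG
  rw [Finsupp.sum_single_index] <;> simp

lemma exists_sub_single (g : P →₀ ℕ) (p : P) (hp : g p ≠ 0) :
    ∃ h : P →₀ ℕ, g = h + Finsupp.single p 1 := by
  refine ⟨g - Finsupp.single p 1, ?_⟩
  ext x
  by_cases hx : p = x
  · subst hx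
    simp
    omega
  · simp [Finsupp.single_apply, hx]

lemma muG_add_single (h : P →₀ ℕ) (p : P) (hp : h p = 0) :
    muG (h + Finsupp.single p 1) = - muG h := by
  unfold muG
  have h1 : (∀ x, (h + Finsupp.single p 1 : P →₀ ℕ) x ≤ 1) ↔ ∀ x, h x ≤ 1 := by
    constructor
    · intro H x
      have := H x
      simp at this
      omega
    · intro H x
      by_cases hx : p = x
      · subst hx; simp [hp]
      · simpa [Finsupp.single_apply, hx] using H x
  have h2 : (h + Finsupp.single p 1 : P →₀ ℕ).support = insert p h.support := by
    ext x
    by_cases hx : p = x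
    · subst hx; simp
    · simp [Finsupp.single_apply, hx, Ne.symm hx]
  rw [h2, Finset.card_insert_of_notMem (by simp [hp])]
  simp only [h1]
  split_ifs
  · ring
  · simp

lemma muG_add_single_zero (h : P →₀ ℕ) (p : P) (hp : h p ≠ 0) :
    muG (h + Finsupp.single p 1) = 0 := by
  unfold muG
  rw [if_neg]
  intro H
  have := H p
  simp at this
  exact hp this

variable (hfin : ∀ n : ℕ, {g : P →₀ ℕ | degG deg g = n}.Finite)

/-- Elements of degree `n` free of primes in `T`. -/
noncomputable def FT (T : Finset P) (n : ℕ) : Finset (P →₀ ℕ) :=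
  (hfin n).toFinset.filter (fun g => ∀ p ∈ T, g p = 0)

lemma mem_FT (T : Finset P) (n : ℕ) (g : P →₀ ℕ) :
    g ∈ FT deg hfin T n ↔ degG deg g = n ∧ ∀ p ∈ T, g p = 0 := by
  simp [FT]

noncomputable def MT (T : Finset P) (n : ℕ) : ℝ := ∑ g ∈ FT deg hfin T n, (muG g : ℝ)

lemma FT_insert (T : Finset P) (p : P) (n : ℕ) :
    FT deg hfin (insert p T) n = (FT deg hfin T n).filter (fun g => g p = 0) := by
  ext g
  simp only [mem_FT, Finset.mem_filter, Finset.mem_insert, forall_eq_or_imp]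
  tauto

lemma FT_image (T : Finset P) (p : P) (hp : p ∉ T) (n : ℕ) :
    (FT deg hfin T (n + deg p)).filter (fun g => ¬ g p = 0) =
      (FT deg hfin T n).map (addRightEmbedding (Finsupp.single p 1)) := by
  ext g
  simp only [mem_FT, Finset.mem_filter, Finset.mem_map, addRightEmbedding_apply]
  constructor
  · rintro ⟨⟨h1, h2⟩, h3⟩
    obtain ⟨h, rfl⟩ := exists_sub_single g p h3
    rw [degG_add', degG_single'] at h1
    refine ⟨h, ⟨by omega, fun x hx => ?_⟩, rfl⟩
    have := h2 x hx
    simp at this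
    exact this.1
  · rintro ⟨h, ⟨h1, h2⟩, rfl⟩
    refine ⟨⟨by rw [degG_add', degG_single', h1], fun x hx => ?_⟩, by simp⟩
    have hxp : p ≠ x := by rintro rfl; exact hp hx
    simp [h2 x hx, hxp]

lemma FT_insert_lt (T : Finset P) (p : P) (n : ℕ) (hn : n < deg p) :
    FT deg hfin (insert p T) n = FT deg hfin T n := by
  rw [FT_insert, Finset.filter_true_of_mem]
  intro g hg
  by_contra h3
  rw [mem_FT] at hg
  obtain ⟨h, rfl⟩ := exists_sub_single g p h3
  rw [degG_add', degG_single'] at hg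
  omega

lemma card_FT_rec (T : Finset P) (p : P) (hp : p ∉ T) (n : ℕ) :
    (FT deg hfin T (n + deg p)).card =
      (FT deg hfin (insert p T) (n + deg p)).card + (FT deg hfin T n).card := by
  rw [FT_insert, ← Finset.card_map (s := FT deg hfin T n)
      (addRightEmbedding (Finsupp.single p 1)),
    ← Finset.card_filter_add_card_filter_not (s := FT deg hfin T (n + deg p)) (fun g => g p = 0),
    FT_image deg hfin T p hp]

lemma MT_rec (T : Finset P) (p : P) (hp : p ∉ T) (n : ℕ) :
    MT deg hfin T (n + deg p) =
      MT deg hfin (insert p T) (n + deg p) - MT deg hfin (insert p T) n := by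
  unfold MT
  rw [← Finset.sum_filter_add_sum_filter_not (s := FT deg hfin T (n + deg p)) (fun g => g p = 0),
    FT_image deg hfin T p hp, FT_insert, FT_insert, Finset.sum_map, sub_eq_add_neg]
  congr 1
  rw [← Finset.sum_neg_distrib, Finset.sum_filter]
  refine Finset.sum_congr rfl fun h _ => ?_
  simp only [addRightEmbedding_apply]
  split_ifs with h0
  · rw [muG_add_single h p h0]; simp
  · rw [muG_add_single_zero h p h0]; simp

/-- uniform Möbius bound -/
lemma MT_bound (hdeg : ∀ p, 0 < deg p) (Q A : ℝ) (hQ : 1 < Q)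
    (h0 : ∀ n, |MT deg hfin ∅ n| ≤ A * Q ^ n) (T : Finset P) :
    ∀ n, |MT deg hfin T n| ≤ A * (Q / (Q - 1)) ^ T.card * Q ^ n := by
  have hA : 0 ≤ A := by
    have := (abs_nonneg _).trans (h0 0)
    simpa using this
  have hQ1 : 0 < Q - 1 := by linarith
  induction T using Finset.induction_on with
  | empty => simpa using h0
  | insert p T hp ih =>
    intro n
    rw [Finset.card_insert_of_notMem hp]
    set K := Q / (Q - 1) with hK
    have hK1 : 1 ≤ K := by rw [hK, le_div_iff₀ hQ1]; linarith
    have hKQ : K = 1 + K / Q := by rw [hK]; field_simp; ring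
    set X := A * K ^ T.card with hX
    have hX0 : 0 ≤ X := by positivity
    induction n using Nat.strong_induction_on with
    | _ n ihn =>
      by_cases hn : n < deg p
      · have : MT deg hfin (insert p T) n = MT deg hfin T n := by
          unfold MT; rw [FT_insert_lt deg hfin T p n hn]
        rw [this]
        refine (ih n).trans ?_
        gcongr
        rw [hX]
        gcongr
        omega
      · obtain ⟨k, rfl⟩ : ∃ k, n = k + deg p := ⟨n - deg p, by omega⟩
        have h1 := MT_rec deg hfin T p hp k
        have h2 := ihn k (by have := hdeg p; omega)
        have h3 := ih (k + deg p)
        have h4 : MT deg hfin (insert p T) (k + deg p) =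
          MT deg hfin T (k + deg p) + MT deg hfin (insert p T) k := by linarith
        rw [h4]
        refine (abs_add_le _ _).trans ((add_le_add h3 h2).trans ?_)
        have h5 : Q ^ k * Q ≤ Q ^ (k + deg p) := by
          rw [← pow_succ]
          exact pow_le_pow_right₀ hQ.le (by have := hdeg p; omega)
        have h6 : Q ^ k ≤ Q ^ (k + deg p) / Q := by
          rw [le_div_iff₀ (by linarith)]; exact h5
        have h7 : A * K ^ (T.card + 1) = X * K := by rw [hX]; ring
        rw [h7]
        calc X * Q ^ (k + deg p) + X * K * Q ^ k
            ≤ X * Q ^ (k + deg p) + X * K * (Q ^ (k + deg p) / Q) := by gcongr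
          _ = X * (1 + K / Q) * Q ^ (k + deg p) := by ring
          _ = _ := by rw [← hKQ]

noncomputable def cT (q : ℝ) (T : Finset P) : ℝ := ∏ p ∈ T, (1 - (q ^ deg p)⁻¹)

lemma fac_bounds (hdeg : ∀ p, 0 < deg p) (q : ℝ) (hq : 1 < q) (p : P) :
    0 ≤ 1 - (q ^ deg p)⁻¹ ∧ 1 - (q ^ deg p)⁻¹ ≤ 1 := by
  have : 1 ≤ q ^ deg p := one_le_pow₀ hq.le
  have h2 : (q ^ deg p)⁻¹ ≤ 1 := inv_le_one_of_one_le₀ this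
  have h3 : 0 ≤ (q ^ deg p)⁻¹ := by positivity
  constructor <;> linarith

lemma cT_nonneg (hdeg : ∀ p, 0 < deg p) (q : ℝ) (hq : 1 < q) (T : Finset P) :
    0 ≤ cT deg q T :=
  Finset.prod_nonneg fun p _ => (fac_bounds deg hdeg q hq p).1

lemma cT_le_one (hdeg : ∀ p, 0 < deg p) (q : ℝ) (hq : 1 < q) (T : Finset P) :
    cT deg q T ≤ 1 :=
  Finset.prod_le_one (fun p _ => (fac_bounds deg hdeg q hq p).1)
    fun p _ => (fac_bounds deg hdeg q hq p).2

/-- Legendre sieve -/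
lemma sieve (hdeg : ∀ p, 0 < deg p) (q Q A c : ℝ) (hq : 1 < q) (hQ : 1 < Q)
    (hc : 0 < c) (hcA : c ≤ A)
    (h0 : ∀ n, |((FT deg hfin ∅ n).card : ℝ) - c * q ^ n| ≤ A * Q ^ n) (T : Finset P) :
    ∀ n, |((FT deg hfin T n).card : ℝ) - c * cT deg q T * q ^ n| ≤ A * 2 ^ T.card * Q ^ n := by
  induction T using Finset.induction_on with
  | empty => simpa [cT] using h0
  | insert p T hp ih =>
    intro n
    rw [Finset.card_insert_of_notMem hp]
    have hcT : cT deg q (insert p T) = (1 - (q ^ deg p)⁻¹) * cT deg q T := by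
      unfold cT; rw [Finset.prod_insert hp]
    have hpos := cT_nonneg deg hdeg q hq T
    have hle := cT_le_one deg hdeg q hq T
    have hqp : 0 < q ^ deg p := by positivity
    rw [hcT]
    by_cases hn : n < deg p
    · rw [FT_insert_lt deg hfin T p n hn]
      have h1 := ih n
      have e : ((FT deg hfin T n).card : ℝ) - c * ((1 - (q ^ deg p)⁻¹) * cT deg q T) * q ^ n
        = (((FT deg hfin T n).card : ℝ) - c * cT deg q T * q ^ n)
          + c * cT deg q T * (q ^ n / q ^ deg p) := by ring
      rw [e]
      have h2 : q ^ n / q ^ deg p ≤ 1 := by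
        rw [div_le_one hqp]; exact pow_le_pow_right₀ hq.le hn.le
      have h3 : 0 ≤ q ^ n / q ^ deg p := by positivity
      have h4 : |c * cT deg q T * (q ^ n / q ^ deg p)| ≤ A * 2 ^ T.card * Q ^ n := by
        rw [abs_of_nonneg (by positivity)]
        calc c * cT deg q T * (q ^ n / q ^ deg p) ≤ c * 1 * 1 := by gcongr
          _ = c * 1 * 1 := rfl
          _ ≤ A * 2 ^ T.card * Q ^ n := by
            have hA : 0 ≤ A := by linarith
            have i1 : (1 : ℝ) ≤ 2 ^ T.card := one_le_pow₀ (by norm_num)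
            have i2 : (1 : ℝ) ≤ Q ^ n := one_le_pow₀ hQ.le
            gcongr
      refine (abs_add_le _ _).trans ((add_le_add h1 h4).trans (le_of_eq (by ring)))
    · obtain ⟨k, rfl⟩ : ∃ k, n = k + deg p := ⟨n - deg p, by omega⟩
      have h1 := card_FT_rec deg hfin T p hp k
      have h1' : ((FT deg hfin T (k + deg p)).card : ℝ) =
        (FT deg hfin (insert p T) (k + deg p)).card + (FT deg hfin T k).card := by
        exact_mod_cast h1
      have e : ((FT deg hfin (insert p T) (k + deg p)).card : ℝ)
          - c * ((1 - (q ^ deg p)⁻¹) * cT deg q T) * q ^ (k + deg p)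
        = (((FT deg hfin T (k + deg p)).card : ℝ) - c * cT deg q T * q ^ (k + deg p))
          - (((FT deg hfin T k).card : ℝ) - c * cT deg q T * q ^ k) := by
        rw [h1', pow_add]; field_simp; ring
      rw [e]
      have hA : 0 < A := by linarith
      have h5 : A * 2 ^ T.card * Q ^ k ≤ A * 2 ^ T.card * Q ^ (k + deg p) := by
        gcongr
        · exact hQ.le
        · omega
      refine (abs_sub _ _).trans ((add_le_add (ih _) ((ih k).trans h5)).trans (le_of_eq (by ring)))

noncomputable def ET (q : ℝ) (T : Finset P) (m : ℕ) : ℝ :=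
  ∑ j ∈ Finset.range (m + 1), ((FT deg hfin T j).card : ℝ) * (q ^ j)⁻¹

lemma ET_rec (q : ℝ) (hq : 1 < q) (T : Finset P) (p : P) (hp : p ∉ T) (m : ℕ) :
    (1 - (q ^ deg p)⁻¹) * ET deg hfin q T m ≤ ET deg hfin q (insert p T) m := by
  have hqp : 0 < q ^ deg p := by positivity
  have key : ET deg hfin q T m - ET deg hfin q (insert p T) m
      ≤ (q ^ deg p)⁻¹ * ET deg hfin q T m := by
    unfold ET
    rw [← Finset.sum_sub_distrib, Finset.mul_sum]
    have hz : ∀ j, j < deg p → ((FT deg hfin T j).card : ℝ) * (q ^ j)⁻¹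
        - ((FT deg hfin (insert p T) j).card : ℝ) * (q ^ j)⁻¹ = 0 := by
      intro j hj
      rw [FT_insert_lt deg hfin T p j hj]; ring
    have hs : ∀ k, ((FT deg hfin T (k + deg p)).card : ℝ) * (q ^ (k + deg p))⁻¹
        - ((FT deg hfin (insert p T) (k + deg p)).card : ℝ) * (q ^ (k + deg p))⁻¹
        = (q ^ deg p)⁻¹ * (((FT deg hfin T k).card : ℝ) * (q ^ k)⁻¹) := by
      intro k
      rw [card_FT_rec deg hfin T p hp k, pow_add]
      push_cast
      field_simp
      ring
    have hnn : ∀ k, 0 ≤ (q ^ deg p)⁻¹ * (((FT deg hfin T k).card : ℝ) * (q ^ k)⁻¹) := by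
      intro k
      positivity
    by_cases hm : m + 1 ≤ deg p
    · rw [Finset.sum_eq_zero]
      · exact Finset.sum_nonneg fun k _ => hnn k
      · intro j hj
        exact hz j (by simp at hj; omega)
    · obtain ⟨r, hr⟩ : ∃ r, m + 1 = deg p + r := ⟨m + 1 - deg p, by omega⟩
      rw [hr, Finset.sum_range_add, Finset.sum_eq_zero, zero_add]
      · rw [← hr]
        calc _ = ∑ k ∈ Finset.range r, (q ^ deg p)⁻¹ * (((FT deg hfin T k).card : ℝ) * (q ^ k)⁻¹) := by
              refine Finset.sum_congr rfl fun k _ => ?_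
              rw [add_comm (deg p) k, hs]
          _ ≤ _ := Finset.sum_le_sum_of_subset_of_nonneg
              (Finset.range_subset_range.2 (by omega)) (fun k _ _ => hnn k)
      · intro j hj
        exact hz j (by simpa using hj)
  linarith

lemma ET_prod (hdeg : ∀ p, 0 < deg p) (q : ℝ) (hq : 1 < q) (T : Finset P) (m : ℕ) :
    cT deg q T * ET deg hfin q ∅ m ≤ ET deg hfin q T m := by
  induction T using Finset.induction_on with
  | empty => simp [cT]
  | insert p T hp ih =>
    refine le_trans ?_ (ET_rec deg hfin q hq T p hp m)
    unfold cT at *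
    rw [Finset.prod_insert hp, mul_assoc]
    exact mul_le_mul_of_nonneg_left ih (fac_bounds deg hdeg q hq p).1

lemma ET_one (q : ℝ) (T : Finset P) (m : ℕ) (hT : ∀ p, deg p ≤ m → p ∈ T) :
    ET deg hfin q T m ≤ 1 := by
  have h : ∀ j ≤ m, ∀ g ∈ FT deg hfin T j, g = 0 := by
    intro j hj g hg
    rw [mem_FT] at hg
    ext p
    by_contra hp
    obtain ⟨h, rfl⟩ := exists_sub_single g p hp
    have h1 := hg.1
    rw [degG_add', degG_single'] at h1
    exact hp (hg.2 p (hT p (by omega)))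
  have h0 : ∀ j, j + 1 ≤ m → FT deg hfin T (j + 1) = ∅ := by
    intro j hj
    rw [Finset.eq_empty_iff_forall_notMem]
    intro g hg
    have := h _ hj g hg
    subst this
    rw [mem_FT] at hg
    simp [degG] at hg
  unfold ET
  rw [Finset.sum_range_succ', Finset.sum_eq_zero]
  · have : (FT deg hfin T 0).card ≤ 1 := by
      rw [Finset.card_le_one]
      intro a ha b hb
      rw [h 0 (by omega) a ha, h 0 (by omega) b hb]
    simpa using this
  · intro j hj
    rw [h0 j (by simp at hj; omega)]
    simp

lemma dmin0_le (g : P →₀ ℕ) (p : P) (hp : g p ≠ 0) : dmin0 deg g ≤ deg p := by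
  have hs : p ∈ g.support := by simpa using hp
  unfold dmin0
  rw [dif_pos ⟨p, hs⟩]
  exact Finset.inf'_le _ hs

lemma exists_dmin0 (g : P →₀ ℕ) (p : P) (hp : g p ≠ 0) :
    ∃ p', g p' ≠ 0 ∧ deg p' = dmin0 deg g := by
  have hs : p ∈ g.support := by simpa using hp
  have hne : g.support.Nonempty := ⟨p, hs⟩
  obtain ⟨p', h1, h2⟩ := Finset.exists_mem_eq_inf' hne deg
  refine ⟨p', by simpa using h1, ?_⟩
  unfold dmin0
  rw [dif_pos hne, h2]

/-- primes of `T` of degree at most `deg p`, other than `p`. -/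
noncomputable def UT (T : Finset P) (p : P) : Finset P :=
  (T.filter (fun x => deg x ≤ deg p)).erase p

lemma unique_min_iff (m : ℕ) (T : Finset P) (hT : ∀ p, p ∈ T ↔ deg p ≤ m) (g : P →₀ ℕ) (p : P)
    (hp : p ∈ T) (hgp : g p ≠ 0) :
    (∀ x ∈ UT deg T p, g x = 0) ↔
      (deg p = dmin0 deg g ∧ ∀ x ∈ g.support, deg x = dmin0 deg g → x = p) := by
  have hpm := (hT p).1 hp
  constructor
  · intro H
    have key : ∀ x, g x ≠ 0 → deg x ≤ deg p → x = p := by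
      intro x hx hd
      by_contra hne
      exact hx (H x (by simp [UT, hne, hd, hT]; omega))
    have hd : deg p = dmin0 deg g := by
      obtain ⟨x, hx, hxd⟩ := exists_dmin0 deg g p hgp
      have := key x hx (by rw [hxd]; exact dmin0_le deg g p hgp)
      rw [← this, hxd]
    refine ⟨hd, fun x hx hxd => key x (by simpa using hx) (by omega)⟩
  · rintro ⟨h1, h2⟩ x hx
    simp only [UT, Finset.mem_erase, Finset.mem_filter] at hx
    by_contra hgx
    have := dmin0_le deg g x hgx
    exact hx.1 (h2 x (by simpa using hgx) (by omega))

lemma pointwise (m : ℕ) (T : Finset P) (hT : ∀ p, p ∈ T ↔ deg p ≤ m) (S : Set P) (f : ℕ → ℂ)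
    (g : P →₀ ℕ) :
    (muG g : ℂ) * (if inDistinguished deg S g then 1 else 0) * f (dmin0 deg g) =
      (∑ p ∈ T, (if p ∈ S then f (deg p) else 0) *
        (if (∀ x ∈ UT deg T p, g x = 0) ∧ ¬ g p = 0 then (muG g : ℂ) else 0)) +
      (if ∀ p ∈ T, g p = 0 then
        (muG g : ℂ) * (if inDistinguished deg S g then 1 else 0) * f (dmin0 deg g) else 0) := by
  by_cases h0 : ∀ p ∈ T, g p = 0
  · rw [if_pos h0, Finset.sum_eq_zero, zero_add]
    intro p hp
    exact mul_eq_zero_of_right _ (if_neg (fun h => h.2 (h0 p hp)))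
  · rw [if_neg h0, add_zero]
    push Not at h0
    obtain ⟨p1, hp1, hgp1⟩ := h0
    have hd1 := dmin0_le deg g p1 hgp1
    have hp1m := (hT p1).1 hp1
    by_cases hD : inDistinguished deg S g
    · rw [if_pos hD]
      rcases hD with rfl | ⟨p, hps, hpd, hpS, hu⟩
      · simp at hgp1
      have hgp : g p ≠ 0 := by simpa using hps
      have hpT : p ∈ T := (hT p).2 (by omega)
      rw [Finset.sum_eq_single_of_mem p hpT]
      · rw [if_pos hpS, if_pos ⟨(unique_min_iff deg m T hT g p hpT hgp).2 ⟨hpd, hu⟩, hgp⟩, hpd]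
        ring
      · intro x hx hxp
        refine mul_eq_zero_of_right _ (if_neg ?_)
        rintro ⟨h1, h2⟩
        have h3 := (unique_min_iff deg m T hT g x hx h2).1 h1
        exact hxp (hu x (by simpa using h2) h3.1)
    · rw [if_neg hD, Finset.sum_eq_zero]
      · ring
      intro p hp
      by_cases hpS : p ∈ S
      · refine mul_eq_zero_of_right _ (if_neg ?_)
        rintro ⟨h1, h2⟩
        have h3 := (unique_min_iff deg m T hT g p hp h2).1 h1
        exact hD (Or.inr ⟨p, by simpa using h2, h3.1, hpS, h3.2⟩)
      · rw [if_neg hpS, zero_mul]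

lemma abs_muG_le (g : P →₀ ℕ) : ‖(muG g : ℂ)‖ ≤ 1 := by
  unfold muG
  split_ifs <;> simp

lemma per_degree (m : ℕ) (T : Finset P) (hT : ∀ p, p ∈ T ↔ deg p ≤ m) (S : Set P) (f : ℕ → ℂ)
    (B : ℝ) (hB : ∀ k, ‖f k‖ ≤ B) (j : ℕ) (X : ℝ)
    (hX : ∀ T' ⊆ T, |MT deg hfin T' j| ≤ X) :
    ‖∑ g ∈ (hfin j).toFinset,
      (muG g : ℂ) * (if inDistinguished deg S g then 1 else 0) * f (dmin0 deg g)‖ ≤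
      B * (2 * X * T.card) + B * (FT deg hfin T j).card := by
  have hB0 : 0 ≤ B := (norm_nonneg _).trans (hB 0)
  rw [Finset.sum_congr rfl (fun g _ => pointwise deg m T hT S f g), Finset.sum_add_distrib]
  refine (norm_add_le _ _).trans (add_le_add ?_ ?_)
  · rw [Finset.sum_comm]
    refine (norm_sum_le _ _).trans ?_
    have : ∀ p ∈ T, ‖∑ g ∈ (hfin j).toFinset, (if p ∈ S then f (deg p) else 0) *
        (if (∀ x ∈ UT deg T p, g x = 0) ∧ ¬ g p = 0 then (muG g : ℂ) else 0)‖ ≤ B * (2 * X) := by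
      intro p hp
      rw [← Finset.mul_sum, norm_mul]
      have h1 : ‖(if p ∈ S then f (deg p) else 0)‖ ≤ B := by
        split_ifs
        · exact hB _
        · simpa using hB0
      have h2 : ∑ g ∈ (hfin j).toFinset,
          (if (∀ x ∈ UT deg T p, g x = 0) ∧ ¬ g p = 0 then (muG g : ℂ) else 0) =
          ((MT deg hfin (UT deg T p) j - MT deg hfin (insert p (UT deg T p)) j : ℝ) : ℂ) := by
        rw [← Finset.sum_filter, ← Finset.filter_filter]
        unfold MT
        rw [FT_insert, ← Finset.sum_filter_add_sum_filter_not
          (s := FT deg hfin (UT deg T p) j) (fun g => g p = 0)]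
        rw [add_sub_cancel_left]
        push_cast
        rfl
      have h3 : UT deg T p ⊆ T := (Finset.erase_subset _ _).trans (Finset.filter_subset _ _)
      have h4 : insert p (UT deg T p) ⊆ T := Finset.insert_subset hp h3
      rw [h2, Complex.norm_real, Real.norm_eq_abs]
      refine mul_le_mul h1 ?_ (abs_nonneg _) hB0
      refine (abs_sub _ _).trans ?_
      linarith [hX _ h3, hX _ h4]
    refine (Finset.sum_le_sum this).trans (le_of_eq ?_)
    rw [Finset.sum_const, nsmul_eq_mul]; ring
  · rw [← Finset.sum_filter]
    refine (norm_sum_le _ _).trans ?_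
    have : ∀ g ∈ FT deg hfin T j, ‖(muG g : ℂ) * (if inDistinguished deg S g then 1 else 0) *
        f (dmin0 deg g)‖ ≤ B := by
      intro g _
      rw [norm_mul, norm_mul]
      have h1 := abs_muG_le g
      have h2 : ‖(if inDistinguished deg S g then (1 : ℂ) else 0)‖ ≤ 1 := by
        split_ifs <;> simp
      calc _ ≤ 1 * 1 * B := by gcongr; exact hB _
        _ = B := by ring
    refine (Finset.sum_le_sum this).trans (le_of_eq ?_)
    rw [Finset.sum_const, nsmul_eq_mul]; ring

end Aux

lemma loglog_facts (n : ℕ) (hn : 3 ≤ n) :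
    1 ≤ Real.log n ∧ 0 < Real.log (Real.log n) ∧ Real.log (Real.log n) ≤ Real.log n ∧
      Real.log (Real.log n) ≤ n := by
  have hn' : (3 : ℝ) ≤ n := by exact_mod_cast hn
  have h1 : 1 < Real.log n := by
    rw [Real.lt_log_iff_exp_lt (by linarith)]
    linarith [Real.exp_one_lt_d9]
  have h2 := Real.log_pos h1
  have h3 : Real.log (Real.log n) ≤ Real.log n := by
    have := Real.log_le_sub_one_of_pos (show (0 : ℝ) < Real.log n by linarith)
    linarith
  have h4 : Real.log n ≤ n := by
    have := Real.log_le_sub_one_of_pos (show (0 : ℝ) < n by linarith)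
    linarith
  exact ⟨h1.le, h2, h3, h3.trans h4⟩

lemma analytic (q Q L C1 : ℝ) (hQ : 1 < Q) (hQq : Q < q) (hL : 1 ≤ L) (hC1 : 0 ≤ C1) :
    ∃ Z : ℝ, 0 ≤ Z ∧ ∀ n : ℕ, 3 ≤ n → ∃ m : ℕ,
      (1 / ((m : ℝ) + 1) ≤ Z / Real.log (Real.log n)) ∧
      ∀ t : ℕ, (t : ℝ) ≤ C1 * q ^ m →
        ((n : ℝ) + 1) * L ^ t * Q ^ n ≤ Z * q ^ n / Real.log (Real.log n) := by
  have hq : 1 < q := hQ.trans hQq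
  have hlq : 0 < Real.log q := Real.log_pos hq
  set ε := Real.log q - Real.log Q with hε
  have hε0 : 0 < ε := by
    have := Real.log_lt_log (by linarith) hQq
    linarith
  set E := C1 * Real.log L + 4 with hE
  have hlL : 0 ≤ Real.log L := Real.log_nonneg hL
  set Z1 := 2 * Real.exp (E ^ 2 / (4 * ε)) with hZ1
  have hZ10 : 0 ≤ Z1 := by positivity
  refine ⟨Z1 + 2 * Real.log q, by positivity, fun n hn => ?_⟩
  obtain ⟨l1, l2, l3, l4⟩ := loglog_facts n hn
  have hn' : (3 : ℝ) ≤ n := by exact_mod_cast hn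
  have hn0 : (0 : ℝ) < n := by linarith
  refine ⟨⌊Real.log n / (2 * Real.log q)⌋₊, ?_, ?_⟩
  · have := Nat.lt_floor_add_one (Real.log n / (2 * Real.log q))
    set m := ⌊Real.log n / (2 * Real.log q)⌋₊
    rw [div_lt_iff₀ (by positivity)] at this
    rw [div_le_div_iff₀ (by positivity) l2]
    have h3 : 0 ≤ Z1 * ((m : ℝ) + 1) := by positivity
    nlinarith
  · have hm := Nat.floor_le (show 0 ≤ Real.log n / (2 * Real.log q) by positivity)
    set m := ⌊Real.log n / (2 * Real.log q)⌋₊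
    rw [le_div_iff₀ (by positivity)] at hm
    intro t ht
    set s := Real.sqrt n with hs
    have hs2 : s ^ 2 = n := Real.sq_sqrt hn0.le
    have hs0 : 0 ≤ s := Real.sqrt_nonneg _
    have hqm : q ^ m ≤ s := by
      apply Real.le_sqrt_of_sq_le
      rw [← Real.log_le_log_iff (by positivity) hn0, Real.log_pow, Real.log_pow]
      push_cast
      linarith
    have hLt : L ^ t ≤ Real.exp (C1 * Real.log L * s) := by
      rw [← Real.log_le_iff_le_exp (by positivity), Real.log_pow]
      calc (t : ℝ) * Real.log L ≤ (C1 * s) * Real.log L := by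
            gcongr
            exact ht.trans (by gcongr)
        _ = _ := by ring
    have hse : s ≤ Real.exp s := by linarith [Real.add_one_le_exp s]
    have hs4 : (n : ℝ) ^ 2 ≤ Real.exp (4 * s) := by
      rw [← hs2, ← pow_mul]
      calc s ^ (2 * 2) ≤ Real.exp s ^ (2 * 2) := by gcongr
        _ = _ := by rw [← Real.exp_nat_mul]; norm_num
    have hquad : E * s ≤ E ^ 2 / (4 * ε) + ε * n := by
      rw [← hs2]
      have : 0 ≤ (2 * ε * s - E) ^ 2 / (4 * ε) := by positivity
      have e : (2 * ε * s - E) ^ 2 / (4 * ε) = ε * s ^ 2 - E * s + E ^ 2 / (4 * ε) := by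
        field_simp
        ring
      linarith
    have hexp : Real.exp (ε * n) * Q ^ n = q ^ n := by
      rw [mul_comm ε, Real.exp_nat_mul, ← mul_pow, hε, Real.exp_sub, Real.exp_log (by linarith),
        Real.exp_log (by linarith), div_mul_cancel₀ _ (by linarith)]
    rw [le_div_iff₀ l2]
    have hQn : 0 < Q ^ n := by positivity
    have hqn : 0 < q ^ n := by positivity
    calc ((n : ℝ) + 1) * L ^ t * Q ^ n * Real.log (Real.log n)
        ≤ (2 * n) * Real.exp (C1 * Real.log L * s) * Q ^ n * n := by
          gcongr
          linarith
      _ = 2 * (n ^ 2 * Real.exp (C1 * Real.log L * s)) * Q ^ n := by ring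
      _ ≤ 2 * (Real.exp (4 * s) * Real.exp (C1 * Real.log L * s)) * Q ^ n := by gcongr
      _ = 2 * Real.exp (E * s) * Q ^ n := by rw [← Real.exp_add, hE]; ring_nf
      _ ≤ 2 * Real.exp (E ^ 2 / (4 * ε) + ε * n) * Q ^ n := by gcongr
      _ = Z1 * q ^ n := by rw [Real.exp_add, hZ1, ← hexp]; ring
      _ ≤ (Z1 + 2 * Real.log q) * q ^ n := by
          gcongr
          linarith

lemma geom_le_aux (q : ℝ) (hq : 1 < q) (m : ℕ) :
    ∑ k ∈ Finset.range (m + 1), q ^ k ≤ q / (q - 1) * q ^ m := by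
  have h : 0 < q - 1 := by linarith
  rw [geom_sum_eq (by linarith), div_mul_eq_mul_div]
  gcongr
  rw [pow_succ]
  linarith

lemma geom_le_inv (r : ℝ) (h0 : 0 ≤ r) (h1 : r < 1) (m : ℕ) :
    ∑ k ∈ Finset.range m, r ^ k ≤ (1 - r)⁻¹ := by
  rw [← tsum_geometric_of_lt_one h0 h1]
  exact (summable_geometric_of_lt_one h0 h1).sum_le_tsum _ (fun i _ => by positivity)

lemma cT_bound {P : Type*} (deg : P → ℕ)
    (hfin : ∀ n : ℕ, {g : P →₀ ℕ | degG deg g = n}.Finite)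
    (hdeg : ∀ p, 0 < deg p) (q Q A c : ℝ) (hQ : 1 < Q) (hQq : Q < q) (hA : 0 ≤ A)
    (h0 : ∀ n, |((FT deg hfin ∅ n).card : ℝ) - c * q ^ n| ≤ A * Q ^ n)
    (T : Finset P) (m : ℕ) (hT : ∀ p, p ∈ T ↔ deg p ≤ m) :
    c * cT deg q T ≤ (1 + A * (1 - Q / q)⁻¹) * (1 / ((m : ℝ) + 1)) := by
  have hq : 1 < q := hQ.trans hQq
  have e1 := (ET_prod deg hfin hdeg q hq T m).trans
    (ET_one deg hfin q T m (fun p hp => (hT p).2 hp))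
  have n1 := cT_nonneg deg hdeg q hq T
  have n2 := cT_le_one deg hdeg q hq T
  set D := A * (1 - Q / q)⁻¹ with hD
  have hr1 : Q / q < 1 := by rw [div_lt_one (by linarith)]; exact hQq
  have hr0 : 0 ≤ Q / q := by positivity
  have hD0 : 0 ≤ D := by
    have : 0 < 1 - Q / q := by linarith
    positivity
  have e2 : c * ((m : ℝ) + 1) - D ≤ ET deg hfin q ∅ m := by
    have : ∀ j, c - A * (Q / q) ^ j ≤ ((FT deg hfin ∅ j).card : ℝ) * (q ^ j)⁻¹ := by
      intro j
      have hqj : 0 < q ^ j := by positivity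
      have := (abs_le.1 (h0 j)).1
      rw [← div_eq_mul_inv, le_div_iff₀ hqj, div_pow]
      have e : (c - A * (Q ^ j / q ^ j)) * q ^ j = c * q ^ j - A * Q ^ j := by
        field_simp
      rw [e]
      linarith
    have h3 : ∑ j ∈ Finset.range (m + 1), (c - A * (Q / q) ^ j) ≤ ET deg hfin q ∅ m :=
      Finset.sum_le_sum fun j _ => this j
    rw [Finset.sum_sub_distrib, ← Finset.mul_sum, Finset.sum_const, Finset.card_range,
      nsmul_eq_mul] at h3
    have h4 := mul_le_mul_of_nonneg_left (geom_le_inv (Q / q) hr0 hr1 (m + 1)) hA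
    push_cast at h3
    linarith
  rw [mul_one_div, le_div_iff₀ (by positivity)]
  have := mul_le_mul_of_nonneg_left e2 n1
  nlinarith

/-- Lemma 2.5: for an Axiom A# semigroup (with the Möbius degree-sum bound and the
abstract PNT), any bounded `f` with `f 0 = 0` and any set `S` of primes,
`∑_{∂(g) ≤ n} μ(g)·1_{D(G,S)}(g)·f(d₋(g)) = O(q^n / log log n)`. -/
theorem moebius_distinguished_average {P : Type*} [Countable P]
    (deg : P → ℕ) (hdeg : ∀ p, 0 < deg p)
    (cG q η : ℝ) (hc : 0 < cG) (hq : 1 < q) (hη0 : 0 ≤ η) (hη1 : η < 1)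
    (hfin : ∀ n : ℕ, {g : P →₀ ℕ | degG deg g = n}.Finite)
    (hfinle : ∀ n : ℕ, {g : P →₀ ℕ | degG deg g ≤ n}.Finite)
    (hfinP : ∀ k : ℕ, {p : P | deg p = k}.Finite)
    (hax : ∃ C : ℝ, ∀ n : ℕ,
      |(Nat.card {g : P →₀ ℕ // degG deg g = n} : ℝ) - cG * q ^ n| ≤ C * q ^ (η * n))
    (hmu : ∃ C : ℝ, ∀ k : ℕ,
      |∑ g ∈ (hfin k).toFinset, (muG g : ℝ)| ≤ C * q ^ (η * k))
    (hpnt : ∃ C : ℝ, ∀ k : ℕ, 1 ≤ k →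
      (Nat.card {p : P // deg p = k} : ℝ) ≤ C * q ^ k / k)
    (S : Set P) (f : ℕ → ℂ) (hf0 : f 0 = 0) (B : ℝ) (hB : ∀ k, ‖f k‖ ≤ B) :
    ∃ C : ℝ, ∀ n : ℕ, 3 ≤ n →
      ‖∑ g ∈ (hfinle n).toFinset,
          (muG g : ℂ) * (if inDistinguished deg S g then 1 else 0) * f (dmin0 deg g)‖
        ≤ C * q ^ n / Real.log (Real.log n) := by
  obtain ⟨C1, hax⟩ := hax
  obtain ⟨C2, hmu⟩ := hmu
  obtain ⟨C3, hpnt⟩ := hpnt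
  have hB0 : 0 ≤ B := (norm_nonneg _).trans (hB 0)
  set η' := max η (1 / 2) with hη'
  have hη'0 : 0 < η' := lt_of_lt_of_le (by norm_num) (le_max_right _ _)
  have hη'1 : η' < 1 := max_lt hη1 (by norm_num)
  set Q := q ^ η' with hQdef
  have hQ : 1 < Q := Real.one_lt_rpow hq hη'0
  have hQq : Q < q := by
    have := Real.rpow_lt_rpow_of_exponent_lt hq hη'1
    simpa using this
  have hpow : ∀ k : ℕ, q ^ (η * k) ≤ Q ^ k := by
    intro k
    rw [hQdef, ← Real.rpow_natCast, ← Real.rpow_mul (by linarith)]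
    apply Real.rpow_le_rpow_of_exponent_le hq.le
    gcongr
    exact le_max_left _ _
  have hpow0 : ∀ k : ℕ, 0 ≤ q ^ (η * k) := fun k => Real.rpow_nonneg (by linarith) _
  set A := |C1| + |C2| + cG with hA
  have a1 := abs_nonneg C1
  have a2 := abs_nonneg C2
  have hA0 : 0 ≤ A := by linarith
  have hcA : cG ≤ A := by linarith
  have hbd : ∀ C : ℝ, |C| ≤ A → ∀ k : ℕ, C * q ^ (η * k) ≤ A * Q ^ k := by
    intro C hC k
    calc C * q ^ (η * k) ≤ A * q ^ (η * k) :=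
          mul_le_mul_of_nonneg_right ((le_abs_self C).trans hC) (hpow0 k)
      _ ≤ A * Q ^ k := mul_le_mul_of_nonneg_left (hpow k) hA0
  have h0 : ∀ n, |((FT deg hfin ∅ n).card : ℝ) - cG * q ^ n| ≤ A * Q ^ n := by
    intro n
    have e : Nat.card {g : P →₀ ℕ // degG deg g = n} = (FT deg hfin ∅ n).card :=
      Nat.subtype_card _ (fun g => by simp [mem_FT])
    rw [← e]
    exact (hax n).trans (hbd C1 (by linarith) n)
  have hM0 : ∀ n, |MT deg hfin ∅ n| ≤ A * Q ^ n := by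
    intro n
    have e : MT deg hfin ∅ n = ∑ g ∈ (hfin n).toFinset, (muG g : ℝ) := by
      unfold MT FT
      rw [Finset.filter_true_of_mem (by simp)]
    rw [e]
    exact (hmu n).trans (hbd C2 (by linarith) n)
  set K := Q / (Q - 1) with hK
  have hQ1 : 0 < Q - 1 := by linarith
  have hK1 : 1 ≤ K := by rw [hK, le_div_iff₀ hQ1]; linarith
  have hq1 : 0 < q - 1 := by linarith
  set G := q / (q - 1) with hG
  have hG0 : 0 ≤ G := by positivity
  obtain ⟨Z, hZ0, hZ⟩ := analytic q Q (2 * K) (|C3| * G) hQ hQq (by linarith) (by positivity)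
  set D := 1 + A * (1 - Q / q)⁻¹ with hD
  have hD0 : 0 ≤ D := by
    have : Q / q < 1 := by rw [div_lt_one (by linarith)]; exact hQq
    have : 0 < 1 - Q / q := by linarith
    positivity
  refine ⟨3 * B * A * Z + B * D * G * Z, fun n hn => ?_⟩
  obtain ⟨m, hm1, hm2⟩ := hZ n hn
  obtain ⟨l1, l2, l3, l4⟩ := loglog_facts n hn
  set T : Finset P := (Finset.range (m + 1)).biUnion (fun k => (hfinP k).toFinset) with hTdef
  have hT : ∀ p, p ∈ T ↔ deg p ≤ m := by
    intro p
    simp [hTdef, Nat.lt_succ_iff]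
  have hTc : (T.card : ℝ) ≤ |C3| * G * q ^ m := by
    have h1 : (T.card : ℝ) ≤ ∑ k ∈ Finset.range (m + 1), ((hfinP k).toFinset.card : ℝ) := by
      exact_mod_cast Finset.card_biUnion_le
    have h2 : ∀ k, ((hfinP k).toFinset.card : ℝ) ≤ |C3| * q ^ k := by
      intro k
      rcases Nat.eq_zero_or_pos k with rfl | hk
      · have : (hfinP 0).toFinset = ∅ := by
          ext p
          simp [(hdeg p).ne']
        rw [this]
        simp
      · have e : Nat.card {p : P // deg p = k} = (hfinP k).toFinset.card :=
          Nat.subtype_card _ (fun g => by simp)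
        rw [← e]
        refine (hpnt k hk).trans ?_
        have hk' : (1 : ℝ) ≤ k := by exact_mod_cast hk
        have hqk : 0 ≤ q ^ k := by positivity
        rw [div_le_iff₀ (by linarith)]
        calc C3 * q ^ k ≤ |C3| * q ^ k := mul_le_mul_of_nonneg_right (le_abs_self _) hqk
          _ ≤ |C3| * q ^ k * k := le_mul_of_one_le_right (by positivity) hk'
    calc (T.card : ℝ) ≤ ∑ k ∈ Finset.range (m + 1), |C3| * q ^ k :=
          h1.trans (Finset.sum_le_sum fun k _ => h2 k)
      _ = |C3| * ∑ k ∈ Finset.range (m + 1), q ^ k := by rw [Finset.mul_sum]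
      _ ≤ |C3| * (G * q ^ m) := by
          gcongr
          exact geom_le_aux q hq m
      _ = _ := by ring
  have hfinal := hm2 T.card hTc
  have hcT := cT_bound deg hfin hdeg q Q A cG hQ hQq hA0 h0 T m hT
  have hcT0 := cT_nonneg deg hdeg q hq T
  set t := T.card with ht
  have hper : ∀ j ∈ Finset.range (n + 1), ‖∑ g ∈ (hfin j).toFinset,
      (muG g : ℂ) * (if inDistinguished deg S g then 1 else 0) * f (dmin0 deg g)‖ ≤
      3 * B * A * ((2 * K) ^ t * Q ^ n) + B * (cG * cT deg q T) * q ^ j := by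
    intro j hj
    have hjn : j ≤ n := by simp at hj; omega
    have hX : ∀ T' ⊆ T, |MT deg hfin T' j| ≤ A * K ^ t * Q ^ j := by
      intro T' hT'
      refine (MT_bound deg hfin hdeg Q A hQ hM0 T' j).trans ?_
      have : K ^ T'.card ≤ K ^ t := pow_le_pow_right₀ hK1 (Finset.card_le_card hT')
      gcongr
    refine (per_degree deg hfin m T hT S f B hB j _ hX).trans ?_
    have hs := (abs_le.1 (sieve deg hfin hdeg q Q A cG hq hQ hc hcA h0 T j)).2
    have hs' : ((FT deg hfin T j).card : ℝ) ≤ cG * cT deg q T * q ^ j + A * 2 ^ t * Q ^ j := by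
      linarith
    have ht2 : (t : ℝ) ≤ 2 ^ t := by exact_mod_cast Nat.lt_two_pow_self.le
    have hQj : Q ^ j ≤ Q ^ n := pow_le_pow_right₀ hQ.le hjn
    have hKt : 1 ≤ K ^ t := one_le_pow₀ hK1
    have hKt0 : 0 ≤ K ^ t := by linarith
    have i1 : A * K ^ t * Q ^ j * t ≤ A * K ^ t * Q ^ n * 2 ^ t := by gcongr
    have i2 : A * 2 ^ t * Q ^ j ≤ A * 2 ^ t * Q ^ n * K ^ t := by
      calc A * 2 ^ t * Q ^ j ≤ A * 2 ^ t * Q ^ n := by gcongr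
        _ ≤ _ := le_mul_of_one_le_right (by positivity) hKt
    rw [mul_pow]
    calc B * (2 * (A * K ^ t * Q ^ j) * t) + B * (FT deg hfin T j).card
        ≤ B * (2 * (A * K ^ t * Q ^ n * 2 ^ t)) +
          B * (cG * cT deg q T * q ^ j + A * 2 ^ t * Q ^ n * K ^ t) := by
          refine add_le_add (mul_le_mul_of_nonneg_left (by linarith) hB0)
            (mul_le_mul_of_nonneg_left (by linarith) hB0)
      _ = _ := by ring
  have hsplit : ∑ g ∈ (hfinle n).toFinset,
      (muG g : ℂ) * (if inDistinguished deg S g then 1 else 0) * f (dmin0 deg g) =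
      ∑ j ∈ Finset.range (n + 1), ∑ g ∈ (hfin j).toFinset,
      (muG g : ℂ) * (if inDistinguished deg S g then 1 else 0) * f (dmin0 deg g) := by
    rw [← Finset.sum_biUnion]
    · refine Finset.sum_congr ?_ fun _ _ => rfl
      ext g
      simp [Nat.lt_succ_iff]
    · intro i _ j _ hij
      rw [Function.onFun, Finset.disjoint_left]
      intro g hg hg'
      simp at hg hg'
      exact hij (hg.symm.trans hg')
  rw [hsplit]
  refine (norm_sum_le _ _).trans ((Finset.sum_le_sum hper).trans ?_)
  rw [Finset.sum_add_distrib, Finset.sum_const, Finset.card_range, nsmul_eq_mul, ← Finset.mul_sum]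
  push_cast
  have j1 : B * (cG * cT deg q T) * ∑ k ∈ Finset.range (n + 1), q ^ k ≤
      B * (D * (Z / Real.log (Real.log n))) * (G * q ^ n) := by
    have hsum : 0 ≤ ∑ k ∈ Finset.range (n + 1), q ^ k :=
      Finset.sum_nonneg fun k _ => by positivity
    have k1 : cG * cT deg q T ≤ D * (Z / Real.log (Real.log n)) :=
      hcT.trans (mul_le_mul_of_nonneg_left hm1 hD0)
    have k2 := geom_le_aux q hq n
    gcongr
  have j2 := mul_le_mul_of_nonneg_left hfinal (show 0 ≤ 3 * B * A by positivity)
  calc _ ≤ 3 * B * A * (Z * q ^ n / Real.log (Real.log n)) +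
        B * (D * (Z / Real.log (Real.log n))) * (G * q ^ n) := by
        refine add_le_add ?_ j1
        refine le_trans (le_of_eq ?_) j2
        ring
    _ = _ := by ring
end

section
/- Let G be a finite connected undirected graph with no degree-1 vertices, with m unoriented edges and ℓ vertices, adjacency matrix A, and diagonal matrix Q with entries q_j = deg(v_j) − 1. Then the Ihara zeta function satisfies ζ_G(z)^{−1} = (1 − z²)^{r−1} · det(I − Az + Qz²), where r = m − ℓ + 1. In particular ζ_G(z) has no zeros. -/
open scoped Classical
open Finset Filter SimpleGraph

/-- The number of equivalence classes (up to cyclic rotation) of primitive closed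
backtrackless tailless paths of length `n` in `G`: such a path is a cyclic sequence of
darts in which each dart follows the previous one without backtracking, which is not a
proper power; each primitive class of length `n` has exactly `n` representatives. -/
noncomputable def primeCycleCount {V : Type*} (G : SimpleGraph V) (n : ℕ) : ℕ :=
  Nat.card {c : ZMod n → G.Dart //
    (∀ i : ZMod n, (c (i + 1)).toProd.1 = (c i).toProd.2 ∧ c (i + 1) ≠ (c i).symm) ∧
    ∀ d : ℕ, d ∣ n → d < n → ¬ ∀ i : ZMod n, c (i + (d : ZMod n)) = c i} / n

/-- The Ihara zeta function `ζ_G(z) = ∏_{[P]} (1 − z^{ν(P)})⁻¹ = ∏_n (1 − z^n)^{−π(n)}`. -/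
noncomputable def iharaZeta {V : Type*} (G : SimpleGraph V) (z : ℂ) : ℂ :=
  ∏' n : ℕ, (((1 : ℂ) - z ^ (n + 1)) ^ primeCycleCount G (n + 1))⁻¹

namespace IB

theorem det_aeval {D : Type*} [Fintype D] [DecidableEq D] (B : Matrix D D ℂ) (p : Polynomial ℂ) :
    (Polynomial.aeval B p).det = (B.charpoly.roots.map (fun x => p.eval x)).prod := by
  have hcard : B.charpoly.roots.card = Fintype.card D := by
    rw [← (IsAlgClosed.splits B.charpoly).natDegree_eq_card_roots, Matrix.charpoly_natDegree_eq_dim]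
  have h1 : ∀ a : ℂ, (Polynomial.aeval B (Polynomial.X - Polynomial.C a)).det
      = (B.charpoly.roots.map (fun x => x - a)).prod := by
    intro a
    have e1 : Polynomial.aeval B (Polynomial.X - Polynomial.C a) = - (Matrix.scalar D a - B) := by
      simp [Matrix.scalar_apply, Matrix.algebraMap_eq_diagonal, Pi.algebraMap_def]
    rw [e1, Matrix.det_neg, ← Matrix.eval_charpoly]
    conv_lhs => rw [(IsAlgClosed.splits B.charpoly).eq_prod_roots_of_monic B.charpoly_monic]
    rw [Polynomial.eval_multiset_prod, Multiset.map_map, ← hcard]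
    rw [← Multiset.card_map (Polynomial.eval a ∘ fun x => Polynomial.X - Polynomial.C x),
      ← Multiset.prod_map_neg, Multiset.map_map]
    simp
  have h2 : ∀ s : Multiset ℂ, (Polynomial.aeval B (s.map (fun a => Polynomial.X - Polynomial.C a)).prod).det
      = (B.charpoly.roots.map (fun x => (s.map (fun a => x - a)).prod)).prod := by
    intro s
    induction s using Multiset.induction_on with
    | empty => simp
    | cons a s ih =>
      rw [Multiset.map_cons, Multiset.prod_cons, map_mul, Matrix.det_mul, ih, h1]
      simp [Multiset.prod_map_mul]
  have hp := (IsAlgClosed.splits p).eq_prod_roots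
  conv_lhs => rw [hp]
  rw [map_mul, Matrix.det_mul, h2]
  have h3 : (Polynomial.aeval B (Polynomial.C p.leadingCoeff)).det
    = (B.charpoly.roots.map (fun x => p.leadingCoeff)).prod := by
    rw [Multiset.map_const', Multiset.prod_replicate, hcard]
    simp [Matrix.algebraMap_eq_diagonal, Matrix.det_diagonal]
  rw [h3, ← Multiset.prod_map_mul]
  congr 1
  apply Multiset.map_congr rfl
  intro x _
  conv_rhs => rw [hp]
  simp [Polynomial.eval_multiset_prod, Multiset.map_map]

theorem trace_pow' {D : Type*} [Fintype D] [DecidableEq D] (B : Matrix D D ℂ) (n : ℕ) :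
    (B ^ n).trace = (B.charpoly.roots.map (fun x => x ^ n)).sum := by
  have : (B ^ n).charpoly = (B.charpoly.roots.map (fun x => Polynomial.X - Polynomial.C (x ^ n))).prod := by
    apply Polynomial.funext
    intro y
    rw [Matrix.eval_charpoly, Polynomial.eval_multiset_prod, Multiset.map_map]
    have := det_aeval B (Polynomial.C y - Polynomial.X ^ n)
    simp only [map_sub, Polynomial.aeval_C, map_pow, Polynomial.aeval_X] at this
    have e : Matrix.scalar D y = algebraMap ℂ (Matrix D D ℂ) y := by
      simp [Matrix.scalar_apply, Matrix.algebraMap_eq_diagonal, Pi.algebraMap_def]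
    rw [e, this]
    simp
  rw [Matrix.trace_eq_sum_roots_charpoly, this]
  have e : (B.charpoly.roots.map (fun x => Polynomial.X - Polynomial.C (x ^ n)))
    = ((B.charpoly.roots.map (fun x => x ^ n)).map (fun x => Polynomial.X - Polynomial.C x)) := by
    rw [Multiset.map_map]; rfl
  rw [e, Polynomial.roots_multiset_prod_X_sub_C]

theorem det_one_sub' {D : Type*} [Fintype D] [DecidableEq D] (B : Matrix D D ℂ) (z : ℂ) :
    (1 - z • B).det = (B.charpoly.roots.map (fun x => 1 - z * x)).prod := by
  have := det_aeval B (1 - Polynomial.C z * Polynomial.X)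
  rw [Algebra.smul_def]
  simp at this
  exact this

theorem log_aux (z : ℂ) (s : Multiset ℂ) (h : ∀ x ∈ s, ‖z * x‖ < 1) :
    ∃ L : ℂ, HasSum (fun n : ℕ => (s.map (fun x => x ^ n)).sum * z ^ n / n) L ∧
      Complex.exp L * (s.map (fun x => 1 - z * x)).prod = 1 := by
  induction s using Multiset.induction_on with
  | empty => exact ⟨0, by simpa using hasSum_zero, by simp⟩
  | cons a s ih =>
    obtain ⟨L, hL, hE⟩ := ih (fun x hx => h x (Multiset.mem_cons_of_mem hx))
    have ha := h a (Multiset.mem_cons_self a s)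
    refine ⟨-Complex.log (1 - z * a) + L, ?_, ?_⟩
    · convert (Complex.hasSum_taylorSeries_neg_log ha).add hL using 2 with n
      simp only [Multiset.map_cons, Multiset.sum_cons]
      ring
    · have : (1 - z * a) ≠ 0 := by
        intro h0
        rw [sub_eq_zero] at h0
        rw [← h0] at ha; simp at ha
      rw [Multiset.map_cons, Multiset.prod_cons, Complex.exp_add, Complex.exp_neg, Complex.exp_log this]
      field_simp
      linear_combination hE

theorem trace_log {D : Type*} [Fintype D] [DecidableEq D] (B : Matrix D D ℂ) :
    ∃ R : ℝ, 0 < R ∧ ∀ z : ℂ, ‖z‖ < R → ∃ L : ℂ,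
      HasSum (fun n : ℕ => (B ^ n).trace * z ^ n / n) L ∧ Complex.exp L * (1 - z • B).det = 1 := by
  have hb : ∃ C : ℝ, 0 < C ∧ ∀ x ∈ B.charpoly.roots, ‖x‖ ≤ C := by
    induction B.charpoly.roots using Multiset.induction_on with
    | empty => exact ⟨1, by simp⟩
    | cons a s ih =>
      obtain ⟨C, hC, h⟩ := ih
      refine ⟨max C ‖a‖, lt_max_of_lt_left hC, ?_⟩
      intro x hx
      rcases Multiset.mem_cons.1 hx with rfl | hx
      · exact le_max_right _ _
      · exact (h x hx).trans (le_max_left _ _)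
  obtain ⟨C, hC, h⟩ := hb
  refine ⟨C⁻¹, by positivity, fun z hz => ?_⟩
  obtain ⟨L, h1, h2⟩ := log_aux z B.charpoly.roots (fun x hx => by
    rw [norm_mul]
    calc ‖z‖ * ‖x‖ ≤ ‖z‖ * C := by gcongr; exact h x hx
      _ < C⁻¹ * C := by gcongr
      _ = 1 := inv_mul_cancel₀ hC.ne')
  exact ⟨L, by simpa only [trace_pow'] using h1, by rw [det_one_sub']; exact h2⟩

/-- cyclic sequences -/
def Cyc {D : Type*} (r : D → D → Prop) (n : ℕ) : Type _ :=
  {c : ZMod n → D // ∀ i, r (c i) (c (i + 1))}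

def Pr {D : Type*} (r : D → D → Prop) (n : ℕ) : Type _ :=
  {c : ZMod n → D // (∀ i, r (c i) (c (i + 1))) ∧
    ∀ d : ℕ, d ∣ n → d < n → ¬ ∀ i : ZMod n, c (i + (d : ZMod n)) = c i}

def shift {D : Type*} (s : ℕ → D) : ℕ → D := fun i => s (i + 1)

theorem shift_iter {D : Type*} (s : ℕ → D) (n : ℕ) : shift^[n] s = fun i => s (i + n) := by
  induction n with
  | zero => rfl
  | succ n ih => rw [Function.iterate_succ_apply', ih]; funext i; simp only [shift]; congr 1; omega

theorem isPer_iff {D : Type*} (s : ℕ → D) (n : ℕ) :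
    Function.IsPeriodicPt shift n s ↔ Function.Periodic s n := by
  rw [Function.IsPeriodicPt, Function.IsFixedPt, shift_iter, funext_iff]; rfl

def perSet {D : Type*} (r : D → D → Prop) (n : ℕ) : Set (ℕ → D) :=
  {s | (∀ i, r (s i) (s (i + 1))) ∧ Function.IsPeriodicPt shift n s}

def primSet {D : Type*} (r : D → D → Prop) (n : ℕ) : Set (ℕ → D) :=
  {s | (∀ i, r (s i) (s (i + 1))) ∧ Function.minimalPeriod shift s = n}

theorem lift_inj {D : Type*} (n : ℕ) [NeZero n] :
    Function.Injective (fun (c : ZMod n → D) (i : ℕ) => c (i : ZMod n)) := by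
  intro c c' h
  funext x
  have := congrFun h x.val
  simpa using this

theorem lift_per {D : Type*} (n : ℕ) [NeZero n] (s : ℕ → D) (h : Function.IsPeriodicPt shift n s) :
    (fun i : ℕ => (fun x : ZMod n => s x.val) (i : ZMod n)) = s := by
  funext i
  simp only [ZMod.val_natCast]
  exact Function.Periodic.map_mod_nat ((isPer_iff s n).1 h) i

theorem lift_isPer {D : Type*} (n : ℕ) (c : ZMod n → D) (d : ℕ) [NeZero n] :
    Function.IsPeriodicPt shift d (fun i : ℕ => c (i : ZMod n)) ↔
      ∀ i : ZMod n, c (i + (d : ZMod n)) = c i := by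
  rw [isPer_iff]
  constructor
  · intro h i
    have := h i.val
    simpa using this
  · intro h i
    simpa using h i

theorem lift_r {D : Type*} (r : D → D → Prop) (n : ℕ) (c : ZMod n → D) [NeZero n] :
    (∀ i : ℕ, r (c (i : ZMod n)) (c ((i + 1 : ℕ) : ZMod n))) ↔ ∀ i, r (c i) (c (i + 1)) := by
  constructor
  · intro h i
    have := h i.val
    simpa using this
  · intro h i
    simpa using h i

theorem perSet_eq {D : Type*} (r : D → D → Prop) (n : ℕ) [NeZero n] :
    perSet r n = (fun (c : ZMod n → D) (i : ℕ) => c (i : ZMod n)) ''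
      {c | ∀ i, r (c i) (c (i + 1))} := by
  ext s
  constructor
  · rintro ⟨h1, h2⟩
    have e := lift_per n s h2
    refine ⟨fun x : ZMod n => s x.val, ?_, e⟩
    rw [← e] at h1
    exact (lift_r r n (fun x : ZMod n => s x.val)).1 h1
  · rintro ⟨c, hc, rfl⟩
    exact ⟨(lift_r r n c).2 hc, (lift_isPer n c n).2 (by simp)⟩

theorem minPer_iff {D : Type*} (n : ℕ) [NeZero n] (s : ℕ → D) :
    Function.minimalPeriod shift s = n ↔ Function.IsPeriodicPt shift n s ∧
      ∀ d : ℕ, d ∣ n → d < n → ¬ Function.IsPeriodicPt shift d s := by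
  constructor
  · intro h
    refine ⟨h ▸ Function.isPeriodicPt_minimalPeriod _ _, fun d hd hlt hp => ?_⟩
    have hd0 : 0 < d := Nat.pos_of_dvd_of_pos hd (NeZero.pos n)
    have := hp.minimalPeriod_le hd0
    omega
  · rintro ⟨h1, h2⟩
    have := h1.minimalPeriod_dvd
    by_contra hne
    exact h2 _ this (lt_of_le_of_ne (Nat.le_of_dvd (NeZero.pos n) this) hne)
      (Function.isPeriodicPt_minimalPeriod _ _)

theorem primSet_eq {D : Type*} (r : D → D → Prop) (n : ℕ) [NeZero n] :
    primSet r n = (fun (c : ZMod n → D) (i : ℕ) => c (i : ZMod n)) ''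
      {c | (∀ i, r (c i) (c (i + 1))) ∧
        ∀ d : ℕ, d ∣ n → d < n → ¬ ∀ i : ZMod n, c (i + (d : ZMod n)) = c i} := by
  ext s
  constructor
  · rintro ⟨h1, h2⟩
    rw [minPer_iff] at h2
    obtain ⟨h2, h3⟩ := h2
    have e := lift_per n s h2
    refine ⟨fun x : ZMod n => s x.val, ⟨?_, ?_⟩, e⟩
    · rw [← e] at h1
      exact (lift_r r n (fun x : ZMod n => s x.val)).1 h1
    · intro d hd hlt
      have := lift_isPer n (fun x : ZMod n => s x.val) d
      rw [e] at this
      exact fun h => h3 d hd hlt (this.2 h)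
  · rintro ⟨c, hc, rfl⟩
    refine ⟨(lift_r r n c).2 hc.1, (minPer_iff _ _).2 ⟨(lift_isPer n c n).2 (by simp), ?_⟩⟩
    intro d hd hlt
    rw [lift_isPer]
    exact hc.2 d hd hlt

theorem card_perSet {D : Type*} (r : D → D → Prop) (n : ℕ) [NeZero n] :
    (perSet r n).ncard = Nat.card (Cyc r n) := by
  rw [perSet_eq, Set.ncard_image_of_injective _ (lift_inj n)]; rfl

theorem card_primSet {D : Type*} (r : D → D → Prop) (n : ℕ) [NeZero n] :
    (primSet r n).ncard = Nat.card (Pr r n) := by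
  rw [primSet_eq, Set.ncard_image_of_injective _ (lift_inj n)]; rfl

theorem cyc_eq_sum {D : Type*} [Finite D] (r : D → D → Prop) (n : ℕ) [NeZero n] :
    Nat.card (Cyc r n) = ∑ d ∈ n.divisors, Nat.card (Pr r d) := by
  rw [← card_perSet]
  have hfin : (perSet r n).Finite := by
    rw [perSet_eq]; exact Set.toFinite _
  rw [Set.ncard_eq_toFinset_card _ hfin]
  rw [Finset.card_eq_sum_card_fiberwise (f := fun s => Function.minimalPeriod shift s)
    (t := n.divisors)]
  · apply Finset.sum_congr rfl
    intro d hd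
    have hdn := Nat.dvd_of_mem_divisors hd
    have : NeZero d := ⟨(Nat.pos_of_mem_divisors hd).ne'⟩
    rw [← card_primSet, ← Set.ncard_coe_finset]
    congr 1
    ext s
    simp only [coe_filter, Set.Finite.mem_toFinset, Set.mem_ofPred_eq, perSet, primSet]
    constructor
    · rintro ⟨⟨h1, h2⟩, h3⟩; exact ⟨h1, h3⟩
    · rintro ⟨h1, h3⟩
      exact ⟨⟨h1, (Function.isPeriodicPt_iff_minimalPeriod_dvd).2 (h3 ▸ hdn)⟩, h3⟩
  · intro s hs
    have hs' : s ∈ perSet r n := by simpa using hs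
    simp only [Finset.mem_coe, Nat.mem_divisors]
    exact ⟨hs'.2.minimalPeriod_dvd, NeZero.ne n⟩

instance prAct {D : Type*} (r : D → D → Prop) (n : ℕ) : AddAction (ZMod n) (Pr r n) where
  vadd g c := ⟨fun i => c.1 (i + g), fun i => by
      have := c.2.1 (i + g)
      rwa [add_right_comm] at this, fun d hd hlt h => c.2.2 d hd hlt (fun i => by
      have := h (i - g)
      simpa [sub_add_eq_add_sub] using this)⟩
  zero_vadd c := Subtype.ext (by funext i; exact congrArg c.1 (add_zero i))
  add_vadd g h c := Subtype.ext (by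
    funext i
    change c.1 (i + (g + h)) = c.1 ((i + g) + h)
    rw [add_assoc])

theorem dvd_card {D : Type*} [Finite D] (r : D → D → Prop) (n : ℕ) [NeZero n] :
    n ∣ Nat.card (Pr r n) := by
  have hs : ∀ c : Pr r n, AddAction.stabilizer (ZMod n) c = ⊥ := by
    intro c
    rw [eq_bot_iff]
    intro g hg
    have hg' : ∀ i, c.1 (i + g) = c.1 i := fun i => congrFun (congrArg Subtype.val hg) i
    rw [AddSubgroup.mem_bot]
    by_contra hne
    have hv : g.val ≠ 0 := by simpa [ZMod.val_eq_zero] using hne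
    have hgv : ((g.val : ℕ) : ZMod n) = g := by simp
    have p1 : Function.IsPeriodicPt shift g.val (fun i : ℕ => c.1 (i : ZMod n)) := by
      rw [lift_isPer, hgv]; exact hg'
    have p2 : Function.IsPeriodicPt shift n (fun i : ℕ => c.1 (i : ZMod n)) := by
      rw [lift_isPer]; simp
    have p3 := (lift_isPer _ _ _).1 (p1.gcd p2)
    refine c.2.2 _ (Nat.gcd_dvd_right _ _) ?_ p3
    exact lt_of_le_of_lt (Nat.gcd_le_left _ (Nat.pos_of_ne_zero hv)) (ZMod.val_lt g)
  rw [Nat.card_congr (AddAction.selfEquivOrbitsQuotientProd hs), Nat.card_prod, Nat.card_zmod]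
  exact dvd_mul_left _ _

theorem card_le {D : Type*} [Fintype D] (r : D → D → Prop) (n : ℕ) [NeZero n] :
    Nat.card (Pr r n) ≤ Fintype.card D ^ n := by
  have : Nat.card (Pr r n) ≤ Nat.card (ZMod n → D) :=
    Nat.card_le_card_of_injective _ Subtype.val_injective
  simpa [Nat.card_eq_fintype_card, ZMod.card] using this

theorem pow_entry {D : Type*} [Fintype D] [DecidableEq D] (B : Matrix D D ℂ) (n : ℕ) (b : D) (a : D) :
    (B ^ (n + 1)) a b = ∑ p : Fin n → D,
      (∏ i : Fin n, B ((Fin.cons a p : Fin (n + 1) → D) i.castSucc) (p i)) *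
        B ((Fin.cons a p : Fin (n + 1) → D) (Fin.last n)) b := by
  induction n generalizing a with
  | zero => simp
  | succ n ih =>
    rw [pow_succ', Matrix.mul_apply, ← (Fin.consEquiv (fun _ => D)).sum_comp, Fintype.sum_prod_type]
    apply Finset.sum_congr rfl
    intro x _
    rw [ih, Finset.mul_sum]
    apply Finset.sum_congr rfl
    intro p _
    rw [Fin.prod_univ_succ]
    simp [Fin.consEquiv, ← Fin.succ_last, mul_assoc]

theorem trace_eq {D : Type*} [Fintype D] [DecidableEq D] (B : Matrix D D ℂ) (n : ℕ) :
    (B ^ (n + 1)).trace = ∑ p : Fin (n + 1) → D, ∏ i, B (p i) (p (i + 1)) := by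
  rw [← (Fin.consEquiv (fun _ => D)).sum_comp, Fintype.sum_prod_type, Matrix.trace]
  apply Finset.sum_congr rfl
  intro a _
  rw [Matrix.diag_apply, pow_entry]
  apply Finset.sum_congr rfl
  intro p _
  rw [Fin.prod_univ_castSucc]
  simp [Fin.consEquiv]

theorem trace_card {D : Type*} [Fintype D] [DecidableEq D] (r : D → D → Prop) [DecidableRel r] (n : ℕ) (hn : n ≠ 0) :
    ((Matrix.of fun a b => if r a b then (1 : ℂ) else 0) ^ n).trace = Nat.card (Cyc r n) := by
  obtain ⟨n, rfl⟩ := Nat.exists_eq_succ_of_ne_zero hn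
  rw [trace_eq]
  have : ∀ p : Fin (n + 1) → D, (∏ i, (Matrix.of fun a b => if r a b then (1 : ℂ) else 0) (p i) (p (i + 1)))
      = if (∀ i, r (p i) (p (i + 1))) then 1 else 0 := by
    intro p
    simp [Finset.prod_ite_zero]
  simp_rw [this]
  rw [Finset.sum_boole]
  have e : Nat.card (Cyc r (n + 1)) = Nat.card {c : Fin (n + 1) → D // ∀ i, r (c i) (c (i + 1))} :=
    Nat.card_congr (Equiv.refl _)
  rw [Nat.succ_eq_add_one, e, Nat.card_eq_fintype_card, Fintype.card_subtype]

theorem hasSum_pnat {f : ℕ → ℂ} {a : ℂ} (h0 : f 0 = 0) (h : HasSum f a) :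
    HasSum (fun n : ℕ+ => f n) a := by
  refine (Function.Injective.hasSum_iff PNat.coe_injective ?_).2 h
  intro x hx
  rcases Nat.eq_zero_or_pos x with rfl | hx'
  · exact h0
  · exact absurd ⟨⟨x, hx'⟩, rfl⟩ hx

theorem euler (p : ℕ → ℕ) (T : ℕ → ℂ) (hT : ∀ n, n ≠ 0 → T n = ∑ d ∈ n.divisors, (d : ℂ) * p d)
    (C : ℝ) (hC : 1 ≤ C) (hp : ∀ n, n ≠ 0 → (p n : ℝ) ≤ C ^ n) (z : ℂ) (hz : C * ‖z‖ < 1) (L : ℂ)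
    (hL : HasSum (fun n : ℕ => T n * z ^ n / n) L) :
    HasProd (fun n : ℕ => (((1 : ℂ) - z ^ (n + 1)) ^ p (n + 1))⁻¹) (Complex.exp L) := by
  have hz1 : ‖z‖ < 1 := lt_of_le_of_lt (le_mul_of_one_le_left (norm_nonneg _) hC) hz
  have hzn : ∀ n : ℕ, n ≠ 0 → ‖z ^ n‖ < 1 := fun n hn => by
    rw [norm_pow]; exact pow_lt_one₀ (norm_nonneg _) hz1 hn
  let f : ℕ+ × ℕ+ → ℂ := fun x => (p x.1 : ℂ) * z ^ (x.1 * x.2 : ℕ) / (x.2 : ℕ)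
  have hf : Summable f := by
    have hs := summable_prod_mul_pow (𝕜 := ℝ) 0 (r := C * ‖z‖) (by
      rw [Real.norm_of_nonneg (by positivity)]; exact hz)
    refine Summable.of_norm_bounded hs ?_
    rintro ⟨n, k⟩
    simp only [f, norm_div, norm_mul, norm_pow, pow_zero, one_mul, Complex.norm_natCast]
    have hk : (1 : ℝ) ≤ (k : ℕ) := by exact_mod_cast k.one_le
    calc (p n : ℝ) * ‖z‖ ^ (n * k : ℕ) / (k : ℕ) ≤ (p n : ℝ) * ‖z‖ ^ (n * k : ℕ) :=
          div_le_self (by positivity) hk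
      _ ≤ C ^ (n * k : ℕ) * ‖z‖ ^ (n * k : ℕ) := by
          gcongr
          exact (hp n n.ne_zero).trans (pow_le_pow_right₀ hC (Nat.le_mul_of_pos_right _ k.pos))
      _ = _ := by rw [mul_pow]
  obtain ⟨S, hS⟩ := hf
  have h1 : HasSum (fun n : ℕ+ => (p n : ℂ) * -Complex.log (1 - z ^ (n : ℕ))) S := by
    refine hS.prod_fiberwise (fun n => ?_)
    have := (hasSum_pnat (by simp) (Complex.hasSum_taylorSeries_neg_log (hzn n n.ne_zero))).mul_left (p n : ℂ)
    refine this.congr_fun ?_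
    intro k
    simp only [f, pow_mul]
    ring
  have h2 : HasSum (fun n : ℕ+ => T n * z ^ (n : ℕ) / (n : ℕ)) S := by
    have h3 := (sigmaAntidiagonalEquivProd.hasSum_iff).2 hS
    refine h3.sigma (fun n => ?_)
    convert hasSum_fintype _ using 1
    rw [Finset.univ_eq_attach, hT n n.ne_zero]
    have e : ∀ x : Nat.divisorsAntidiagonal (n : ℕ), (f ∘ sigmaAntidiagonalEquivProd) ⟨n, x⟩ =
        (fun y : ℕ × ℕ => (p y.1 : ℂ) * z ^ (y.1 * y.2) / (y.2 : ℂ)) x.1 := fun x => rfl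
    simp_rw [e]
    rw [Finset.sum_attach (n : ℕ).divisorsAntidiagonal
      (fun y : ℕ × ℕ => (p y.1 : ℂ) * z ^ (y.1 * y.2) / (y.2 : ℂ)),
      Nat.sum_divisorsAntidiagonal (fun a b => (p a : ℂ) * z ^ (a * b) / (b : ℂ)), Finset.sum_mul,
      Finset.sum_div]
    apply Finset.sum_congr rfl
    intro d hd
    have hdn := Nat.dvd_of_mem_divisors hd
    have hd0 := (Nat.pos_of_mem_divisors hd).ne'
    obtain ⟨k, hk⟩ := hdn
    have hk0 : k ≠ 0 := by rintro rfl; simp at hk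
    rw [hk, Nat.mul_div_cancel_left _ (Nat.pos_of_ne_zero hd0)]
    push_cast
    have : (d : ℂ) ≠ 0 := by exact_mod_cast hd0
    have : (k : ℂ) ≠ 0 := by exact_mod_cast hk0
    field_simp
  have hSL : S = L := h2.unique (hasSum_pnat (by simp) hL)
  rw [hSL] at h1
  have h4 : HasSum (fun n : ℕ => (p (n + 1) : ℂ) * -Complex.log (1 - z ^ (n + 1))) L := by
    have := (Equiv.pnatEquivNat.symm.hasSum_iff).2 h1
    exact this
  convert h4.cexp using 2 with n
  simp only [Function.comp]
  have hne : (1 : ℂ) - z ^ (n + 1) ≠ 0 := by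
    intro h0
    have := hzn (n + 1) (by simp)
    rw [sub_eq_zero] at h0
    rw [← h0] at this; simp at this
  rw [Complex.exp_nat_mul, Complex.exp_neg, Complex.exp_log hne, inv_pow]

theorem det_invol {D : Type*} [Fintype D] [DecidableEq D] (J : Matrix D D ℂ) (E : Matrix D D ℂ) (hJ : J * J = 1)
    (hE : E * E = 1) (hEJ : E * J * E = -J) (m : ℕ) (hm : Fintype.card D = 2 * m) (z : ℂ) :
    (1 + z • J).det = (1 - z ^ 2) ^ m := by
  let X : Polynomial ℂ := Polynomial.X
  let J' : Matrix D D (Polynomial ℂ) := J.map Polynomial.C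
  let E' : Matrix D D (Polynomial ℂ) := E.map Polynomial.C
  have hJ' : J' * J' = 1 := by
    simp only [J', ← Matrix.map_mul, hJ]; simp
  have hE' : E' * E' = 1 := by
    simp only [E', ← Matrix.map_mul, hE]; simp
  have hEJ' : E' * J' * E' = -J' := by
    simp only [E', J', ← Matrix.map_mul, hEJ]
    ext i j : 2
    simp
  have h1 : (1 + X • J').det = (1 - X • J').det := by
    have : (1 - X • J') = E' * (1 + X • J') * E' := by
      rw [mul_add, add_mul, mul_one, hE', Matrix.mul_smul, Matrix.smul_mul, hEJ', smul_neg, sub_eq_add_neg]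
    rw [this, Matrix.det_mul_right_comm, hE', one_mul]
  have h2 : (1 + X • J').det ^ 2 = ((1 - X ^ 2) ^ m) ^ 2 := by
    rw [sq]
    nth_rewrite 2 [h1]
    rw [← Matrix.det_mul]
    have : (1 + X • J') * (1 - X • J') = (1 - X ^ 2) • (1 : Matrix D D (Polynomial ℂ)) := by
      simp only [add_mul, mul_sub, Matrix.smul_mul, Matrix.mul_smul, hJ', sub_smul, smul_smul, sq,
        one_mul, mul_one, one_smul]
      abel
    rw [this, Matrix.det_smul, hm, Matrix.det_one, mul_one, ← pow_mul, mul_comm]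
  have hev : ∀ w : ℂ, ((1 + X • J').det).eval w = (1 + w • J).det := by
    intro w
    rw [← Polynomial.coe_evalRingHom, RingHom.map_det]
    congr 1
    ext i j
    simp [J', X, Matrix.one_apply, apply_ite (Polynomial.eval w)]
    ring
  rcases sq_eq_sq_iff_eq_or_eq_neg.1 h2 with h | h
  · rw [← hev, h]; simp [X]
  · exfalso
    have := hev 0
    rw [h] at this
    simp [X] at this
    norm_num [eq_comm, neg_eq_iff_eq_neg] at this

theorem bass_abs {V D : Type*} [Fintype V] [Fintype D] [DecidableEq V] [DecidableEq D] (S T : Matrix V D ℂ) (J : Matrix D D ℂ)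
    (A Q : Matrix V V ℂ) (hA : S * T.transpose = A) (hQ : S * J * T.transpose = Q)
    (hJ : J * J = 1) (m : ℕ) (hl : Fintype.card V ≤ m) (z : ℂ) (hz : 1 - z ^ 2 ≠ 0)
    (hdet : (1 + z • J).det = (1 - z ^ 2) ^ m) :
    (1 - z • (T.transpose * S - J)).det = (1 - z ^ 2) ^ (m - Fintype.card V) *
      (1 - z • A + z ^ 2 • (Q - 1)).det := by
  let w := (1 - z ^ 2)⁻¹
  have hw : (1 - z ^ 2) * w = 1 := mul_inv_cancel₀ hz
  have h1 : (1 + z • J) * (w • (1 - z • J)) = 1 := by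
    simp only [Matrix.mul_smul, add_mul, mul_sub, Matrix.smul_mul, hJ, one_mul, mul_one, smul_smul]
    ext i j
    simp only [Matrix.smul_apply, Matrix.add_apply, Matrix.sub_apply, smul_eq_mul]
    linear_combination (1 : Matrix D D ℂ) i j * hw
  have h2 : 1 - z • (T.transpose * S - J) =
      (1 + z • J) * (1 - (w • (1 - z • J)) * T.transpose * (z • S)) := by
    rw [mul_sub, ← Matrix.mul_assoc, ← Matrix.mul_assoc, h1, mul_one, Matrix.one_mul,
      Matrix.mul_smul, smul_sub]
    abel
  rw [h2, Matrix.det_mul, hdet, Matrix.det_one_sub_mul_comm]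
  have h3 : 1 - z • A + z ^ 2 • (Q - 1) =
     (1 - z ^ 2) • (1 - (z • S) * ((w • (1 - z • J)) * T.transpose)) := by
    have e : (z • S) * ((w • (1 - z • J)) * T.transpose) = (z * w) • A - (z * w * z) • Q := by
      rw [← hA, ← hQ]
      simp only [Matrix.smul_mul, Matrix.mul_smul, Matrix.sub_mul, Matrix.mul_sub, smul_sub,
        smul_smul, Matrix.one_mul, Matrix.mul_assoc]
      congr 2 <;> ring
    rw [e]
    ext i j
    simp only [Matrix.smul_apply, Matrix.add_apply, Matrix.sub_apply, smul_eq_mul]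
    linear_combination (z * A i j - z ^ 2 * Q i j) * hw
  rw [h3, Matrix.det_smul, ← mul_assoc, ← pow_add, Nat.sub_add_cancel hl]

theorem bass {V : Type*} [Fintype V] (G : SimpleGraph V) [DecidableRel G.Adj]
    (hdeg : ∀ v : V, 2 ≤ G.degree v) (z : ℂ) (hz : 1 - z ^ 2 ≠ 0) :
    (1 - z • (Matrix.of fun a b : G.Dart =>
      if b.toProd.1 = a.toProd.2 ∧ b ≠ a.symm then (1 : ℂ) else 0)).det =
      (1 - z ^ 2) ^ (G.edgeFinset.card - Fintype.card V) *
          Matrix.det ((1 : Matrix V V ℂ) - z • G.adjMatrix ℂ +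
            (z ^ 2) • Matrix.diagonal (fun v => (G.degree v : ℂ) - 1)) := by
  let S : Matrix V G.Dart ℂ := Matrix.of fun v e => if e.fst = v then 1 else 0
  let T : Matrix V G.Dart ℂ := Matrix.of fun v e => if e.snd = v then 1 else 0
  let J : Matrix G.Dart G.Dart ℂ := Matrix.of fun e f => if f = e.symm then 1 else 0
  have hcard : Fintype.card G.Dart = 2 * G.edgeFinset.card := by
    rw [dart_card_eq_twice_card_edges]
  have hl : Fintype.card V ≤ G.edgeFinset.card := by
    have h := G.sum_degrees_eq_twice_card_edges
    have h2 : ∑ v : V, 2 ≤ ∑ v : V, G.degree v := Finset.sum_le_sum (fun v _ => hdeg v)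
    simp at h2
    omega
  have hJ : J * J = 1 := by
    ext e f
    simp only [J, Matrix.mul_apply, Matrix.one_apply, Matrix.of_apply, ite_mul, one_mul, zero_mul,
      Finset.sum_ite_eq', Finset.sum_ite_eq, Finset.mem_univ, if_true, Dart.symm_symm]
    simp only [eq_comm]
  have hSJ : S * J = T := by
    ext v f
    have : ∀ e : G.Dart, (f = e.symm) ↔ (e = f.symm) := fun e =>
      ⟨fun h => by rw [h, Dart.symm_symm], fun h => by rw [h, Dart.symm_symm]⟩
    simp [J, S, T, Matrix.mul_apply, this]
  have hA : S * T.transpose = G.adjMatrix ℂ := by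
    ext u v
    simp only [S, T, Matrix.mul_apply, Matrix.transpose_apply, Matrix.of_apply, adjMatrix_apply,
      ← ite_and, mul_ite, mul_one, mul_zero]
    by_cases h : G.Adj u v
    · rw [if_pos h, Finset.sum_eq_single (⟨(u, v), h⟩ : G.Dart)]
      · simp
      · intro b _ hb
        rw [if_neg]
        rintro ⟨h1, h2⟩
        exact hb (Dart.ext _ _ (Prod.ext h2 h1))
      · simp
    · rw [if_neg h]
      apply Finset.sum_eq_zero
      intro b _
      rw [if_neg]
      rintro ⟨h1, h2⟩
      exact h (h1 ▸ h2 ▸ b.adj)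
  have hQ : S * J * T.transpose = Matrix.diagonal (fun v => (G.degree v : ℂ)) := by
    rw [hSJ]
    ext u v
    simp only [T, Matrix.mul_apply, Matrix.transpose_apply, Matrix.of_apply, Matrix.diagonal_apply,
      ← ite_and, mul_ite, mul_one, mul_zero]
    by_cases h : u = v
    · subst h
      rw [if_pos rfl]
      simp only [and_self, Finset.sum_boole]
      norm_cast
      rw [← G.dart_fst_fiber_card_eq_degree u]
      apply Finset.card_bij (fun e _ => e.symm)
      · intro e he; simpa using he
      · intro e _ f _ h; simpa using congrArg Dart.symm h
      · intro e he; exact ⟨e.symm, by simpa using he, by simp⟩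
    · rw [if_neg h]
      apply Finset.sum_eq_zero
      intro b _
      rw [if_neg]
      rintro ⟨h1, h2⟩
      exact h (h2.symm.trans h1)
  have hB : (Matrix.of fun a b : G.Dart =>
      if b.toProd.1 = a.toProd.2 ∧ b ≠ a.symm then (1 : ℂ) else 0) = T.transpose * S - J := by
    ext a b
    simp only [T, S, J, Matrix.mul_apply, Matrix.transpose_apply, Matrix.of_apply, Matrix.sub_apply,
      mul_ite, mul_one, mul_zero]
    by_cases h : b = a.symm
    · subst h; simp
    · simp [h, eq_comm]
  obtain ⟨E, hE, hEJ⟩ : ∃ E : Matrix G.Dart G.Dart ℂ, E * E = 1 ∧ E * J * E = -J := by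
    obtain ⟨o⟩ : Nonempty (V ≃ Fin (Fintype.card V)) := ⟨Fintype.equivFin V⟩
    let ε : G.Dart → ℂ := fun e => if o e.fst < o e.snd then 1 else -1
    have h1 : ∀ e, ε e * ε e = 1 := by
      intro e; simp only [ε]; split_ifs <;> norm_num
    have h2 : ∀ e, ε e.symm = - ε e := by
      intro e
      have hne : o e.fst ≠ o e.snd := fun h => e.fst_ne_snd (o.injective h)
      simp only [ε, Dart.symm_toProd, Prod.fst_swap, Prod.snd_swap]
      rcases lt_or_gt_of_ne hne with h | h
      · rw [if_pos h, if_neg (not_lt.2 h.le)]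
      · rw [if_neg (not_lt.2 h.le), if_pos h]; simp
    refine ⟨Matrix.diagonal ε, ?_, ?_⟩
    · rw [Matrix.diagonal_mul_diagonal]
      simp [h1]
    · ext e f
      rw [Matrix.mul_diagonal, Matrix.diagonal_mul]
      simp only [J, Matrix.of_apply, Matrix.neg_apply]
      by_cases h : f = e.symm
      · subst h; rw [h2]; simp [h1]
      · simp [h]
  have hdet := det_invol J E hJ hE hEJ _ hcard z
  rw [hB, bass_abs S T J _ _ hA hQ hJ _ hl z hz hdet]
  congr 4
  rw [← Matrix.diagonal_one, Matrix.diagonal_sub]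

end IB

/-- The Ihara–Bass theorem: for a finite connected graph `G` with no degree-1 vertices,
`m` edges, `ℓ` vertices, adjacency matrix `A` and `Q = diag(deg − 1)`, one has
`ζ_G(z)⁻¹ = (1 − z²)^{r−1} · det(I − Az + Qz²)` with `r = m − ℓ + 1`, for `z` in a
neighbourhood of `0`; in particular `ζ_G` has no zeros there. -/
theorem ihara_bass {V : Type*} [Fintype V] (G : SimpleGraph V) [DecidableRel G.Adj]
    (hconn : G.Connected) (hdeg : ∀ v : V, 2 ≤ G.degree v) :
    ∃ ε : ℝ, 0 < ε ∧ ∀ z : ℂ, ‖z‖ < ε →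
      (iharaZeta G z)⁻¹ =
        (1 - z ^ 2) ^ (G.edgeFinset.card - Fintype.card V + 1 - 1) *
          Matrix.det ((1 : Matrix V V ℂ) - z • G.adjMatrix ℂ +
            (z ^ 2) • Matrix.diagonal (fun v => (G.degree v : ℂ) - 1)) ∧
      iharaZeta G z ≠ 0 := by
  let r : G.Dart → G.Dart → Prop := fun a b => b.toProd.1 = a.toProd.2 ∧ b ≠ a.symm
  let B : Matrix G.Dart G.Dart ℂ := Matrix.of fun a b : G.Dart =>
      if b.toProd.1 = a.toProd.2 ∧ b ≠ a.symm then (1 : ℂ) else 0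
  have hP : ∀ n, primeCycleCount G n = Nat.card (IB.Pr r n) / n := fun n => rfl
  obtain ⟨R, hR, hlog⟩ := IB.trace_log B
  let C : ℝ := Fintype.card G.Dart + 1
  have hC1 : 1 ≤ C := by simp [C]
  have hC0 : 0 < C := by linarith
  refine ⟨min R C⁻¹, by positivity, fun z hz => ?_⟩
  have hzR := lt_of_lt_of_le hz (min_le_left _ _)
  have hzC : C * ‖z‖ < 1 := by
    have := lt_of_lt_of_le hz (min_le_right _ _)
    calc C * ‖z‖ < C * C⁻¹ := by gcongr
      _ = 1 := mul_inv_cancel₀ hC0.ne'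
  have hz1 : ‖z‖ < 1 := lt_of_le_of_lt (le_mul_of_one_le_left (norm_nonneg _) hC1) hzC
  obtain ⟨L, hL, hE⟩ := hlog z hzR
  have key := IB.euler (primeCycleCount G) (fun n => (B ^ n).trace) (by
      intro n hn
      have : NeZero n := ⟨hn⟩
      have ht : (B ^ n).trace = Nat.card (IB.Cyc r n) := IB.trace_card r n hn
      rw [ht, IB.cyc_eq_sum]
      push_cast
      apply Finset.sum_congr rfl
      intro d hd
      have : NeZero d := ⟨(Nat.pos_of_mem_divisors hd).ne'⟩
      rw [hP, ← Nat.cast_mul, Nat.mul_div_cancel' (IB.dvd_card r d)])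
    C hC1 (by
      intro n hn
      have : NeZero n := ⟨hn⟩
      have h1 : primeCycleCount G n ≤ Fintype.card G.Dart ^ n :=
        (Nat.div_le_self _ _).trans (IB.card_le r n)
      calc (primeCycleCount G n : ℝ) ≤ (Fintype.card G.Dart : ℝ) ^ n := by exact_mod_cast h1
        _ ≤ C ^ n := by gcongr; simp [C])
    z hzC L hL
  have hzeta : iharaZeta G z = Complex.exp L := key.tprod_eq
  have hz2 : 1 - z ^ 2 ≠ 0 := by
    intro h0
    have h1 : ‖z ^ 2‖ < 1 := by rw [norm_pow]; exact pow_lt_one₀ (norm_nonneg _) hz1 (by simp)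
    rw [sub_eq_zero] at h0
    rw [← h0] at h1; simp at h1
  refine ⟨?_, by rw [hzeta]; exact Complex.exp_ne_zero _⟩
  rw [hzeta, Nat.add_sub_cancel, ← IB.bass G hdeg z hz2]
  exact inv_eq_of_mul_eq_one_right hE
end

section
/- Let a : ℕ → ℂ satisfy a(1) = 1 and |a(n)| ≪ n^{−α} for some α > 0, and suppose a is supported on {1} ∪ {n ≥ 2 : p_min(n) ∈ S} for a set S of primes with natural density δ(S). Then −lim_{x→∞} ∑_{2 ≤ n ≤ x, p_min(n) ∈ S} (μ * a)(n)/φ(n) = δ(S), where φ is Euler's totient function. -/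
open scoped Classical
open Finset Filter


namespace Alladi

open MeasureTheory Topology

/-- Mertens function, at a real argument, complex valued. -/
noncomputable def MC (t : ℝ) : ℂ := ∑ k ∈ Finset.Icc 1 ⌊t⌋₊, ((ArithmeticFunction.moebius k : ℤ) : ℂ)

lemma norm_moebius_le (k : ℕ) : ‖((ArithmeticFunction.moebius k : ℤ) : ℂ)‖ ≤ 1 := by
  rw [Complex.norm_intCast]
  exact_mod_cast ArithmeticFunction.abs_moebius_le_one

lemma MC_of_lt_one {t : ℝ} (ht : t < 1) : MC t = 0 := by
  simp [MC, Nat.floor_eq_zero.2 ht]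

lemma norm_MC_le {t : ℝ} (ht : 0 ≤ t) : ‖MC t‖ ≤ t := by
  unfold MC
  refine (norm_sum_le_of_le _ (fun k _ => norm_moebius_le k)).trans ?_
  simpa using Nat.floor_le ht

lemma norm_MC_sub_le {x y : ℝ} (hx : 0 ≤ x) (hxy : x ≤ y) : ‖MC y - MC x‖ ≤ y - x + 1 := by
  have hf : ⌊x⌋₊ ≤ ⌊y⌋₊ := Nat.floor_le_floor hxy
  have : MC y - MC x = ∑ k ∈ Finset.Ioc ⌊x⌋₊ ⌊y⌋₊, ((ArithmeticFunction.moebius k : ℤ) : ℂ) := by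
    unfold MC
    rw [sub_eq_iff_eq_add, ← Finset.sum_union]
    · apply Finset.sum_congr _ (fun _ _ => rfl)
      ext k; simp; omega
    · rw [Finset.disjoint_left]; intro k; simp; omega
  rw [this]
  refine (norm_sum_le_of_le _ (fun k _ => norm_moebius_le k)).trans ?_
  simp only [sum_const, Nat.card_Ioc, nsmul_eq_mul, mul_one]
  rw [Nat.cast_sub hf]
  have h1 := Nat.floor_le (hx.trans hxy)
  have h2 := Nat.lt_floor_add_one x
  linarith

lemma measurable_MC : Measurable MC := by
  have : MC = (fun n : ℕ => ∑ k ∈ Finset.Icc 1 n, ((ArithmeticFunction.moebius k : ℤ) : ℂ)) ∘ Nat.floor := rfl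
  rw [this]
  exact (measurable_from_nat).comp Nat.measurable_floor

/-- normalised Mertens function -/
noncomputable def HH (σ : ℝ) (u : ℝ) : ℂ := Real.exp (σ * u) • MC (Real.exp (-u))

lemma measurable_HH (σ : ℝ) : Measurable (HH σ) := by
  unfold HH
  have := measurable_MC
  fun_prop

lemma HH_of_pos (σ : ℝ) {u : ℝ} (hu : 0 < u) : HH σ u = 0 := by
  unfold HH
  rw [MC_of_lt_one, smul_zero]
  simpa using hu

lemma norm_HH_le (σ u : ℝ) : ‖HH σ u‖ ≤ Real.exp ((σ - 1) * u) := by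
  unfold HH
  rw [norm_smul, Real.norm_eq_abs, Real.abs_exp]
  calc _ ≤ Real.exp (σ * u) * Real.exp (-u) := by gcongr; exact norm_MC_le (Real.exp_pos _).le
    _ = _ := by rw [← Real.exp_add]; congr 1; ring

lemma norm_HH_le_one {σ : ℝ} (hσ : 1 ≤ σ) (u : ℝ) : ‖HH σ u‖ ≤ 1 := by
  rcases lt_or_ge 0 u with hu | hu
  · simp [HH_of_pos σ hu]
  · refine (norm_HH_le σ u).trans ?_
    rw [Real.exp_le_one_iff]
    exact mul_nonpos_of_nonneg_of_nonpos (by linarith) hu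

lemma integrable_HH {σ : ℝ} (hσ : 1 < σ) : Integrable (HH σ) := by
  have h1 : IntegrableOn (fun u => Real.exp ((σ - 1) * u)) (Set.Iic 0) :=
    integrableOn_exp_mul_Iic (by linarith) 0
  rw [← integrableOn_univ, ← Set.Iic_union_Ioi (a := (0:ℝ)), integrableOn_union]
  refine ⟨h1.mono' (measurable_HH σ).aestronglyMeasurable (ae_of_all _ (norm_HH_le σ)), ?_⟩
  refine (integrableOn_zero).congr_fun (fun u hu => (HH_of_pos σ hu).symm) measurableSet_Ioi

lemma HH_slow_aux {x y : ℝ} (hx : 0 < x) (hxy : x ≤ y) :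
    ‖y⁻¹ • MC y - x⁻¹ • MC x‖ ≤ 2 * (Real.log y - Real.log x) + y⁻¹ := by
  have hy : 0 < y := hx.trans_le hxy
  have h0 : y⁻¹ • MC y - x⁻¹ • MC x = y⁻¹ • (MC y - MC x) - (x⁻¹ - y⁻¹) • MC x := by
    rw [smul_sub, sub_smul]; abel
  have hi : y⁻¹ ≤ x⁻¹ := by gcongr
  have h1 : ‖y⁻¹ • (MC y - MC x)‖ ≤ y⁻¹ * (y - x + 1) := by
    rw [norm_smul, Real.norm_of_nonneg (by positivity)]
    gcongr
    exact norm_MC_sub_le hx.le hxy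
  have h2 : ‖(x⁻¹ - y⁻¹) • MC x‖ ≤ (x⁻¹ - y⁻¹) * x := by
    rw [norm_smul, Real.norm_of_nonneg (by linarith)]
    gcongr
    exact norm_MC_le hx.le
  have h3 : 1 - x / y ≤ Real.log y - Real.log x := by
    have := Real.log_le_sub_one_of_pos (div_pos hx hy)
    rw [Real.log_div hx.ne' hy.ne'] at this
    linarith
  rw [h0]
  refine (norm_sub_le _ _).trans ((add_le_add h1 h2).trans ?_)
  have e1 : y⁻¹ * (y - x + 1) = 1 - x / y + y⁻¹ := by field_simp
  have e2 : (x⁻¹ - y⁻¹) * x = 1 - x / y := by field_simp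
  rw [e1, e2]; linarith

lemma HH_one_eq (u : ℝ) : HH 1 u = (Real.exp (-u))⁻¹ • MC (Real.exp (-u)) := by
  unfold HH
  rw [Real.exp_neg, inv_inv, one_mul]

lemma HH_slow (v w : ℝ) : ‖HH 1 v - HH 1 (v + w)‖ ≤ 2 * |w| + Real.exp v := by
  rw [HH_one_eq, HH_one_eq]
  rcases le_total 0 w with hw | hw
  · have := HH_slow_aux (x := Real.exp (-(v+w))) (y := Real.exp (-v)) (Real.exp_pos _) (by gcongr; linarith)
    rw [Real.log_exp, Real.log_exp] at this
    rw [abs_of_nonneg hw]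
    refine this.trans ?_
    rw [Real.exp_neg v, inv_inv]; linarith
  · have := HH_slow_aux (y := Real.exp (-(v+w))) (x := Real.exp (-v)) (Real.exp_pos _) (by gcongr; linarith)
    rw [Real.log_exp, Real.log_exp, norm_sub_rev] at this
    rw [abs_of_nonpos hw]
    refine this.trans ?_
    rw [Real.exp_neg (v+w), inv_inv]
    have : Real.exp (v + w) ≤ Real.exp v := by gcongr; linarith
    linarith

end Alladi


namespace Alladi

open MeasureTheory Topology FourierTransform

noncomputable def ZZ : ℂ → ℂ := Function.update (fun s ↦ (s - 1) * riemannZeta s) 1 1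

noncomputable def GG (s : ℂ) : ℂ := (s - 1) / (s * ZZ s)

lemma continuous_ZZ : Continuous ZZ := by
  rw [continuous_iff_continuousAt]
  intro s
  by_cases hs : s = 1
  · subst hs
    unfold ZZ
    rw [continuousAt_update_same]
    exact riemannZeta_residue_one
  · unfold ZZ
    rw [continuousAt_update_of_ne hs]
    exact (by fun_prop : ContinuousAt (fun s : ℂ => s - 1) s).mul
      (differentiableAt_riemannZeta hs).continuousAt

lemma ZZ_ne_zero {s : ℂ} (hs : 1 ≤ s.re) : ZZ s ≠ 0 := by
  unfold ZZ
  by_cases h : s = 1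
  · subst h; simp
  · rw [Function.update_of_ne h]
    exact mul_ne_zero (sub_ne_zero.2 h) (riemannZeta_ne_zero_of_one_le_re hs)

lemma continuousOn_GG : ContinuousOn GG {s : ℂ | 1 ≤ s.re} := by
  unfold GG
  apply ContinuousOn.div (by fun_prop) (continuousOn_id.mul continuous_ZZ.continuousOn)
  intro s hs
  refine mul_ne_zero ?_ (ZZ_ne_zero hs)
  rintro rfl
  simp at hs
  linarith

lemma mellin_MC {s : ℂ} (hs : 1 < s.re) : mellin MC (-s) = GG s := by
  have hs0 : s ≠ 0 := by rintro rfl; simp at hs; linarith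
  have hs1 : s ≠ 1 := by rintro rfl; simp at hs
  have h1 := LSeries_eq_mul_integral' (fun n => ((ArithmeticFunction.moebius n : ℤ) : ℂ)) (r := 1) zero_le_one hs
    (by
      refine Asymptotics.IsBigO.of_bound 1 (Eventually.of_forall fun n => ?_)
      rw [Real.norm_of_nonneg (by positivity), one_mul, Real.rpow_one, Real.norm_of_nonneg (by positivity)]
      refine (Finset.sum_le_sum (fun k _ => norm_moebius_le k)).trans ?_
      simp)
  have h2 := ArithmeticFunction.LSeries_zeta_mul_Lseries_moebius hs
  rw [ArithmeticFunction.LSeries_zeta_eq_riemannZeta hs] at h2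
  have hz := riemannZeta_ne_zero_of_one_le_re hs.le
  have h3 : mellin MC (-s) = ∫ t in Set.Ioi (1:ℝ), MC t * (t:ℂ) ^ (-(s+1)) := by
    unfold mellin
    rw [setIntegral_eq_of_subset_of_forall_sdiff_eq_zero (s := Set.Ici (1:ℝ)) measurableSet_Ioi
      (fun t ht => Set.mem_Ioi.2 (lt_of_lt_of_le zero_lt_one ht)), integral_Ici_eq_integral_Ioi]
    · apply setIntegral_congr_fun measurableSet_Ioi
      intro t ht
      simp only [smul_eq_mul]
      rw [mul_comm, neg_add']
    · intro t ht
      rw [MC_of_lt_one (by simpa using ht.2), smul_zero]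
  rw [h3]
  unfold MC
  rw [h1] at h2
  have h4 : (∫ t in Set.Ioi (1:ℝ), (∑ k ∈ Icc 1 ⌊t⌋₊, ((ArithmeticFunction.moebius k : ℤ):ℂ)) * (t:ℂ) ^ (-(s+1)))
      = 1 / (s * riemannZeta s) := by
    rw [eq_div_iff (mul_ne_zero hs0 hz)]
    refine Eq.trans ?_ h2
    ring
  rw [h4]
  unfold GG ZZ
  rw [Function.update_of_ne hs1]
  have := sub_ne_zero.2 hs1
  field_simp

lemma fourier_HH {σ : ℝ} (hσ : 1 < σ) (ξ : ℝ) :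
    𝓕 (HH σ) ξ = GG (σ - 2 * Real.pi * ξ * Complex.I) := by
  rw [← mellin_MC (by simpa), mellin_eq_fourier]
  have : (-((σ:ℂ) - 2 * Real.pi * ξ * Complex.I)).im / (2 * Real.pi) = ξ := by
    simp
  rw [this]
  have : (-((σ:ℂ) - 2 * Real.pi * ξ * Complex.I)).re = -σ := by simp
  rw [this]
  simp only [neg_neg]
  rfl

/-- Main identity -/
lemma integral_HH_mul {σ : ℝ} (hσ : 1 < σ) {φ : ℝ → ℂ} (hφ : Integrable φ) (v : ℝ) :
    ∫ u, HH σ u * 𝓕 φ (u - v) = ∫ ξ : ℝ, GG (σ - 2 * Real.pi * ξ * Complex.I) *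
      (Real.fourierChar (v * ξ) • φ ξ) := by
  have hφ' : Integrable (fun ξ => Real.fourierChar (v * ξ) • φ ξ) := by
    have := (Real.fourierIntegral_convergent_iff (μ := volume) (f := φ) (-v)).2 hφ
    refine this.congr (ae_of_all _ fun ξ => ?_)
    simp [mul_comm]
  have := VectorFourier.integral_fourierIntegral_smul_eq_flip (L := innerₗ ℝ) (f := HH σ)
      Real.continuous_fourierChar continuous_inner (integrable_HH hσ) hφ'
  have h2 : ∀ u, 𝓕 φ (u - v) = VectorFourier.fourierIntegral Real.fourierChar volume (innerₗ ℝ).flip (fun ξ => Real.fourierChar (v * ξ) • φ ξ) u := by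
    intro u
    rw [Real.fourier_eq]
    unfold VectorFourier.fourierIntegral
    congr 1
    ext ξ
    rw [smul_smul, ← AddChar.map_add_eq_mul]
    congr 2
    simp
    ring
  simp_rw [h2, ← fourier_HH hσ]
  simp only [smul_eq_mul] at this
  rw [← this]
  rfl

end Alladi


namespace Alladi

open MeasureTheory Topology FourierTransform

lemma continuousOn_GG' : ContinuousOn (fun p : ℝ × ℝ => GG (p.1 - 2 * Real.pi * p.2 * Complex.I))
    {p | 1 ≤ p.1} := by
  apply continuousOn_GG.comp (by fun_prop)
  intro p hp
  simpa using hp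

lemma tendsto_GG_right (ξ : ℝ) : Tendsto (fun σ : ℝ => GG (σ - 2 * Real.pi * ξ * Complex.I)) (𝓝[>] 1)
          (𝓝 (GG ((1:ℝ) - 2 * Real.pi * ξ * Complex.I))) := by
  have h : ContinuousOn (fun σ : ℝ => GG (σ - 2 * Real.pi * ξ * Complex.I)) (Set.Ici 1) := by
    apply continuousOn_GG.comp (by fun_prop)
    intro p hp
    simpa using hp
  exact (h 1 Set.self_mem_Ici).tendsto.mono_left (nhdsWithin_mono _ Set.Ioi_subset_Ici_self)

lemma integral_HH_one_mul {φ : ℝ → ℂ} (hφc : Continuous φ) (hφ : HasCompactSupport φ)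
    (hK : Integrable (𝓕 φ)) (v : ℝ) :
    ∫ u, HH 1 u * 𝓕 φ (u - v) = ∫ ξ : ℝ, GG ((1:ℝ) - 2 * Real.pi * ξ * Complex.I) *
      (Real.fourierChar (v * ξ) • φ ξ) := by
  have hφi : Integrable φ := hφc.integrable_of_hasCompactSupport hφ
  have hmem : ∀ᶠ σ : ℝ in 𝓝[>] 1, σ ∈ Set.Ioc (1:ℝ) 2 := Ioc_mem_nhdsGT (by norm_num)
  have h1 : Tendsto (fun σ : ℝ => ∫ u, HH σ u * 𝓕 φ (u - v)) (𝓝[>] 1)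
      (𝓝 (∫ u, HH 1 u * 𝓕 φ (u - v))) := by
    apply tendsto_integral_filter_of_dominated_convergence (fun u => ‖𝓕 φ (u - v)‖)
    · refine Eventually.of_forall fun σ => ?_
      exact (measurable_HH σ).aestronglyMeasurable.mul (hK.comp_sub_right v).aestronglyMeasurable
    · filter_upwards [hmem] with σ hσ
      refine ae_of_all _ fun u => ?_
      rw [norm_mul]
      exact mul_le_of_le_one_left (norm_nonneg _) (norm_HH_le_one hσ.1.le u)
    · exact (hK.comp_sub_right v).norm
    · refine ae_of_all _ fun u => ?_
      apply Tendsto.mono_left _ nhdsWithin_le_nhds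
      have : Continuous (fun σ : ℝ => HH σ u * 𝓕 φ (u - v)) := by unfold HH; fun_prop
      exact this.tendsto 1
  obtain ⟨B, hB⟩ : ∃ B, ∀ p ∈ Set.Icc (1:ℝ) 2 ×ˢ tsupport φ,
      ‖GG ((p:ℝ×ℝ).1 - 2 * Real.pi * p.2 * Complex.I)‖ ≤ B := by
    apply IsCompact.exists_bound_of_continuousOn (isCompact_Icc.prod hφ)
    exact continuousOn_GG'.mono (fun p hp => hp.1.1)
  have hmeas : ∀ σ : ℝ, 1 ≤ σ → Continuous (fun ξ : ℝ => GG (σ - 2 * Real.pi * ξ * Complex.I) *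
      (Real.fourierChar (v * ξ) • φ ξ)) := by
    intro σ hσ
    have c1 : Continuous (fun ξ : ℝ => GG (σ - 2 * Real.pi * ξ * Complex.I)) :=
      continuousOn_GG'.comp_continuous (f := fun ξ : ℝ => (σ, ξ)) (by fun_prop) (fun _ => hσ)
    have c2 : Continuous (fun ξ : ℝ => (Real.fourierChar (v * ξ) • φ ξ)) := by
      have := Real.continuous_fourierChar
      simp only [Circle.smul_def]
      fun_prop
    exact c1.mul c2
  have h2 : Tendsto (fun σ : ℝ => ∫ ξ : ℝ, GG (σ - 2 * Real.pi * ξ * Complex.I) *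
      (Real.fourierChar (v * ξ) • φ ξ)) (𝓝[>] 1)
      (𝓝 (∫ ξ : ℝ, GG ((1:ℝ) - 2 * Real.pi * ξ * Complex.I) *
      (Real.fourierChar (v * ξ) • φ ξ))) := by
    apply tendsto_integral_filter_of_dominated_convergence (fun ξ => B * ‖φ ξ‖)
    · filter_upwards [hmem] with σ hσ
      exact (hmeas σ hσ.1.le).aestronglyMeasurable
    · filter_upwards [hmem] with σ hσ
      refine ae_of_all _ fun ξ => ?_
      rw [norm_mul, Circle.norm_smul]
      by_cases hξ : ξ ∈ tsupport φ
      · gcongr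
        exact hB (σ, ξ) ⟨⟨hσ.1.le, hσ.2⟩, hξ⟩
      · simp [image_eq_zero_of_notMem_tsupport hξ]
    · exact hφi.norm.const_mul B
    · refine ae_of_all _ fun ξ => ?_
      have c3 := tendsto_GG_right ξ
      exact c3.mul_const _
  refine tendsto_nhds_unique h1 (h2.congr' ?_)
  filter_upwards [hmem] with σ hσ
  exact (integral_HH_mul hσ.1 hφi v).symm

lemma tendsto_integral_HH {φ : ℝ → ℂ} (hφc : Continuous φ) (hφ : HasCompactSupport φ)
    (hK : Integrable (𝓕 φ)) :
    Tendsto (fun v => ∫ u, HH 1 u * 𝓕 φ (u - v)) atBot (𝓝 0) := by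
  simp_rw [integral_HH_one_mul hφc hφ hK]
  have h := Real.zero_at_infty_fourier (fun ξ : ℝ => GG ((1:ℝ) - 2 * Real.pi * ξ * Complex.I) * φ ξ)
  have h' := (h.mono_left atTop_le_cocompact).comp tendsto_neg_atBot_atTop
  refine h'.congr fun v => ?_
  simp only [Function.comp]
  rw [Real.fourier_eq]
  congr 1
  ext ξ
  rw [Circle.smul_def, Circle.smul_def]
  simp
  ring_nf

lemma exists_phi : ∃ φ : ℝ → ℂ, Continuous φ ∧ HasCompactSupport φ ∧ Integrable (𝓕 φ) ∧
    Integrable (fun w => |w| * ‖𝓕 φ w‖) ∧ ∫ w, 𝓕 φ w = 1 := by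
  let b : ContDiffBump (0:ℝ) := ⟨1, 2, by norm_num, by norm_num⟩
  have hb1 : HasCompactSupport (fun x => ((b x : ℝ) : ℂ)) :=
    b.hasCompactSupport.comp_left (g := fun x : ℝ => (x:ℂ)) (by simp)
  have hb2 : ContDiff ℝ ((⊤ : ℕ∞) : WithTop ℕ∞) (fun x => ((b x : ℝ) : ℂ)) :=
    Complex.ofRealCLM.contDiff.comp b.contDiff
  let f := hb1.toSchwartzMap hb2
  have hf : 𝓕 (fun x => ((b x : ℝ) : ℂ)) = ⇑(𝓕 f : SchwartzMap ℝ ℂ) := rfl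
  refine ⟨_, hb2.continuous, hb1, ?_, ?_, ?_⟩
  · rw [hf]; exact (𝓕 f : SchwartzMap ℝ ℂ).integrable
  · rw [hf]
    simpa using (𝓕 f : SchwartzMap ℝ ℂ).integrable_pow_mul volume 1
  · have h1 : (𝓕⁻ (𝓕 f : SchwartzMap ℝ ℂ) : SchwartzMap ℝ ℂ) = f := by simp
    have h2 : (𝓕⁻ (𝓕 f : SchwartzMap ℝ ℂ) : SchwartzMap ℝ ℂ) 0 = ∫ w, (𝓕 f : SchwartzMap ℝ ℂ) w := by
      rw [SchwartzMap.fourierInv_coe, Real.fourierInv_eq]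
      simp
    rw [hf, ← h2, h1]
    simp [f]
    exact b.one_of_mem_closedBall (by simp [b])
end Alladi


namespace Alladi

open MeasureTheory Topology FourierTransform

lemma fourier_scale (φ : ℝ → ℂ) {l : ℝ} (hl : 0 < l) (u : ℝ) :
    𝓕 (fun ξ => φ (ξ / l)) u = l * 𝓕 φ (l * u) := by
  rw [Real.fourier_eq, Real.fourier_eq]
  have := Measure.integral_comp_div (fun η => Real.fourierChar (-(inner ℝ η (l * u))) • φ η) l
  rw [abs_of_pos hl, Complex.real_smul] at this
  rw [← this]
  congr 1
  ext ξ
  congr 3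
  simp
  field_simp

lemma tendsto_HH : Tendsto (HH 1) atBot (𝓝 0) := by
  obtain ⟨φ, hφc, hφs, hK, hK1, hK2⟩ := exists_phi
  set K := 𝓕 φ with hKdef
  set A := ∫ w, |w| * ‖K w‖ with hA
  set B := ∫ w, ‖K w‖ with hB
  have hA0 : 0 ≤ A := integral_nonneg fun w => by positivity
  have hB0 : 0 ≤ B := integral_nonneg fun w => by positivity
  rw [Metric.tendsto_nhds]
  intro ε hε
  obtain ⟨l, hl0, hl⟩ : ∃ l : ℝ, 0 < l ∧ 2 / l * A < ε / 3 := by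
    refine ⟨(6 * A + 3) / ε + 1, by positivity, ?_⟩
    have : 0 < (6 * A + 3) / ε + 1 := by positivity
    rw [div_mul_eq_mul_div, div_lt_iff₀ this]
    have : ε / 3 * ((6 * A + 3) / ε + 1) = (6 * A + 3) / 3 + ε / 3 := by field_simp
    rw [this]; linarith
  have hKl : ∀ u, 𝓕 (fun ξ => φ (ξ / l)) u = l * K (l * u) := fourier_scale φ hl0
  have hlim := tendsto_integral_HH (φ := fun ξ => φ (ξ / l)) (by fun_prop)
    (by simpa [div_eq_inv_mul] using! hφs.comp_smul (inv_ne_zero hl0.ne'))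
    (by
      have : 𝓕 (fun ξ => φ (ξ / l)) = fun u => (l:ℂ) * K (l * u) := funext hKl
      rw [this]
      exact (hK.comp_mul_left' hl0.ne').const_mul _)
  have hconv_eq : ∀ v, ∫ u, HH 1 u * 𝓕 (fun ξ => φ (ξ / l)) (u - v) = ∫ w, HH 1 (v + w / l) * K w := by
    intro v
    simp_rw [hKl]
    have h1 := Measure.integral_comp_div (fun w => HH 1 (v + w) * ((l:ℂ) * K (l * w))) l
    rw [abs_of_pos hl0, Complex.real_smul] at h1
    have h2 := integral_add_left_eq_self (μ := volume) (fun u => HH 1 u * ((l:ℂ) * K (l * (u - v)))) v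
    rw [← h2]
    simp only [add_sub_cancel_left]
    have hl' : (l:ℂ) ≠ 0 := by exact_mod_cast hl0.ne'
    apply mul_left_cancel₀ hl'
    rw [← h1, ← integral_const_mul]
    congr 1
    ext w
    rw [mul_div_cancel₀ _ hl0.ne']
    ring
  simp_rw [hconv_eq] at hlim
  rw [Metric.tendsto_nhds] at hlim
  have hexp : ∀ᶠ v in atBot, Real.exp v * B < ε / 3 := by
    have : Tendsto (fun v => Real.exp v * B) atBot (𝓝 (0 * B)) := Real.tendsto_exp_atBot.mul_const B
    rw [zero_mul] at this
    exact this.eventually_lt_const (by positivity)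
  filter_upwards [hlim (ε / 3) (by positivity), hexp] with v hv1 hv2
  rw [dist_zero_right] at hv1 ⊢
  have hi1 : Integrable (fun w => HH 1 (v + w / l) * K w) := by
    refine hK.norm.mono' ?_ (ae_of_all _ fun w => ?_)
    · refine AEStronglyMeasurable.mul ?_ hK.aestronglyMeasurable
      exact ((measurable_HH 1).comp (by fun_prop)).aestronglyMeasurable
    · rw [norm_mul]
      exact mul_le_of_le_one_left (norm_nonneg _) (norm_HH_le_one le_rfl _)
  have hdiff : ‖HH 1 v - ∫ w, HH 1 (v + w / l) * K w‖ ≤ 2 / l * A + Real.exp v * B := by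
    have e1 : HH 1 v = ∫ w, HH 1 v * K w := by rw [integral_const_mul, hK2, mul_one]
    rw [e1, ← integral_sub (hK.const_mul _) hi1]
    have e2 : 2 / l * A + Real.exp v * B = ∫ w, (2 / l * (|w| * ‖K w‖) + Real.exp v * ‖K w‖) := by
      rw [integral_add (hK1.const_mul _) (hK.norm.const_mul _), integral_const_mul, integral_const_mul]
    rw [e2]
    refine norm_integral_le_of_norm_le ((hK1.const_mul _).add (hK.norm.const_mul _)) (ae_of_all _ fun w => ?_)
    rw [← sub_mul, norm_mul]
    have := HH_slow v (w / l)
    rw [abs_div, abs_of_pos hl0] at this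
    calc _ ≤ (2 * (|w| / l) + Real.exp v) * ‖K w‖ := by gcongr
      _ = _ := by ring
  calc ‖HH 1 v‖ = ‖(HH 1 v - ∫ w, HH 1 (v + w / l) * K w) + ∫ w, HH 1 (v + w / l) * K w‖ := by rw [sub_add_cancel]
    _ ≤ _ := norm_add_le _ _
    _ < ε := by linarith

/-- The prime number theorem in the form `M(N) = o(N)`. -/
theorem tendsto_mertens : Tendsto (fun N : ℕ => (∑ n ∈ Finset.Icc 1 N,
    ((ArithmeticFunction.moebius n : ℤ) : ℝ)) / N) atTop (𝓝 0) := by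
  have h1 : Tendsto (fun N : ℕ => -Real.log N) atTop atBot :=
    tendsto_neg_atTop_atBot.comp (Real.tendsto_log_atTop.comp tendsto_natCast_atTop_atTop)
  have h2 := (Complex.continuous_re.tendsto _).comp (tendsto_HH.comp h1)
  refine h2.congr' ?_
  filter_upwards [eventually_gt_atTop 0] with N hN
  have hN' : (0:ℝ) < N := by exact_mod_cast hN
  simp only [Function.comp]
  rw [HH_one_eq, neg_neg, Real.exp_log hN', MC, Nat.floor_natCast]
  simp [div_eq_inv_mul]
  left
  field_simp

end Alladi


namespace Alladi

open Topology


/-- multiplicative weight depending on the radical only -/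
noncomputable def hh (c : ℕ → ℝ) (n : ℕ) : ℝ := ∏ p ∈ n.primeFactors, c p

lemma hh_one (c : ℕ → ℝ) : hh c 1 = 1 := by simp [hh]

lemma hh_mul (c : ℕ → ℝ) {m n : ℕ} (h : Nat.Coprime m n) : hh c (m * n) = hh c m * hh c n := by
  unfold hh
  rw [h.primeFactors_mul, Finset.prod_union h.disjoint_primeFactors]

lemma sum_divisors_sqfree {n : ℕ} (hn : n ≠ 0) (f : ℕ → ℝ) (hf : ∀ d, ¬ Squarefree d → f d = 0) :
    ∑ d ∈ n.divisors, f d = ∑ t ∈ n.primeFactors.powerset, f (∏ p ∈ t, p) := by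
  have h := Nat.sum_divisors_filter_squarefree hn (f := f)
  rw [Finset.sum_filter] at h
  rw [Finset.sum_congr rfl (g := fun a => if Squarefree a then f a else 0), h]
  · apply Finset.sum_congr
    · congr 1
      rw [Nat.factors_eq]
      rfl
    · intro t _
      rw [Finset.prod_eq_multiset_prod, Multiset.map_id']
  · intro d _
    split_ifs with hd
    · rfl
    · exact hf d hd

lemma hh_prod (c : ℕ → ℝ) {t : Finset ℕ} (ht : ∀ p ∈ t, p.Prime) :
    hh c (∏ p ∈ t, p) = ∏ p ∈ t, c p := by
  unfold hh
  rw [Nat.primeFactors_prod ht]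

lemma coprime_prod {P : ℕ} (hP : P.Prime) {t : Finset ℕ} (ht : ∀ p ∈ t, p.Prime) (hPt : P ∉ t) :
    Nat.Coprime P (∏ p ∈ t, p) := by
  apply Nat.Coprime.prod_right
  intro q hq
  rw [Nat.coprime_primes hP (ht q hq)]
  rintro rfl
  exact hPt hq

lemma moebius_prod {t : Finset ℕ} (ht : ∀ p ∈ t, p.Prime) :
    ArithmeticFunction.moebius (∏ p ∈ t, p) = (-1) ^ t.card := by
  induction t using Finset.induction_on with
  | empty => simp
  | insert P t hPt ih =>
    have hP := ht P (Finset.mem_insert_self _ _)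
    have ht' : ∀ p ∈ t, p.Prime := fun p hp => ht p (Finset.mem_insert_of_mem hp)
    rw [Finset.prod_insert hPt, ArithmeticFunction.isMultiplicative_moebius.map_mul_of_coprime
      (coprime_prod hP ht' hPt), ArithmeticFunction.moebius_apply_prime hP, ih ht',
      Finset.card_insert_of_notMem hPt, pow_succ]
    ring

lemma sum_moebius_hh (c : ℕ → ℝ) {n : ℕ} (hn : n ≠ 0) :
    ∑ d ∈ n.divisors, (ArithmeticFunction.moebius d : ℝ) * hh c d = hh (fun p => 1 - c p) n := by
  rw [sum_divisors_sqfree hn]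
  · unfold hh
    simp_rw [sub_eq_add_neg]
    rw [Finset.prod_one_add]
    apply Finset.sum_congr rfl
    intro t ht
    have ht' : ∀ p ∈ t, p.Prime := fun p hp => Nat.prime_of_mem_primeFactors (Finset.mem_powerset.1 ht hp)
    rw [moebius_prod ht', Nat.primeFactors_prod ht', Finset.prod_neg]
    push_cast
    rfl
  · intro d hd
    simp [ArithmeticFunction.moebius_eq_zero_of_not_squarefree hd]

lemma sum_moebius_sq_hh (c : ℕ → ℝ) {n : ℕ} (hn : n ≠ 0) :
    ∑ d ∈ n.divisors, (ArithmeticFunction.moebius d : ℝ) ^ 2 * hh c d = hh (fun p => 1 + c p) n := by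
  rw [sum_divisors_sqfree hn]
  · unfold hh
    rw [Finset.prod_one_add]
    apply Finset.sum_congr rfl
    intro t ht
    have ht' : ∀ p ∈ t, p.Prime := fun p hp => Nat.prime_of_mem_primeFactors (Finset.mem_powerset.1 ht hp)
    rw [moebius_prod ht', Nat.primeFactors_prod ht']
    push_cast
    rw [← pow_mul, mul_comm, pow_mul']
    simp
  · intro d hd
    simp [ArithmeticFunction.moebius_eq_zero_of_not_squarefree hd]

lemma euler_summable {f b : ℕ → ℝ} (hf0 : f 0 = 0) (hf1 : f 1 = 1) (hf : ∀ n, 0 ≤ f n)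
    (hmul : ∀ m n, Nat.Coprime m n → f (m * n) = f m * f n)
    (hs : ∀ p, p.Prime → Summable (fun j => f (p ^ j)))
    (hb0 : ∀ p, 0 ≤ b p) (hb : Summable b)
    (hbound : ∀ p, p.Prime → ∑' j, f (p ^ j) ≤ 1 + b p) : Summable f := by
  refine summable_of_sum_range_le (c := Real.exp (∑' p, b p)) hf (fun N => ?_)
  have hE := EulerProduct.summable_and_hasSum_smoothNumbers_prod_primesBelow_tsum (f := f) hf1
    (fun {m n} h => hmul m n h) (fun {p} hp => by simpa [abs_of_nonneg (hf _)] using hs p hp) N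
  have h1 : ∑ n ∈ range N, f n ≤ ∏ p ∈ N.primesBelow, ∑' j, f (p ^ j) := by
    rw [← hE.2.tsum_eq]
    have h2 : Summable ((Nat.smoothNumbers N).indicator f) := by
      rw [← summable_subtype_iff_indicator]
      exact hE.2.summable
    rw [tsum_subtype (Nat.smoothNumbers N) f]
    calc ∑ n ∈ range N, f n = ∑ n ∈ range N, (Nat.smoothNumbers N).indicator f n := by
          apply Finset.sum_congr rfl
          intro n hn
          by_cases h0 : n = 0
          · subst h0; simp [hf0, Set.indicator]
          · rw [Set.indicator_of_mem]
            exact Nat.mem_smoothNumbers_of_lt (Nat.pos_of_ne_zero h0) (Finset.mem_range.1 hn)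
      _ ≤ _ := h2.sum_le_tsum _ (fun n _ => Set.indicator_nonneg (fun n _ => hf n) n)
  refine h1.trans ?_
  calc _ ≤ ∏ p ∈ N.primesBelow, Real.exp (b p) := by
        apply Finset.prod_le_prod
        · intro p hp
          exact tsum_nonneg (fun j => hf _)
        · intro p hp
          refine (hbound p (Nat.prime_of_mem_primesBelow hp)).trans ?_
          rw [add_comm]
          exact Real.add_one_le_exp _
    _ = Real.exp (∑ p ∈ N.primesBelow, b p) := (Real.exp_sum _ _).symm
    _ ≤ _ := by
        gcongr
        exact hb.sum_le_tsum _ (fun p _ => hb0 p)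

end Alladi


namespace Alladi

open Topology


/-- Dirichlet hyperbola rearrangement -/
lemma sum_divisors_swap {E : Type*} [AddCommMonoid E] (F : ℕ → ℕ → E) (N : ℕ) :
    ∑ n ∈ Icc 1 N, ∑ d ∈ n.divisors, F d (n / d) = ∑ d ∈ Icc 1 N, ∑ m ∈ Icc 1 (N / d), F d m := by
  rw [Finset.sum_sigma', Finset.sum_sigma']
  refine Finset.sum_bij' (fun x _ => ⟨x.2, x.1 / x.2⟩) (fun x _ => ⟨x.1 * x.2, x.1⟩) ?_ ?_ ?_ ?_ ?_
  · rintro ⟨n, d⟩ h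
    simp only [mem_sigma, mem_Icc, Nat.mem_divisors] at h ⊢
    obtain ⟨⟨h1, h2⟩, h3, h4⟩ := h
    have hd : 0 < d := Nat.pos_of_dvd_of_pos h3 h1
    have := Nat.le_of_dvd h1 h3
    exact ⟨⟨hd, this.trans h2⟩, Nat.div_pos this hd, Nat.div_le_div_right h2⟩
  · rintro ⟨d, m⟩ h
    simp only [mem_sigma, mem_Icc, Nat.mem_divisors] at h ⊢
    obtain ⟨⟨h1, h2⟩, h3, h4⟩ := h
    have h5 : 0 < d * m := Nat.mul_pos h1 h3
    refine ⟨⟨h5, ?_⟩, Dvd.intro _ rfl, h5.ne'⟩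
    calc d * m ≤ d * (N / d) := Nat.mul_le_mul_left _ h4
      _ ≤ N := Nat.mul_div_le _ _
  · rintro ⟨n, d⟩ h
    simp only [mem_sigma, mem_Icc, Nat.mem_divisors] at h ⊢
    simp [Nat.mul_div_cancel' h.2.1]
  · rintro ⟨d, m⟩ h
    simp only [mem_sigma, mem_Icc, Nat.mem_divisors] at h ⊢
    simp [Nat.mul_div_cancel_left _ h.1.1]
  · rintro ⟨n, d⟩ h
    rfl

lemma sum_divisors_floor (f : ℕ → ℝ) (N : ℕ) :
    ∑ n ∈ Icc 1 N, ∑ d ∈ n.divisors, f d = ∑ d ∈ Icc 1 N, f d * ((N / d : ℕ) : ℝ) := by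
  rw [sum_divisors_swap (fun d _ => f d)]
  apply Finset.sum_congr rfl
  intro d _
  simp [mul_comm]

noncomputable def c0 (p : ℕ) : ℝ := 1 + 1 / ((p : ℝ) - 1)

def Adm (c : ℕ → ℝ) : Prop := ∀ p : ℕ, p.Prime → 1 ≤ c p ∧ c p ≤ 1 + 1 / ((p : ℝ) - 1)

lemma prime_ge {p : ℕ} (hp : p.Prime) : (2 : ℝ) ≤ p := by exact_mod_cast hp.two_le

lemma hh_ge_one {c : ℕ → ℝ} (hc : Adm c) (n : ℕ) : 1 ≤ hh c n := by
  unfold hh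
  calc (1 : ℝ) = ∏ p ∈ n.primeFactors, 1 := by simp
    _ ≤ _ := Finset.prod_le_prod (by simp) (fun p hp => (hc p (Nat.prime_of_mem_primeFactors hp)).1)

lemma hh_le_c0 {c : ℕ → ℝ} (hc : Adm c) (n : ℕ) : hh c n ≤ hh c0 n := by
  unfold hh
  exact Finset.prod_le_prod (fun p hp => zero_le_one.trans (hc p (Nat.prime_of_mem_primeFactors hp)).1)
    (fun p hp => (hc p (Nat.prime_of_mem_primeFactors hp)).2)

lemma adm_c0 : Adm c0 := by
  intro p hp
  have := prime_ge hp
  refine ⟨?_, le_rfl⟩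
  unfold c0
  have : 0 ≤ 1 / ((p : ℝ) - 1) := by apply div_nonneg <;> linarith
  linarith

lemma inv_sub_one_le {p : ℕ} (hp : p.Prime) : 1 / ((p : ℝ) - 1) ≤ 2 / p := by
  have := prime_ge hp
  rw [div_le_div_iff₀ (by linarith) (by linarith)]
  linarith

lemma inv_sub_one_le_one {p : ℕ} (hp : p.Prime) : 1 / ((p : ℝ) - 1) ≤ 1 := by
  have := prime_ge hp
  rw [div_le_one (by linarith)]
  linarith

lemma exists_meansq : ∃ C : ℝ, 0 < C ∧ ∀ N : ℕ, ∑ d ∈ Icc 1 N, hh c0 d ^ 2 ≤ C * N := by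
  set t : ℕ → ℝ := fun p => c0 p ^ 2 - 1 with ht
  have ht0 : ∀ p : ℕ, p.Prime → 0 ≤ t p ∧ t p ≤ 6 / p := by
    intro p hp
    have h1 := (adm_c0 p hp).1
    have h2 := inv_sub_one_le hp
    have h3 := inv_sub_one_le_one hp
    have h4 : 0 ≤ 1 / ((p : ℝ) - 1) := by
      have := prime_ge hp
      apply div_nonneg <;> linarith
    simp only [ht, c0] at h1 ⊢
    set u := 1 / ((p : ℝ) - 1)
    constructor
    · nlinarith
    · have : (6 : ℝ) / p = 3 * (2 / p) := by ring
      rw [this]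
      nlinarith
  have hhht : ∀ n, 0 ≤ hh t n := fun n => Finset.prod_nonneg
    (fun p hp => (ht0 p (Nat.prime_of_mem_primeFactors hp)).1)
  set f : ℕ → ℝ := fun n => (ArithmeticFunction.moebius n : ℝ) ^ 2 * hh t n / n with hf
  have hfpp : ∀ p : ℕ, p.Prime → ∀ j, j ∉ range 2 → f (p ^ j) = 0 := by
    intro p hp j hj
    have : ¬ Squarefree (p ^ j) := by
      intro h
      simp only [mem_range, not_lt] at hj
      rw [Nat.squarefree_pow_iff hp.ne_one (by omega)] at h
      omega
    simp [hf, ArithmeticFunction.moebius_eq_zero_of_not_squarefree this]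
  have hsum : Summable f := by
    refine euler_summable (b := fun p => 6 / (p : ℝ) ^ 2) ?_ ?_ ?_ ?_ ?_ ?_ ?_ ?_
    · simp [hf]
    · simp [hf, hh_one]
    · intro n; exact div_nonneg (mul_nonneg (sq_nonneg _) (hhht n)) (Nat.cast_nonneg _)
    · intro m n h
      simp only [hf]
      rw [ArithmeticFunction.isMultiplicative_moebius.map_mul_of_coprime h, hh_mul _ h]
      push_cast
      field_simp
    · intro p hp
      exact summable_of_ne_finset_zero (s := range 2) (hfpp p hp)
    · intro p; positivity
    · exact (Real.summable_one_div_nat_pow.2 one_lt_two).mul_left 6 |>.congr (fun p => by ring)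
    · intro p hp
      rw [tsum_eq_sum (s := range 2) (hfpp p hp)]
      simp only [Finset.sum_range_succ, Finset.range_zero, Finset.sum_empty, pow_zero, pow_one, hf,
        ArithmeticFunction.moebius_apply_prime hp]
      have h2 : hh t p = t p := by simp [hh, hp.primeFactors]
      rw [h2]
      have := prime_ge hp
      simp only [hh_one]
      have h3 : t p / p ≤ 6 / (p : ℝ) ^ 2 := by
        rw [pow_two, ← div_div]
        gcongr
        exact (ht0 p hp).2
      simpa using h3
  refine ⟨∑' n, f n + 1, ?_, fun N => ?_⟩
  · have : 0 ≤ ∑' n, f n := tsum_nonneg (fun n =>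
      div_nonneg (mul_nonneg (sq_nonneg _) (hhht n)) (Nat.cast_nonneg _))
    linarith
  have h1 : ∀ d ∈ Icc 1 N, hh c0 d ^ 2 = ∑ k ∈ d.divisors, (ArithmeticFunction.moebius k : ℝ) ^ 2 * hh t k := by
    intro d hd
    rw [sum_moebius_sq_hh t (by simp at hd; omega)]
    unfold hh
    rw [← Finset.prod_pow]
    apply Finset.prod_congr rfl
    intro p _
    simp [ht]
  rw [Finset.sum_congr rfl h1, sum_divisors_floor]
  calc _ ≤ ∑ k ∈ Icc 1 N, f k * N := by
        apply Finset.sum_le_sum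
        intro k _
        have : (((N / k : ℕ)) : ℝ) ≤ N / k := Nat.cast_div_le
        calc _ ≤ (ArithmeticFunction.moebius k : ℝ) ^ 2 * hh t k * (N / k) := by
              gcongr
              exact mul_nonneg (sq_nonneg _) (hhht k)
          _ = _ := by simp only [hf]; ring
    _ = (∑ k ∈ Icc 1 N, f k) * N := by rw [Finset.sum_mul]
    _ ≤ (∑' n, f n + 1) * N := by
        gcongr
        have := hsum.sum_le_tsum (Icc 1 N) (fun n _ =>
          div_nonneg (mul_nonneg (sq_nonneg _) (hhht n)) (Nat.cast_nonneg _))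
        linarith

/-- the constant in the mean-square bound -/
noncomputable def CC : ℝ := exists_meansq.choose

lemma CC_pos : 0 < CC := exists_meansq.choose_spec.1

lemma meansq_le (N : ℕ) : ∑ d ∈ Icc 1 N, hh c0 d ^ 2 ≤ CC * N := exists_meansq.choose_spec.2 N

lemma mean_le {c : ℕ → ℝ} (hc : Adm c) (N : ℕ) : ∑ d ∈ Icc 1 N, hh c d ≤ CC * N := by
  refine le_trans (Finset.sum_le_sum (fun d _ => ?_)) (meansq_le N)
  have h1 := hh_ge_one adm_c0 d
  have h2 := hh_le_c0 hc d
  nlinarith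

end Alladi


namespace Alladi

open Topology


noncomputable def gg (c : ℕ → ℝ) (T : Set ℕ) (d : ℕ) : ℝ :=
  (ArithmeticFunction.moebius d : ℝ) * hh c d * (if d.minFac ∈ T then 1 else 0)

def gpf (n : ℕ) : ℕ := n.primeFactors.sup id

noncomputable def ind (T : Set ℕ) (p : ℕ) : ℝ := if p ∈ T then 1 else 0

lemma ind_nonneg (T : Set ℕ) (p : ℕ) : 0 ≤ ind T p := by unfold ind; split_ifs <;> simp
lemma ind_le_one (T : Set ℕ) (p : ℕ) : ind T p ≤ 1 := by unfold ind; split_ifs <;> simp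

lemma minFac_mul_max {P : ℕ} (hP : P.Prime) {t : Finset ℕ} (ht : ∀ p ∈ t, p.Prime)
    (hlt : ∀ p ∈ t, p < P) (hne : t.Nonempty) :
    (P * ∏ p ∈ t, p).minFac = (∏ p ∈ t, p).minFac := by
  set m := ∏ p ∈ t, p with hm
  have hm1 : m ≠ 1 := by
    obtain ⟨q, hq⟩ := hne
    intro h
    have : q ∣ m := Finset.dvd_prod_of_mem _ hq
    rw [h] at this
    exact (ht q hq).one_lt.ne' (Nat.dvd_one.1 this)
  have hmf : m.minFac < P := by
    have h1 : m.minFac ∣ m := Nat.minFac_dvd m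
    have h2 := Nat.minFac_prime hm1
    obtain ⟨q, hq, hqd⟩ := (Prime.dvd_finsetProd_iff h2.prime _).1 h1
    rw [(Nat.prime_dvd_prime_iff_eq h2 (ht q hq)).1 hqd]
    exact hlt q hq
  have hPm1 : P * m ≠ 1 := fun h => hm1 (Nat.eq_one_of_mul_eq_one_left h)
  apply le_antisymm
  · exact Nat.minFac_le_of_dvd (Nat.minFac_prime hm1).two_le ((Nat.minFac_dvd m).mul_left P)
  · have h2 := Nat.minFac_prime hPm1
    rcases (Nat.Prime.dvd_mul h2).1 (Nat.minFac_dvd (P * m)) with h | h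
    · rw [(Nat.prime_dvd_prime_iff_eq h2 hP).1 h]; exact hmf.le
    · exact Nat.minFac_le_of_dvd h2.two_le h

noncomputable def GS (c : ℕ → ℝ) (T : Set ℕ) (s : Finset ℕ) : ℝ :=
  ∑ t ∈ s.powerset, gg c T (∏ p ∈ t, p)

lemma gg_one (c : ℕ → ℝ) {T : Set ℕ} (hT : ∀ p ∈ T, p.Prime) : gg c T 1 = 0 := by
  have : (1 : ℕ) ∉ T := fun h => Nat.not_prime_one (hT 1 h)
  simp [gg, this]

lemma GS_insert (c : ℕ → ℝ) {T : Set ℕ} (hT : ∀ p ∈ T, p.Prime) {P : ℕ} (hP : P.Prime) {s : Finset ℕ}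
    (hs : ∀ p ∈ s, p.Prime) (hlt : ∀ p ∈ s, p < P) :
    GS c T (insert P s) = (1 - c P) * GS c T s - c P * ind T P := by
  have hPs : P ∉ s := fun h => (hlt P h).false
  unfold GS
  rw [Finset.sum_powerset_insert hPs]
  have h1 : ∀ t ∈ s.powerset, gg c T (∏ p ∈ insert P t, p) =
      - c P * gg c T (∏ p ∈ t, p) - (if t = ∅ then c P * ind T P else 0) := by
    intro t ht
    have hts := Finset.mem_powerset.1 ht
    have ht' : ∀ p ∈ t, p.Prime := fun p hp => hs p (hts hp)
    rw [Finset.prod_insert (fun h => hPs (hts h))]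
    split_ifs with h0
    · subst h0
      simp only [Finset.prod_empty, mul_one, gg_one c hT]
      simp [gg, ArithmeticFunction.moebius_apply_prime hP, hh, hP.primeFactors, hP.minFac_eq, ind]
      split_ifs <;> simp
    · have hcop := coprime_prod hP ht' (fun h => hPs (hts h))
      unfold gg
      rw [minFac_mul_max hP ht' (fun p hp => hlt p (hts hp)) (Finset.nonempty_iff_ne_empty.2 h0),
        ArithmeticFunction.isMultiplicative_moebius.map_mul_of_coprime hcop, hh_mul _ hcop,
        ArithmeticFunction.moebius_apply_prime hP]
      have : hh c P = c P := by simp [hh, hP.primeFactors]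
      rw [this]
      push_cast
      ring
  rw [Finset.sum_congr rfl h1, Finset.sum_sub_distrib, Finset.sum_ite_eq' , ← Finset.mul_sum]
  simp
  ring

lemma GS_bound {c : ℕ → ℝ} (hc : Adm c) {T : Set ℕ} (hT : ∀ p ∈ T, p.Prime) (s : Finset ℕ) :
    (∀ p ∈ s, p.Prime) → |GS c T s| ≤ 3 ∧
      (s.Nonempty → |GS c T s + ind T (s.sup id)| ≤ 4 / (((s.sup id : ℕ) : ℝ) - 1)) := by
  induction s using Finset.induction_on_max with
  | empty => intro _; simp [GS, gg_one c hT]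
  | insert P s hlt ih =>
    intro hs
    have hP := hs P (Finset.mem_insert_self _ _)
    have hs' : ∀ p ∈ s, p.Prime := fun p hp => hs p (Finset.mem_insert_of_mem hp)
    obtain ⟨ih1, -⟩ := ih hs'
    have hsup : (insert P s).sup id = P := by
      rw [Finset.sup_insert]
      simp only [id]
      exact sup_eq_left.2 (Finset.sup_le (fun p hp => (hlt p hp).le))
    rw [hsup, GS_insert c hT hP hs' hlt]
    obtain ⟨h1, h2⟩ := hc P hP
    have hP2 := prime_ge hP
    have h4 : 0 ≤ 1 / ((P : ℝ) - 1) := by apply div_nonneg <;> linarith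
    have hi0 := ind_nonneg T P
    have hi1 := ind_le_one T P
    have h5 := abs_le.1 ih1
    constructor
    · by_cases hPt : P = 2
      · have hse : s = ∅ := by
          rw [Finset.eq_empty_iff_forall_notMem]
          intro p hp
          have := hlt p hp
          have := (hs' p hp).two_le
          omega
        subst hse
        have : GS c T ∅ = 0 := by simp [GS, gg_one c hT]
        rw [this, abs_le]
        subst hPt
        norm_num at h2
        constructor <;> nlinarith
      · have h3 : (3 : ℝ) ≤ P := by
          have := hP.two_le
          exact_mod_cast (by omega : 3 ≤ P)
        have h6 : 1 / ((P : ℝ) - 1) ≤ 1 / 2 := by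
          apply one_div_le_one_div_of_le <;> linarith
        rw [abs_le]
        constructor <;> nlinarith
    · intro _
      have : (4 : ℝ) / ((P : ℝ) - 1) = 4 * (1 / ((P : ℝ) - 1)) := by ring
      rw [this, abs_le]
      constructor <;> nlinarith

lemma sum_gg_divisors (c : ℕ → ℝ) (T : Set ℕ) {n : ℕ} (hn : n ≠ 0) :
    ∑ d ∈ n.divisors, gg c T d = GS c T n.primeFactors := by
  unfold GS
  apply sum_divisors_sqfree hn
  intro d hd
  simp [gg, ArithmeticFunction.moebius_eq_zero_of_not_squarefree hd]

lemma sum_gg_le {c : ℕ → ℝ} (hc : Adm c) {T : Set ℕ} (hT : ∀ p ∈ T, p.Prime) {n : ℕ} (hn : n ≠ 0) :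
    |∑ d ∈ n.divisors, gg c T d| ≤ 3 := by
  rw [sum_gg_divisors c T hn]
  exact (GS_bound hc hT _ (fun p hp => Nat.prime_of_mem_primeFactors hp)).1

lemma sum_gg_near {c : ℕ → ℝ} (hc : Adm c) {T : Set ℕ} (hT : ∀ p ∈ T, p.Prime) {n : ℕ} (hn : 2 ≤ n) :
    |∑ d ∈ n.divisors, gg c T d + ind T (gpf n)| ≤ 4 / ((gpf n : ℝ) - 1) := by
  rw [sum_gg_divisors c T (by omega)]
  exact (GS_bound hc hT _ (fun p hp => Nat.prime_of_mem_primeFactors hp)).2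
    (Nat.nonempty_primeFactors.2 (by omega))

lemma abs_moebius_le (d : ℕ) : |((ArithmeticFunction.moebius d : ℤ) : ℝ)| ≤ 1 := by
  have := ArithmeticFunction.abs_moebius_le_one (n := d)
  exact_mod_cast this

lemma abs_gg_le {c : ℕ → ℝ} (hc : Adm c) (T : Set ℕ) (d : ℕ) : |gg c T d| ≤ hh c d := by
  have h1 := abs_moebius_le d
  have h2 := hh_ge_one hc d
  unfold gg
  rw [abs_mul, abs_mul, abs_of_nonneg (by linarith : 0 ≤ hh c d)]
  have h3 : |(if d.minFac ∈ T then (1 : ℝ) else 0)| ≤ 1 := by split_ifs <;> simp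
  calc _ ≤ 1 * hh c d * 1 := by gcongr
    _ = _ := by ring

lemma sum_abs_gg_le {c : ℕ → ℝ} (hc : Adm c) (T : Set ℕ) (N : ℕ) :
    ∑ d ∈ Icc 1 N, |gg c T d| ≤ CC * N :=
  (Finset.sum_le_sum (fun d _ => abs_gg_le hc T d)).trans (mean_le hc N)

lemma sum_gg_div_le {c : ℕ → ℝ} (hc : Adm c) {T : Set ℕ} (hT : ∀ p ∈ T, p.Prime) (N : ℕ) :
    |∑ d ∈ Icc 1 N, gg c T d / d| ≤ 3 + CC := by
  rcases Nat.eq_zero_or_pos N with h0 | hN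
  · subst h0; simp; linarith [CC_pos]
  have hN' : (0 : ℝ) < N := by exact_mod_cast hN
  have h1 := sum_divisors_floor (gg c T) N
  have h2 : |∑ n ∈ Icc 1 N, ∑ d ∈ n.divisors, gg c T d| ≤ 3 * N := by
    calc _ ≤ ∑ n ∈ Icc 1 N, |∑ d ∈ n.divisors, gg c T d| := Finset.abs_sum_le_sum_abs _ _
      _ ≤ ∑ n ∈ Icc 1 N, (3 : ℝ) := Finset.sum_le_sum (fun n hn => sum_gg_le hc hT
          (by simp at hn; omega))
      _ = _ := by simp [mul_comm]
  have h3 : |∑ d ∈ Icc 1 N, gg c T d / d * N - ∑ d ∈ Icc 1 N, gg c T d * ((N / d : ℕ) : ℝ)| ≤ CC * N := by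
    rw [← Finset.sum_sub_distrib]
    refine (Finset.abs_sum_le_sum_abs _ _).trans ((Finset.sum_le_sum (fun d hd => ?_)).trans
      (sum_abs_gg_le hc T N))
    have hd : (0 : ℝ) < d := by simp at hd; exact_mod_cast hd.1
    have h4 : ((N / d : ℕ) : ℝ) ≤ N / d := Nat.cast_div_le
    have h5 : (N : ℝ) / d < ((N / d : ℕ) : ℝ) + 1 := by
      rw [← Nat.floor_div_eq_div (K := ℝ)]; exact Nat.lt_floor_add_one _
    have : gg c T d / d * N - gg c T d * ((N / d : ℕ) : ℝ) = gg c T d * (N / d - ((N / d : ℕ) : ℝ)) := by ring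
    rw [this, abs_mul]
    have h6 : |(N : ℝ) / d - ((N / d : ℕ) : ℝ)| ≤ 1 := by rw [abs_le]; constructor <;> linarith
    calc _ ≤ |gg c T d| * 1 := by gcongr
      _ = _ := mul_one _
  rw [← h1, ← Finset.sum_mul] at h3
  have h7 : |(∑ d ∈ Icc 1 N, gg c T d / d) * N| ≤ (3 + CC) * N := by
    rw [abs_le] at *
    constructor <;> linarith
  rw [abs_mul, abs_of_pos hN'] at h7
  exact le_of_mul_le_mul_right h7 hN'

end Alladi


namespace Alladi

open Topology


lemma summable_hh_div {k : ℕ → ℝ} {y : ℕ} (h1 : ∀ p : ℕ, p.Prime → |k p| ≤ 1)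
    (h2 : ∀ p : ℕ, p.Prime → y < p → |k p| ≤ 1 / ((p : ℝ) - 1)) :
    Summable (fun n : ℕ => |hh k n| / n) := by
  have key : ∀ p : ℕ, p.Prime → HasSum (fun j => |hh k (p ^ j)| / ((p ^ j : ℕ) : ℝ))
      (1 + |k p| * (1 / ((p : ℝ) - 1))) := by
    intro p hp
    have hp2 := prime_ge hp
    have hgeo : HasSum (fun j : ℕ => ((p : ℝ)⁻¹) ^ j) (1 - (p : ℝ)⁻¹)⁻¹ :=
      hasSum_geometric_of_lt_one (by positivity) (inv_lt_one_of_one_lt₀ (by linarith))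
    have h3 : HasSum (fun j : ℕ => |k p| * (p : ℝ)⁻¹ * ((p : ℝ)⁻¹) ^ j) (|k p| * (p : ℝ)⁻¹ * (1 - (p : ℝ)⁻¹)⁻¹) :=
      hgeo.mul_left _
    rw [← hasSum_nat_add_iff' 1]
    have e1 : (fun j => |hh k (p ^ (j + 1))| / ((p ^ (j + 1) : ℕ) : ℝ)) =
        fun j : ℕ => |k p| * (p : ℝ)⁻¹ * ((p : ℝ)⁻¹) ^ j := by
      funext j
      rw [hh, Nat.primeFactors_prime_pow (by omega) hp]
      simp only [Finset.prod_singleton]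
      push_cast
      rw [pow_succ, inv_pow]
      field_simp
    have e2 : 1 + |k p| * (1 / ((p : ℝ) - 1)) - ∑ i ∈ range 1, |hh k (p ^ i)| / ((p ^ i : ℕ) : ℝ) =
        |k p| * (p : ℝ)⁻¹ * (1 - (p : ℝ)⁻¹)⁻¹ := by
      have : (p : ℝ) - 1 ≠ 0 := by linarith
      simp [hh_one]
      field_simp
    rw [e1, e2]
    exact h3
  refine euler_summable (b := fun p => if p ≤ y then 1 else 4 / (p : ℝ) ^ 2) ?_ ?_ ?_ ?_ ?_ ?_ ?_ ?_
  · simp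
  · simp [hh_one]
  · intro n; positivity
  · intro m n h
    rw [hh_mul _ h, abs_mul]
    push_cast
    field_simp
  · intro p hp; exact (key p hp).summable
  · intro p; split_ifs <;> positivity
  · have h3 : Summable (fun p : ℕ => 4 / (p : ℝ) ^ 2) :=
      (Real.summable_one_div_nat_pow.2 one_lt_two).mul_left 4 |>.congr (fun p => by ring)
    have h4 : Summable (fun p : ℕ => if p ≤ y then (1 : ℝ) else 0) :=
      summable_of_ne_finset_zero (s := range (y + 1)) (fun p hp => by
        simp only [mem_range] at hp
        rw [if_neg (by omega)])
    refine Summable.of_nonneg_of_le (fun p => ?_) (fun p => ?_) (h3.add h4)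
    · split_ifs <;> positivity
    · split_ifs
      · have : (0 : ℝ) ≤ 4 / (p : ℝ) ^ 2 := by positivity
        linarith
      · simp
  · intro p hp
    rw [(key p hp).tsum_eq]
    have hp2 := prime_ge hp
    have h3 := inv_sub_one_le_one hp
    have h4 := inv_sub_one_le hp
    have h5 : 0 ≤ 1 / ((p : ℝ) - 1) := by apply div_nonneg <;> linarith
    have h6 := h1 p hp
    have h7 := abs_nonneg (k p)
    split_ifs with h
    · nlinarith
    · have h8 := h2 p hp (by omega)
      have h9 : (4 : ℝ) / (p : ℝ) ^ 2 = (2 / p) * (2 / p) := by field_simp; norm_num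
      rw [h9]
      gcongr
      exact h8.trans h4

lemma tendsto_moebius_hh {c : ℕ → ℝ} {y : ℕ} (h1 : ∀ p : ℕ, p.Prime → |1 - c p| ≤ 1)
    (h2 : ∀ p : ℕ, p.Prime → y < p → |1 - c p| ≤ 1 / ((p : ℝ) - 1)) :
    Tendsto (fun N : ℕ => (∑ d ∈ Icc 1 N, (ArithmeticFunction.moebius d : ℝ) * hh c d) / N) atTop (𝓝 0) := by
  set k := hh (fun p => 1 - c p) with hk
  set M : ℕ → ℝ := fun N => ∑ n ∈ Icc 1 N, ((ArithmeticFunction.moebius n : ℤ) : ℝ) with hM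
  have hMt : Tendsto (fun N : ℕ => M N / N) atTop (𝓝 0) := tendsto_mertens
  have hinv : ∀ n > 0, ∑ x ∈ n.divisorsAntidiagonal, ((ArithmeticFunction.moebius x.1 : ℤ) : ℝ) * k x.2 = (ArithmeticFunction.moebius n : ℝ) * hh c n :=
    ArithmeticFunction.sum_eq_iff_sum_mul_moebius_eq.1 (fun n hn => sum_moebius_hh c hn.ne')
  have hsum : ∀ N : ℕ, ∑ d ∈ Icc 1 N, (ArithmeticFunction.moebius d : ℝ) * hh c d = ∑ d ∈ Icc 1 N, k d * M (N / d) := by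
    intro N
    have : ∀ n ∈ Icc 1 N, (ArithmeticFunction.moebius n : ℝ) * hh c n = ∑ d ∈ n.divisors, k d * ((ArithmeticFunction.moebius (n / d) : ℤ) : ℝ) := by
      intro n hn
      rw [← hinv n (by simp at hn; omega),
        Nat.sum_divisorsAntidiagonal' (fun i j => ((ArithmeticFunction.moebius i : ℤ) : ℝ) * k j)]
      exact Finset.sum_congr rfl (fun d _ => mul_comm _ _)
    rw [Finset.sum_congr rfl this, sum_divisors_swap (fun d m => k d * ((ArithmeticFunction.moebius m : ℤ) : ℝ))]
    simp only [hM, Finset.mul_sum]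
  have hMle : ∀ m : ℕ, |M m| ≤ m := by
    intro m
    calc |M m| ≤ ∑ n ∈ Icc 1 m, |((ArithmeticFunction.moebius n : ℤ) : ℝ)| := Finset.abs_sum_le_sum_abs _ _
      _ ≤ ∑ n ∈ Icc 1 m, (1 : ℝ) := Finset.sum_le_sum (fun n _ => abs_moebius_le n)
      _ = m := by simp
  have hM0 : M 0 = 0 := by simp [hM]
  set F : ℕ → ℕ → ℝ := fun N d => if d ∈ Icc 1 N then k d * M (N / d) / N else 0 with hF
  have hFs : ∀ N : ℕ, ∑' d, F N d = (∑ d ∈ Icc 1 N, (ArithmeticFunction.moebius d : ℝ) * hh c d) / N := by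
    intro N
    rw [tsum_eq_sum (s := Icc 1 N) (fun d hd => by simp only [hF]; rw [if_neg hd]), hsum, Finset.sum_div]
    exact Finset.sum_congr rfl (fun d hd => by simp only [hF]; rw [if_pos hd])
  have hmain : Tendsto (fun N => ∑' d, F N d) atTop (𝓝 (∑' d : ℕ, (0 : ℝ))) := by
    refine tendsto_tsum_of_dominated_convergence (summable_hh_div h1 h2) ?_ ?_
    · intro d
      rcases Nat.eq_zero_or_pos d with h0 | hd
      · subst h0; simp [hF]
      have h3 : Tendsto (fun N : ℕ => |k d| * |M (N / d) / ((N / d : ℕ) : ℝ)|) atTop (𝓝 0) := by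
        have h4 := (hMt.comp (Nat.tendsto_div_const_atTop hd.ne')).abs.const_mul |k d|
        simpa using h4
      refine squeeze_zero_norm (fun N => ?_) h3
      simp only [hF]
      split_ifs with h
      · rw [Real.norm_eq_abs, mul_div_assoc, abs_mul]
        refine mul_le_mul_of_nonneg_left ?_ (abs_nonneg _)
        rw [abs_div, abs_div, Nat.abs_cast, Nat.abs_cast]
        simp only [mem_Icc] at h
        have : 0 < N / d := Nat.div_pos h.2 hd
        gcongr
        exact Nat.div_le_self _ _
      · simp; positivity
    · refine Eventually.of_forall (fun N d => ?_)
      simp only [hF]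
      split_ifs with h
      · simp only [mem_Icc] at h
        have hN : (0 : ℝ) < N := by exact_mod_cast (by omega : 0 < N)
        rw [Real.norm_eq_abs, mul_div_assoc, abs_mul, div_eq_mul_one_div |_|]
        gcongr
        rw [abs_div, Nat.abs_cast, div_le_iff₀ hN]
        refine (hMle _).trans ((Nat.cast_div_le).trans (le_of_eq ?_))
        ring
      · simp; positivity
  simpa [hFs] using hmain

noncomputable def rg (y d : ℕ) : ℝ := if ∀ p ∈ d.primeFactors, y < p then 1 else 0

lemma rg_nonneg (y d : ℕ) : 0 ≤ rg y d := by unfold rg; split_ifs <;> simp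

lemma hh_rough (c : ℕ → ℝ) (y d : ℕ) :
    hh (fun p => if p ≤ y then 0 else c p) d = hh c d * rg y d := by
  unfold hh rg
  split_ifs with h
  · rw [mul_one]
    exact Finset.prod_congr rfl (fun p hp => if_neg (by have := h p hp; omega))
  · push Not at h
    obtain ⟨p, hp, hpy⟩ := h
    rw [mul_zero]
    exact Finset.prod_eq_zero hp (if_pos hpy)

lemma tendsto_rough {c : ℕ → ℝ} (hc : Adm c) (y : ℕ) :
    Tendsto (fun N : ℕ => (∑ d ∈ Icc 1 N, (ArithmeticFunction.moebius d : ℝ) * hh c d * rg y d) / N) atTop (𝓝 0) := by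
  have hb : ∀ p : ℕ, p.Prime → |1 - c p| ≤ 1 / ((p : ℝ) - 1) := by
    intro p hp
    obtain ⟨h1, h2⟩ := hc p hp
    rw [abs_le]
    constructor <;> linarith
  have := tendsto_moebius_hh (c := fun p => if p ≤ y then 0 else c p) (y := y) ?_ ?_
  · simpa [hh_rough, mul_assoc] using this
  · intro p hp
    split_ifs
    · simp
    · exact (hb p hp).trans (inv_sub_one_le_one hp)
  · intro p hp hy
    rw [if_neg (by omega)]
    exact hb p hp

lemma rough_small {ε : ℝ} (hε : 0 < ε) : ∃ Y : ℕ, ∀ᶠ N : ℕ in atTop, ∑ d ∈ Icc 1 N, rg Y d ≤ ε * N := by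
  have hdiv : Tendsto (fun Y : ℕ => ∑ p ∈ range (Y + 1), (if p.Prime then 1 / (p : ℝ) else 0)) atTop atTop := by
    have h1 : ¬ Summable (fun p : ℕ => if p.Prime then 1 / (p : ℝ) else 0) := by
      have := not_summable_one_div_on_primes
      intro h
      apply this
      refine h.congr (fun p => ?_)
      simp [Set.indicator]
    have h2 := (not_summable_iff_tendsto_nat_atTop_of_nonneg (fun p => by split_ifs <;> positivity)).1 h1
    exact h2.comp (tendsto_add_atTop_nat 1)
  have hexp : Tendsto (fun Y : ℕ => Real.exp (-∑ p ∈ range (Y + 1), (if p.Prime then 1 / (p : ℝ) else 0)))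
      atTop (𝓝 0) := Real.tendsto_exp_neg_atTop_nhds_zero.comp hdiv
  obtain ⟨Y, hY⟩ := (hexp.eventually (gt_mem_nhds (half_pos hε))).exists
  refine ⟨Y, ?_⟩
  set s := (range (Y + 1)).filter Nat.Prime with hs
  have hsp : ∀ p ∈ s, p.Prime := fun p hp => (Finset.mem_filter.1 hp).2
  set Q := ∏ p ∈ s, p with hQ
  have hQ0 : 0 < Q := Finset.prod_pos (fun p hp => (hsp p hp).pos)
  have hQ0' : (0 : ℝ) < Q := by exact_mod_cast hQ0
  have hphi : (Q.totient : ℝ) / Q ≤ ε / 2 := by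
    have h1 : (Q.totient : ℝ) = Q * ∏ p ∈ s, (1 - (p : ℝ)⁻¹) := by
      have := Nat.totient_eq_mul_prod_factors Q
      rw [hQ, Nat.primeFactors_prod hsp, ← hQ] at this
      have h2 := congrArg (fun q : ℚ => (q : ℝ)) this
      push_cast at h2
      exact h2
    rw [h1, mul_div_cancel_left₀ _ hQ0'.ne']
    refine le_trans ?_ hY.le
    rw [← Finset.sum_filter, ← hs, ← Finset.sum_neg_distrib, Real.exp_sum]
    apply Finset.prod_le_prod
    · intro p hp
      have := prime_ge (hsp p hp)
      rw [sub_nonneg]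
      exact inv_le_one_of_one_le₀ (by linarith)
    · intro p hp
      have := Real.add_one_le_exp (-(1 / (p : ℝ)))
      rw [one_div] at this ⊢
      linarith
  have hcard : ∀ N : ℕ, ∑ d ∈ Icc 1 N, rg Y d ≤ (Q.totient : ℝ) * (N / Q + 1) := by
    intro N
    have h1 : ∑ d ∈ Icc 1 N, rg Y d ≤ (((Ico 1 (1 + N)).filter (fun d => Nat.Coprime Q d)).card : ℝ) := by
      unfold rg
      rw [← Finset.sum_filter, Finset.sum_const, nsmul_eq_mul, mul_one]
      norm_cast
      apply Finset.card_le_card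
      intro d hd
      simp only [mem_filter, mem_Icc, mem_Ico] at hd ⊢
      refine ⟨by omega, ?_⟩
      rw [hQ]
      apply Nat.Coprime.prod_left
      intro p hp
      rw [(hsp p hp).coprime_iff_not_dvd]
      intro hpd
      have := hd.2 p (Nat.mem_primeFactors.2 ⟨hsp p hp, hpd, by omega⟩)
      simp only [hs, mem_filter, mem_range] at hp
      omega
    have h2 := Nat.Ico_filter_coprime_le 1 N hQ0.ne'
    refine h1.trans ?_
    calc (((Ico 1 (1 + N)).filter (fun d => Nat.Coprime Q d)).card : ℝ) ≤ ((Q.totient * (N / Q + 1) : ℕ) : ℝ) := by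
          exact_mod_cast h2
      _ ≤ _ := by
          push_cast
          gcongr
          exact Nat.cast_div_le
  have hev : ∀ᶠ N : ℕ in atTop, (Q.totient : ℝ) / (ε / 2) ≤ N :=
    tendsto_natCast_atTop_atTop.eventually_ge_atTop _
  filter_upwards [hev] with N hN
  refine (hcard N).trans ?_
  rw [div_le_iff₀ (half_pos hε)] at hN
  have : (Q.totient : ℝ) * (N / Q + 1) = (Q.totient : ℝ) / Q * N + Q.totient := by ring
  rw [this]
  have : (Q.totient : ℝ) / Q * N ≤ ε / 2 * N := by gcongr
  linarith

lemma gg_decomp (c : ℕ → ℝ) {T : Set ℕ} (hT : ∀ p ∈ T, p.Prime) (Y : ℕ) {d : ℕ} (hd : 1 ≤ d) :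
    |gg c T d - ∑ p ∈ (range (Y + 1)).filter (· ∈ T),
      ((ArithmeticFunction.moebius d : ℝ) * hh c d * rg (p - 1) d - (ArithmeticFunction.moebius d : ℝ) * hh c d * rg p d)| ≤ |hh c d| * rg Y d := by
  have h1 : ∀ p ∈ (range (Y + 1)).filter (· ∈ T),
      ((ArithmeticFunction.moebius d : ℝ) * hh c d * rg (p - 1) d - (ArithmeticFunction.moebius d : ℝ) * hh c d * rg p d) =
      if p = d.minFac then (ArithmeticFunction.moebius d : ℝ) * hh c d else 0 := by
    intro p hp
    have hpp := hT p (Finset.mem_filter.1 hp).2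
    rw [← mul_sub]
    have : rg (p - 1) d - rg p d = if p = d.minFac then 1 else 0 := by
      rcases Nat.eq_or_lt_of_le hd with h | h
      · rw [← h]
        have : p ≠ 1 := hpp.ne_one
        simp [rg, this]
      · have hmp := Nat.minFac_prime (n := d) (by omega)
        have hr : ∀ y, rg y d = if y < d.minFac then 1 else 0 := by
          intro y
          unfold rg
          congr 1
          rw [eq_iff_iff]
          constructor
          · intro hy; exact hy _ (Nat.mem_primeFactors.2 ⟨hmp, Nat.minFac_dvd d, by omega⟩)
          · intro hy q hq
            exact hy.trans_le (Nat.minFac_le_of_dvd (Nat.prime_of_mem_primeFactors hq).two_le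
              (Nat.dvd_of_mem_primeFactors hq))
        rw [hr, hr]
        have := hpp.pos
        split_ifs <;> first | omega | simp
    rw [this]
    split_ifs <;> simp
  rw [Finset.sum_congr rfl h1, Finset.sum_ite_eq']
  have hmu := abs_moebius_le d
  unfold gg
  simp only [mem_filter, mem_range]
  by_cases hmT : d.minFac ∈ T
  · by_cases hY : d.minFac < Y + 1
    · simp only [hmT, hY, and_self, if_true, mul_one, sub_self, abs_zero]
      exact mul_nonneg (abs_nonneg _) (rg_nonneg _ _)
    · simp only [hmT, hY, if_true, false_and, if_false, mul_one, sub_zero, abs_mul]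
      have : rg Y d = 1 := by
        unfold rg
        rw [if_pos]
        intro q hq
        have := (Nat.minFac_le_of_dvd (Nat.prime_of_mem_primeFactors hq).two_le
              (Nat.dvd_of_mem_primeFactors hq))
        omega
      rw [this, mul_one]
      nlinarith [abs_nonneg (hh c d)]
  · simp only [hmT, and_false, if_false, mul_zero, sub_self, abs_zero]
    exact mul_nonneg (abs_nonneg _) (rg_nonneg _ _)

theorem tendsto_sum_gg {c : ℕ → ℝ} (hc : Adm c) {T : Set ℕ} (hT : ∀ p ∈ T, p.Prime) :
    Tendsto (fun N : ℕ => (∑ d ∈ Icc 1 N, gg c T d) / N) atTop (𝓝 0) := by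
  rw [Metric.tendsto_nhds]
  intro ε hε
  have hCC := CC_pos
  set A : ℝ := 4 * CC / ε with hA
  have hA0 : 0 < A := by positivity
  obtain ⟨Y, hY⟩ := rough_small (ε := ε / (4 * A)) (by positivity)
  have hmain : Tendsto (fun N : ℕ => ∑ p ∈ (range (Y + 1)).filter (· ∈ T),
      ((∑ d ∈ Icc 1 N, (ArithmeticFunction.moebius d : ℝ) * hh c d * rg (p - 1) d) / N
        - (∑ d ∈ Icc 1 N, (ArithmeticFunction.moebius d : ℝ) * hh c d * rg p d) / N)) atTop (𝓝 0) := by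
    have := tendsto_finsetSum ((range (Y + 1)).filter (· ∈ T)) (fun p _ =>
      (tendsto_rough hc (p - 1)).sub (tendsto_rough hc p))
    simpa using this
  have hev := (Metric.tendsto_nhds.1 hmain) (ε / 4) (by positivity)
  filter_upwards [hY, hev, eventually_gt_atTop 0] with N h1 h2 hN
  have hN' : (0 : ℝ) < N := by exact_mod_cast hN
  rw [Real.dist_eq, sub_zero] at h2 ⊢
  have h3 : |∑ d ∈ Icc 1 N, gg c T d - ∑ p ∈ (range (Y + 1)).filter (· ∈ T),
      (∑ d ∈ Icc 1 N, (ArithmeticFunction.moebius d : ℝ) * hh c d * rg (p - 1) d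
        - ∑ d ∈ Icc 1 N, (ArithmeticFunction.moebius d : ℝ) * hh c d * rg p d)| ≤ ε / 2 * N := by
    simp only [← Finset.sum_sub_distrib]
    rw [Finset.sum_comm, ← Finset.sum_sub_distrib]
    calc _ ≤ ∑ d ∈ Icc 1 N, |hh c d| * rg Y d := by
          refine (Finset.abs_sum_le_sum_abs _ _).trans (Finset.sum_le_sum (fun d hd => ?_))
          exact gg_decomp c hT Y (by simp at hd; exact hd.1)
      _ ≤ ∑ d ∈ Icc 1 N, (A * rg Y d + hh c0 d ^ 2 / A) := by
          refine Finset.sum_le_sum (fun d _ => ?_)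
          have e1 := hh_ge_one hc d
          have e2 := hh_le_c0 hc d
          rw [abs_of_nonneg (by linarith)]
          have e3 : 0 ≤ hh c0 d ^ 2 / A := by positivity
          unfold rg
          split_ifs
          · rcases le_total (hh c d) A with h | h
            · linarith
            · have : hh c d ≤ hh c0 d ^ 2 / A := by
                rw [le_div_iff₀ hA0]
                nlinarith
              linarith
          · linarith
      _ = A * ∑ d ∈ Icc 1 N, rg Y d + (∑ d ∈ Icc 1 N, hh c0 d ^ 2) / A := by
          rw [Finset.sum_add_distrib, Finset.mul_sum, Finset.sum_div]
      _ ≤ A * (ε / (4 * A) * N) + (CC * N) / A := by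
          gcongr
          exact meansq_le N
      _ = ε / 2 * N := by
          rw [hA]; field_simp; ring
  have h4 : |∑ p ∈ (range (Y + 1)).filter (· ∈ T),
      (∑ d ∈ Icc 1 N, (ArithmeticFunction.moebius d : ℝ) * hh c d * rg (p - 1) d
        - ∑ d ∈ Icc 1 N, (ArithmeticFunction.moebius d : ℝ) * hh c d * rg p d)| < ε / 4 * N := by
    simp only [← sub_div] at h2
    rw [← Finset.sum_div, abs_div, abs_of_pos hN', div_lt_iff₀ hN'] at h2
    exact h2
  rw [abs_div, abs_of_pos hN', div_lt_iff₀ hN']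
  have h5 : 0 < ε * N := by positivity
  rw [abs_lt] at *
  rw [abs_le] at h3
  constructor <;> linarith

end Alladi


namespace Alladi

open Topology

lemma abel_bound {g b : ℕ → ℝ} {m : ℝ} {D : ℕ} (N : ℕ) (hN : D + 1 ≤ N)
    (hm : ∀ n, D ≤ n → n ≤ N → |∑ d ∈ Icc 1 n, g d| ≤ m) (hb : ∀ n, D + 1 ≤ n → b (n + 1) ≤ b n)
    (hb0 : ∀ n, 0 ≤ b n) :
    |∑ d ∈ Ioc D N, g d * b d| ≤ 2 * m * b (D + 1) := by
  have key : ∀ n, D + 1 ≤ n → n ≤ N →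
      |∑ d ∈ Ioc D n, g d * b d - (∑ d ∈ Icc 1 n, g d) * b n| ≤ m * (2 * b (D + 1) - b n) := by
    intro n hn
    induction n, hn using Nat.le_induction with
    | base =>
      intro _
      have h := hm D le_rfl (by omega)
      rw [Finset.sum_Ioc_succ_top (by omega), Finset.sum_Icc_succ_top (by omega)]
      simp only [Finset.Ioc_self, Finset.sum_empty]
      have : 0 + g (D + 1) * b (D + 1) - (∑ d ∈ Icc 1 D, g d + g (D + 1)) * b (D + 1) =
        -((∑ d ∈ Icc 1 D, g d) * b (D + 1)) := by ring
      rw [this, abs_neg, abs_mul, abs_of_nonneg (hb0 _)]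
      have := hb0 (D + 1)
      nlinarith
    | succ n hn ih =>
      intro hnN
      have h := hm n (by omega) (by omega)
      have ih' := ih (by omega)
      rw [Finset.sum_Ioc_succ_top (by omega), Finset.sum_Icc_succ_top (by omega)]
      have hbn := hb n hn
      set G := ∑ d ∈ Icc 1 n, g d
      set S := ∑ d ∈ Ioc D n, g d * b d
      have : S + g (n + 1) * b (n + 1) - (G + g (n + 1)) * b (n + 1) =
        (S - G * b n) + G * (b n - b (n + 1)) := by ring
      rw [this]
      refine (abs_add_le _ _).trans ?_
      rw [abs_mul, abs_of_nonneg (by linarith : 0 ≤ b n - b (n + 1))]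
      nlinarith
  have h1 := key N hN le_rfl
  have h2 := hm N (by omega) le_rfl
  have h3 := hb0 N
  have h4 : |(∑ d ∈ Icc 1 N, g d) * b N| ≤ m * b N := by
    rw [abs_mul, abs_of_nonneg h3]
    gcongr
  rw [abs_le] at *
  constructor <;> linarith

lemma axer {g : ℕ → ℝ} {C : ℝ} (hC : 0 < C) (hg : ∀ N : ℕ, ∑ d ∈ Icc 1 N, |g d| ≤ C * N)
    (ho : Tendsto (fun N : ℕ => (∑ d ∈ Icc 1 N, g d) / N) atTop (𝓝 0)) :
    Tendsto (fun N : ℕ => (∑ d ∈ Icc 1 N, g d * ((N : ℝ) / d - ((N / d : ℕ) : ℝ))) / N) atTop (𝓝 0) := by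
  rw [Metric.tendsto_nhds]
  intro e he
  -- cut parameter
  set ε : ℝ := min (1 / 2) (e / (4 * C)) with hε
  have hε0 : 0 < ε := by positivity
  have hε1 : ε ≤ 1 / 2 := min_le_left _ _
  have hε2 : C * ε ≤ e / 4 := by
    have : ε ≤ e / (4 * C) := min_le_right _ _
    calc C * ε ≤ C * (e / (4 * C)) := by gcongr
      _ = e / 4 := by field_simp
  set η : ℝ := e * ε / 16 with hη
  have hη0 : 0 < η := by positivity
  obtain ⟨n0, hn0⟩ := eventually_atTop.1 ((Metric.tendsto_nhds.1 ho) η hη0)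
  have hG : ∀ n, n0 ≤ n → |∑ d ∈ Icc 1 n, g d| ≤ η * n := by
    intro n hn
    have := hn0 n hn
    rw [Real.dist_eq, sub_zero, abs_div, Nat.abs_cast] at this
    rcases Nat.eq_zero_or_pos n with h | h
    · subst h; simp
    · have hn' : (0 : ℝ) < n := by exact_mod_cast h
      rw [div_lt_iff₀ hn'] at this
      exact this.le
  have hev : ∀ᶠ N : ℕ in atTop, ((n0 : ℝ) + 1) / ε ≤ N :=
    tendsto_natCast_atTop_atTop.eventually_ge_atTop _
  filter_upwards [hev, eventually_gt_atTop 1] with N hN1 hN2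
  have hN : (0 : ℝ) < N := by exact_mod_cast (by omega : 0 < N)
  rw [div_le_iff₀ hε0] at hN1
  set D := ⌊ε * N⌋₊ with hD
  have hD1 : (D : ℝ) ≤ ε * N := Nat.floor_le (by positivity)
  have hD2 : ε * N < D + 1 := Nat.lt_floor_add_one _
  have hDn0 : n0 ≤ D := by
    apply Nat.le_floor
    nlinarith
  have hDN : D + 1 ≤ N := by
    have : (D : ℝ) < N := by nlinarith
    exact_mod_cast this
  have hm : ∀ n, D ≤ n → n ≤ N → |∑ d ∈ Icc 1 n, g d| ≤ η * N := by
    intro n h1 h2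
    refine (hG n (hDn0.trans h1)).trans ?_
    gcongr
  have hND : (N : ℝ) / (D + 1 : ℕ) ≤ 1 / ε := by
    rw [div_le_div_iff₀ (by positivity) hε0]
    push_cast
    nlinarith
  have hA := abel_bound (g := g) (b := fun d => (N : ℝ) / d) (m := η * N) N hDN hm
    (fun n hn => by
      have : (0 : ℝ) < n := by exact_mod_cast (by omega : 0 < n)
      gcongr
      simp) (fun n => by positivity)
  have hB := abel_bound (g := g) (b := fun d => ((N / d : ℕ) : ℝ)) (m := η * N) N hDN hm
    (fun n hn => by
      exact_mod_cast Nat.div_le_div_left (by omega) (by omega)) (fun n => by positivity)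
  have hND' : ((N / (D + 1) : ℕ) : ℝ) ≤ 1 / ε := Nat.cast_div_le.trans hND
  have hsplit : ∑ d ∈ Icc 1 N, g d * ((N : ℝ) / d - ((N / d : ℕ) : ℝ)) =
      ∑ d ∈ Icc 1 D, g d * ((N : ℝ) / d - ((N / d : ℕ) : ℝ)) +
      (∑ d ∈ Ioc D N, g d * ((N : ℝ) / d) - ∑ d ∈ Ioc D N, g d * ((N / d : ℕ) : ℝ)) := by
    rw [← Finset.sum_sub_distrib]
    simp only [← mul_sub]
    have : ∀ n : ℕ, Icc 1 n = Ioc 0 n := fun n => rfl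
    rw [this, this, Finset.sum_Ioc_consecutive _ (by omega) (by omega)]
  have hsmall : |∑ d ∈ Icc 1 D, g d * ((N : ℝ) / d - ((N / d : ℕ) : ℝ))| ≤ C * (ε * N) := by
    calc _ ≤ ∑ d ∈ Icc 1 D, |g d| := by
          refine (Finset.abs_sum_le_sum_abs _ _).trans (Finset.sum_le_sum (fun d hd => ?_))
          have h4 : ((N / d : ℕ) : ℝ) ≤ N / d := Nat.cast_div_le
          have h5 : (N : ℝ) / d < ((N / d : ℕ) : ℝ) + 1 := by
            rw [← Nat.floor_div_eq_div (K := ℝ)]; exact Nat.lt_floor_add_one _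
          rw [abs_mul]
          have h6 : |(N : ℝ) / d - ((N / d : ℕ) : ℝ)| ≤ 1 := by rw [abs_le]; constructor <;> linarith
          calc _ ≤ |g d| * 1 := by gcongr
            _ = _ := mul_one _
      _ ≤ C * D := hg D
      _ ≤ _ := by gcongr
  have hA' : |∑ d ∈ Ioc D N, g d * ((N : ℝ) / d)| ≤ e / 8 * N := by
    refine hA.trans ?_
    calc 2 * (η * N) * ((N : ℝ) / (D + 1 : ℕ)) ≤ 2 * (η * N) * (1 / ε) := by gcongr
      _ = e / 8 * N := by rw [hη]; field_simp; norm_num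
  have hB' : |∑ d ∈ Ioc D N, g d * ((N / d : ℕ) : ℝ)| ≤ e / 8 * N := by
    refine hB.trans ?_
    calc 2 * (η * N) * ((N / (D + 1) : ℕ) : ℝ) ≤ 2 * (η * N) * (1 / ε) := by gcongr
      _ = e / 8 * N := by rw [hη]; field_simp; norm_num
  have hs2 : C * (ε * N) ≤ e / 4 * N := by nlinarith
  rw [Real.dist_eq, sub_zero, abs_div, abs_of_pos hN, div_lt_iff₀ hN, hsplit]
  have h5 : 0 < e * N := by positivity
  rw [abs_le] at hA' hB' hsmall
  rw [abs_lt]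
  constructor <;> linarith

theorem tendsto_gg_frac {c : ℕ → ℝ} (hc : Adm c) {T : Set ℕ} (hT : ∀ p ∈ T, p.Prime) :
    Tendsto (fun N : ℕ => (∑ d ∈ Icc 1 N, gg c T d * ((N : ℝ) / d - ((N / d : ℕ) : ℝ))) / N) atTop (𝓝 0) :=
  axer CC_pos (sum_abs_gg_le hc T) (tendsto_sum_gg hc hT)

end Alladi


namespace Alladi

open Topology

lemma log_eq_sum {n : ℕ} {s : Finset ℕ} (hs : n.primeFactors ⊆ s) :
    Real.log n = ∑ p ∈ s, (n.factorization p : ℝ) * Real.log p := by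
  rw [Real.log_nat_eq_sum_factorization, Finsupp.sum_of_support_subset _ hs]
  intro p _
  simp

lemma prod_Icc_fact (N : ℕ) : ∏ n ∈ Icc 1 N, n = N.factorial := by
  induction N with
  | zero => simp
  | succ n ih => rw [Finset.prod_Icc_succ_top (by omega), ih, Nat.factorial_succ, mul_comm]

lemma sum_factorization (N p : ℕ) :
    ∑ n ∈ Icc 1 N, (n.factorization p : ℝ) = ((N.factorial).factorization p : ℝ) := by
  rw [← prod_Icc_fact, Nat.factorization_prod (fun n hn => by simp at hn; omega)]
  simp

lemma log_factorial_ge (N : ℕ) : N * Real.log N - N ≤ Real.log N.factorial := by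
  rcases Nat.eq_zero_or_pos N with h | h
  · subst h; simp
  have hN : (0 : ℝ) < N := by exact_mod_cast h
  have h1 := Real.pow_div_factorial_le_exp (N : ℝ) hN.le N
  have hf : (0 : ℝ) < N.factorial := by exact_mod_cast N.factorial_pos
  have h2 := Real.log_le_log (by positivity) h1
  rw [Real.log_exp, Real.log_div (by positivity) hf.ne', Real.log_pow] at h2
  linarith

lemma log_factorial_le (N : ℕ) : Real.log N.factorial ≤ N * Real.log N := by
  have hf : (0 : ℝ) < N.factorial := by exact_mod_cast N.factorial_pos
  rw [← Real.log_pow]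
  apply Real.log_le_log hf
  exact_mod_cast Nat.factorial_le_pow N

lemma log_factorial_eq (N : ℕ) : Real.log N.factorial = ∑ n ∈ Icc 1 N, Real.log n := by
  rw [← prod_Icc_fact]
  push_cast
  rw [Real.log_prod]
  intro n hn
  simp at hn
  exact_mod_cast (by omega : n ≠ 0)

/-- primes up to `y` -/
def pr (y : ℕ) : Finset ℕ := (range (y + 1)).filter Nat.Prime

lemma mem_pr {y p : ℕ} : p ∈ pr y ↔ p ≤ y ∧ p.Prime := by simp [pr]

lemma sum_log_le (y : ℕ) : ∑ p ∈ pr y, Real.log p ≤ Real.log 4 * y := by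
  have h := Chebyshev.theta_le_log4_mul_x (x := (y : ℝ)) (Nat.cast_nonneg y)
  refine le_trans (le_of_eq ?_) h
  rw [Chebyshev.theta, Nat.floor_natCast]
  apply Finset.sum_congr _ (fun _ _ => rfl)
  ext p
  simp only [mem_pr, mem_filter, mem_Ioc]
  constructor
  · rintro ⟨h1, h2⟩; exact ⟨⟨h2.pos, h1⟩, h2⟩
  · rintro ⟨⟨_, h1⟩, h2⟩; exact ⟨h1, h2⟩

lemma div_le_factorization (y : ℕ) {p : ℕ} (hp : p.Prime) : y / p ≤ (y.factorial).factorization p := by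
  rw [Nat.factorization_factorial hp (b := Nat.log p y + 2) (by omega)]
  have := Finset.single_le_sum (f := fun i => y / p ^ i) (s := Ico 1 (Nat.log p y + 2)) (fun i _ => Nat.zero_le _)
    (a := 1) (by simp)
  simpa using this

lemma mertens_one {y : ℕ} (hy : 1 ≤ y) : ∑ p ∈ pr y, Real.log p / p ≤ Real.log y + Real.log 4 := by
  have hy' : (0 : ℝ) < y := by exact_mod_cast hy
  have h1 : Real.log y.factorial = ∑ p ∈ pr y, ((y.factorial).factorization p : ℝ) * Real.log p := by
    apply log_eq_sum
    intro p hp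
    have hpp := Nat.prime_of_mem_primeFactors hp
    exact mem_pr.2 ⟨(hpp.dvd_factorial).1 (Nat.dvd_of_mem_primeFactors hp), hpp⟩
  have h2 : ∑ p ∈ pr y, ((y : ℝ) * (Real.log p / p) - Real.log p) ≤ Real.log y.factorial := by
    rw [h1]
    apply Finset.sum_le_sum
    intro p hp
    have hpp := (mem_pr.1 hp).2
    have hl : 0 ≤ Real.log p := Real.log_natCast_nonneg p
    have h5 : (y : ℝ) / p < ((y / p : ℕ) : ℝ) + 1 := by
      rw [← Nat.floor_div_eq_div (K := ℝ)]; exact Nat.lt_floor_add_one _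
    have h6 : ((y / p : ℕ) : ℝ) ≤ ((y.factorial).factorization p : ℝ) := by
      exact_mod_cast div_le_factorization y hpp
    have : (y : ℝ) * (Real.log p / p) - Real.log p = (y / p - 1) * Real.log p := by ring
    rw [this]
    gcongr
    linarith
  rw [Finset.sum_sub_distrib, ← Finset.mul_sum] at h2
  have h3 := sum_log_le y
  have h4 := log_factorial_le y
  have : (y : ℝ) * ∑ p ∈ pr y, Real.log p / p ≤ y * (Real.log y + Real.log 4) := by linarith
  exact le_of_mul_le_mul_left this hy'

lemma smooth_count {y N : ℕ} (hy : 1 ≤ y) :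
    (((Icc 1 N).filter (fun n => gpf n ≤ y)).card : ℝ) * Real.log N ≤
      N * (1 + 2 * (Real.log y + Real.log 4)) := by
  set A := (Icc 1 N).filter (fun n => gpf n ≤ y) with hA
  have hAsub : A ⊆ Icc 1 N := Finset.filter_subset _ _
  have h1 : ∑ n ∈ A, (Real.log N - Real.log n) ≤ N := by
    calc ∑ n ∈ A, (Real.log N - Real.log n) ≤ ∑ n ∈ Icc 1 N, (Real.log N - Real.log n) := by
          apply Finset.sum_le_sum_of_subset_of_nonneg hAsub
          intro n hn _
          simp only [mem_Icc] at hn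
          rw [sub_nonneg]
          apply Real.log_le_log
          · exact_mod_cast hn.1
          · exact_mod_cast hn.2
      _ = N * Real.log N - Real.log N.factorial := by
          rw [Finset.sum_sub_distrib, log_factorial_eq]; simp
      _ ≤ N := by linarith [log_factorial_ge N]
  have h2 : ∑ n ∈ A, Real.log n ≤ N * (2 * (Real.log y + Real.log 4)) := by
    calc ∑ n ∈ A, Real.log n = ∑ n ∈ A, ∑ p ∈ pr y, (n.factorization p : ℝ) * Real.log p := by
          apply Finset.sum_congr rfl
          intro n hn
          apply log_eq_sum
          intro p hp
          have h3 : p ≤ gpf n := Finset.le_sup (f := id) hp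
          exact mem_pr.2 ⟨h3.trans (Finset.mem_filter.1 hn).2, Nat.prime_of_mem_primeFactors hp⟩
      _ ≤ ∑ n ∈ Icc 1 N, ∑ p ∈ pr y, (n.factorization p : ℝ) * Real.log p := by
          apply Finset.sum_le_sum_of_subset_of_nonneg hAsub
          intro n _ _
          exact Finset.sum_nonneg (fun p _ => mul_nonneg (Nat.cast_nonneg _) (Real.log_natCast_nonneg p))
      _ = ∑ p ∈ pr y, ((N.factorial).factorization p : ℝ) * Real.log p := by
          rw [Finset.sum_comm]
          apply Finset.sum_congr rfl
          intro p _
          rw [← Finset.sum_mul, sum_factorization]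
      _ ≤ ∑ p ∈ pr y, N * (2 * (Real.log p / p)) := by
          apply Finset.sum_le_sum
          intro p hp
          have hpp := (mem_pr.1 hp).2
          have h3 : ((N.factorial).factorization p : ℝ) ≤ ((N / (p - 1) : ℕ) : ℝ) := by
            exact_mod_cast Nat.factorization_factorial_le_div_pred hpp N
          have h4 : ((N / (p - 1) : ℕ) : ℝ) ≤ N * (1 / ((p : ℝ) - 1)) := by
            refine Nat.cast_div_le.trans (le_of_eq ?_)
            rw [Nat.cast_sub hpp.one_le]; push_cast; ring
          have h5 := inv_sub_one_le hpp
          have hl : 0 ≤ Real.log p := Real.log_natCast_nonneg p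
          calc _ ≤ N * (2 / (p : ℝ)) * Real.log p := by
                gcongr
                refine h3.trans (h4.trans ?_)
                gcongr
            _ = _ := by ring
      _ = N * (2 * ∑ p ∈ pr y, Real.log p / p) := by rw [Finset.mul_sum, Finset.mul_sum]
      _ ≤ _ := by
          gcongr
          exact mertens_one hy
  rw [Finset.sum_sub_distrib, Finset.sum_const, nsmul_eq_mul] at h1
  linarith

/-- the cut point `N ^ κ` -/
noncomputable def cut (κ : ℝ) (N : ℕ) : ℕ := ⌊(N : ℝ) ^ κ⌋₊

lemma tendsto_cut {κ : ℝ} (hκ : 0 < κ) : Tendsto (cut κ) atTop atTop :=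
  tendsto_nat_floor_atTop.comp ((tendsto_rpow_atTop hκ).comp tendsto_natCast_atTop_atTop)

lemma eventually_smooth {κ : ℝ} (hκ : 0 < κ) :
    ∀ᶠ N : ℕ in atTop, (((Icc 1 N).filter (fun n => gpf n ≤ cut κ N)).card : ℝ) ≤ 3 * κ * N := by
  have hlog : Tendsto (fun N : ℕ => Real.log N) atTop atTop :=
    Real.tendsto_log_atTop.comp tendsto_natCast_atTop_atTop
  filter_upwards [hlog.eventually_ge_atTop ((1 + 2 * Real.log 4) / κ), hlog.eventually_gt_atTop 0,
    (tendsto_cut hκ).eventually_ge_atTop 1, eventually_gt_atTop 0] with N h1 h2 h3 h4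
  have hN : (0 : ℝ) < N := by exact_mod_cast h4
  have h5 := smooth_count (N := N) h3
  have h6 : Real.log (cut κ N) ≤ κ * Real.log N := by
    rw [← Real.log_rpow hN]
    apply Real.log_le_log (by exact_mod_cast h3)
    exact Nat.floor_le (by positivity)
  rw [div_le_iff₀ hκ] at h1
  have h7 : N * (1 + 2 * (Real.log (cut κ N) + Real.log 4)) ≤ (3 * κ * N) * Real.log N := by
    have : 1 + 2 * (Real.log (cut κ N) + Real.log 4) ≤ 3 * κ * Real.log N := by linarith
    calc _ ≤ N * (3 * κ * Real.log N) := by gcongr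
      _ = _ := by ring
  exact le_of_mul_le_mul_right (h5.trans h7) h2

end Alladi


namespace Alladi

open Topology

lemma gpf_mem {n : ℕ} (hn : 2 ≤ n) : gpf n ∈ n.primeFactors := by
  have h := Finset.exists_mem_eq_sup n.primeFactors (Nat.nonempty_primeFactors.2 (by omega)) id
  obtain ⟨p, hp, h⟩ := h
  unfold gpf
  rw [h]
  exact hp

lemma gpf_one : gpf 1 = 0 := by simp [gpf]

lemma gpf_mul {m p : ℕ} (hm : m ≠ 0) (hp : p.Prime) (h : gpf m ≤ p) : gpf (m * p) = p := by
  unfold gpf at *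
  rw [Nat.primeFactors_mul hm hp.ne_zero, Finset.sup_union, hp.primeFactors]
  simpa using h

lemma gpf_mono {m n : ℕ} (h : m ∣ n) (hn : n ≠ 0) : gpf m ≤ gpf n :=
  Finset.sup_mono (Nat.primeFactors_mono h hn)

lemma sum_gpf_large (f : ℕ → ℝ) (y N : ℕ) :
    ∑ n ∈ (Icc 1 N).filter (fun n => y < gpf n), f (gpf n) =
      ∑ m ∈ Icc 1 N, ∑ p ∈ (Ioc (max y (gpf m - 1)) (N / m)).filter Nat.Prime, f p := by
  rw [Finset.sum_sigma']
  have hge : ∀ n, y < gpf n → 1 ≤ n → 2 ≤ n := by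
    intro n h h1
    by_contra h2
    have : n = 1 := by omega
    subst this
    rw [gpf_one] at h
    omega
  refine Finset.sum_bij' (fun n _ => (⟨n / gpf n, gpf n⟩ : (_ : ℕ) × ℕ)) (fun x _ => x.1 * x.2) ?_ ?_ ?_ ?_ ?_
  · intro n hn
    simp only [mem_filter, mem_Icc, mem_sigma, mem_Ioc] at hn ⊢
    obtain ⟨⟨h1, h2⟩, h3⟩ := hn
    have hg := gpf_mem (hge n h3 h1)
    have hgp := Nat.prime_of_mem_primeFactors hg
    have hgd := Nat.dvd_of_mem_primeFactors hg
    have hdd : n / gpf n ∣ n := Nat.div_dvd_of_dvd hgd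
    have hpos : 0 < n / gpf n := Nat.div_pos (Nat.le_of_dvd (by omega) hgd) hgp.pos
    have h4 := gpf_mono hdd (by omega)
    have h5 := hgp.pos
    refine ⟨⟨hpos, (Nat.div_le_self _ _).trans h2⟩, ⟨max_lt h3 (by omega), ?_⟩, hgp⟩
    rw [Nat.le_div_iff_mul_le hpos, Nat.mul_div_cancel' hgd]
    exact h2
  · rintro ⟨m, p⟩ hn
    simp only [mem_filter, mem_Icc, mem_sigma, mem_Ioc, max_lt_iff] at hn ⊢
    obtain ⟨⟨h1, h2⟩, ⟨⟨h3, h4⟩, h5⟩, hp⟩ := hn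
    rw [gpf_mul (by omega) hp (by omega)]
    rw [Nat.le_div_iff_mul_le (by omega)] at h5
    refine ⟨⟨Nat.mul_pos h1 hp.pos, ?_⟩, h3⟩
    rw [mul_comm]; exact h5
  · intro n hn
    simp only [mem_filter, mem_Icc] at hn
    exact Nat.div_mul_cancel (Nat.dvd_of_mem_primeFactors (gpf_mem (hge n hn.2 hn.1.1)))
  · rintro ⟨m, p⟩ hn
    simp only [mem_filter, mem_Icc, mem_sigma, mem_Ioc, max_lt_iff] at hn ⊢
    obtain ⟨⟨h1, h2⟩, ⟨⟨h3, h4⟩, h5⟩, hp⟩ := hn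
    rw [gpf_mul (by omega) hp (by omega), Nat.mul_div_cancel _ hp.pos]
  · intro n hn
    rfl

/-- natural density of a set of primes -/
def HasDens (T : Set ℕ) (δ : ℝ) : Prop :=
  Tendsto (fun x : ℕ => (((Finset.range (x + 1)).filter (fun p => p ∈ T)).card : ℝ) /
        (Nat.primeCounting x : ℝ)) atTop (𝓝 δ)

noncomputable def DD (T : Set ℕ) (δ : ℝ) (x : ℕ) : ℝ := ∑ p ∈ pr x, (ind T p - δ)

lemma card_pr (x : ℕ) : (pr x).card = Nat.primeCounting x := by
  rw [Nat.primeCounting, Nat.primeCounting', Nat.count_eq_card_filter_range]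
  rfl

lemma DD_eq {T : Set ℕ} (hT : ∀ p ∈ T, p.Prime) (δ : ℝ) (x : ℕ) :
    DD T δ x = (((Finset.range (x + 1)).filter (fun p => p ∈ T)).card : ℝ) - δ * Nat.primeCounting x := by
  unfold DD ind
  rw [Finset.sum_sub_distrib, Finset.sum_const, nsmul_eq_mul, card_pr, ← Finset.sum_filter, Finset.sum_const,
    nsmul_eq_mul, mul_one, mul_comm δ]
  congr 3
  ext p
  simp only [mem_filter, mem_pr, mem_range]
  constructor
  · rintro ⟨⟨h1, h2⟩, h3⟩; exact ⟨by omega, h3⟩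
  · rintro ⟨h1, h3⟩; exact ⟨⟨by omega, hT p h3⟩, h3⟩

lemma DD_small {T : Set ℕ} (hT : ∀ p ∈ T, p.Prime) {δ : ℝ} (hd : HasDens T δ) {η : ℝ} (hη : 0 < η) :
    ∃ x0 : ℕ, ∀ x, x0 ≤ x → |DD T δ x| ≤ η * Nat.primeCounting x := by
  obtain ⟨x0, hx0⟩ := eventually_atTop.1 ((Metric.tendsto_nhds.1 hd) η hη)
  refine ⟨max x0 2, fun x hx => ?_⟩
  have h1 := hx0 x ((le_max_left _ _).trans hx)
  have h2 : 0 < Nat.primeCounting x := by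
    rw [← card_pr]
    exact Finset.card_pos.2 ⟨2, mem_pr.2 ⟨(le_max_right _ _).trans hx, Nat.prime_two⟩⟩
  have h3 : (0 : ℝ) < Nat.primeCounting x := by exact_mod_cast h2
  rw [DD_eq hT]
  rw [Real.dist_eq, div_sub' h3.ne', abs_div, abs_of_pos h3, div_lt_iff₀ h3, mul_comm _ δ] at h1
  exact h1.le

lemma DD_diff (T : Set ℕ) (δ : ℝ) {a b : ℕ} (hab : a ≤ b) :
    ∑ p ∈ (Ioc a b).filter Nat.Prime, (ind T p - δ) = DD T δ b - DD T δ a := by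
  unfold DD
  rw [eq_sub_iff_add_eq, ← Finset.sum_union]
  · apply Finset.sum_congr _ (fun _ _ => rfl)
    ext p
    simp only [mem_union, mem_filter, mem_Ioc, mem_pr]
    constructor
    · rintro (⟨⟨h1, h2⟩, h3⟩ | ⟨h1, h3⟩)
      · exact ⟨h2, h3⟩
      · exact ⟨by omega, h3⟩
    · rintro ⟨h1, h3⟩
      by_cases h : p ≤ a
      · exact Or.inr ⟨h, h3⟩
      · exact Or.inl ⟨⟨by omega, h1⟩, h3⟩
  · rw [Finset.disjoint_left]
    intro p hp hp'
    simp only [mem_filter, mem_Ioc, mem_pr] at hp hp'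
    omega

lemma exists_pi_bound : ∃ x1 : ℕ, ∀ x : ℕ, x1 ≤ x → (Nat.primeCounting x : ℝ) ≤ 3 * (x / Real.log x) := by
  have h := Chebyshev.eventually_primeCounting_le (ε := 1) one_pos
  have h2 := tendsto_natCast_atTop_atTop (R := ℝ) |>.eventually h
  obtain ⟨x1, hx1⟩ := eventually_atTop.1 h2
  refine ⟨max x1 2, fun x hx => ?_⟩
  have h3 := hx1 x ((le_max_left _ _).trans hx)
  rw [Nat.floor_natCast] at h3
  refine h3.trans ?_
  rw [mul_div_assoc]
  have h4 : Real.log 4 ≤ 2 := by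
    have : Real.log 4 = 2 * Real.log 2 := by
      rw [show (4 : ℝ) = 2 ^ 2 by norm_num, Real.log_pow]; norm_num
    rw [this]
    have := Real.log_two_lt_d9
    linarith
  have : 0 ≤ (x : ℝ) / Real.log x := div_nonneg (Nat.cast_nonneg _) (Real.log_natCast_nonneg x)
  gcongr
  linarith

lemma harmonic_bound (N : ℕ) : ∑ m ∈ Icc 1 N, 1 / (m : ℝ) ≤ 1 + Real.log N := by
  have := harmonic_le_one_add_log N
  rw [harmonic_eq_sum_Icc] at this
  push_cast at this
  simpa [one_div] using this

lemma large_part {T : Set ℕ} (hT : ∀ p ∈ T, p.Prime) {δ : ℝ} (hd : HasDens T δ) {κ η : ℝ} (hκ : 0 < κ)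
    (hη : 0 < η) :
    ∀ᶠ N : ℕ in atTop, |∑ n ∈ (Icc 1 N).filter (fun n => cut κ N < gpf n), (ind T (gpf n) - δ)| ≤
      12 * η / κ * N := by
  obtain ⟨x0, hx0⟩ := DD_small hT hd hη
  obtain ⟨x1, hx1⟩ := exists_pi_bound
  have hlog : Tendsto (fun N : ℕ => Real.log N) atTop atTop :=
    Real.tendsto_log_atTop.comp tendsto_natCast_atTop_atTop
  filter_upwards [(tendsto_cut hκ).eventually_ge_atTop (max x0 x1), hlog.eventually_ge_atTop 1,
    eventually_gt_atTop 0] with N hcut hlogN hNpos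
  have hN : (0 : ℝ) < N := by exact_mod_cast hNpos
  rw [sum_gpf_large (fun p => ind T p - δ)]
  have hinner : ∀ m ∈ Icc 1 N,
      |∑ p ∈ (Ioc (max (cut κ N) (gpf m - 1)) (N / m)).filter Nat.Prime, (ind T p - δ)| ≤
        6 * η / (κ * Real.log N) * N * (1 / m) := by
    intro m hm
    set L := max (cut κ N) (gpf m - 1) with hL
    have hm1 : 1 ≤ m := (mem_Icc.1 hm).1
    have hLc : cut κ N ≤ L := le_max_left _ _
    by_cases hle : L < N / m
    · rw [DD_diff T δ hle.le]
      have e1 := hx0 (N / m) (by omega)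
      have e2 := hx0 L (by omega)
      have e3 : (Nat.primeCounting L : ℝ) ≤ Nat.primeCounting (N / m) := by
        exact_mod_cast Nat.monotone_primeCounting hle.le
      have e4 := hx1 (N / m) (by omega)
      have e5 : κ * Real.log N ≤ Real.log ((N / m : ℕ) : ℝ) := by
        rw [← Real.log_rpow hN]
        apply Real.log_le_log (by positivity)
        have : (N : ℝ) ^ κ < cut κ N + 1 := Nat.lt_floor_add_one _
        have h6 : ((cut κ N + 1 : ℕ) : ℝ) ≤ ((N / m : ℕ) : ℝ) := by exact_mod_cast (by omega : cut κ N + 1 ≤ N / m)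
        push_cast at h6
        linarith
      have e6 : ((N / m : ℕ) : ℝ) / Real.log ((N / m : ℕ) : ℝ) ≤ (N / m) / (κ * Real.log N) := by
        have : 0 < κ * Real.log N := by positivity
        gcongr
        exact Nat.cast_div_le
      have e7 : |DD T δ (N / m) - DD T δ L| ≤ 2 * η * Nat.primeCounting (N / m) := by
        refine (abs_sub _ _).trans ?_
        nlinarith
      refine e7.trans ?_
      calc 2 * η * (Nat.primeCounting (N / m) : ℝ) ≤ 2 * η * (3 * ((N / m) / (κ * Real.log N))) := by
            gcongr
            exact e4.trans (by gcongr)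
        _ = _ := by ring
    · rw [Finset.Ioc_eq_empty (by omega)]
      simp
      positivity
  refine (Finset.abs_sum_le_sum_abs _ _).trans ((Finset.sum_le_sum hinner).trans ?_)
  rw [← Finset.mul_sum]
  calc _ ≤ 6 * η / (κ * Real.log N) * N * (1 + Real.log N) := by
        gcongr
        exact harmonic_bound N
    _ ≤ 6 * η / (κ * Real.log N) * N * (2 * Real.log N) := by
        gcongr
        linarith
    _ = _ := by field_simp; ring

theorem tendsto_gpf {T : Set ℕ} (hT : ∀ p ∈ T, p.Prime) {δ : ℝ} (hd : HasDens T δ) :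
    Tendsto (fun N : ℕ => (∑ n ∈ Icc 1 N, ind T (gpf n)) / N) atTop (𝓝 δ) := by
  rw [Metric.tendsto_nhds]
  intro e he
  set κ : ℝ := e / (12 * (1 + |δ|)) with hκ
  have hδ : 0 < 1 + |δ| := by positivity
  have hκ0 : 0 < κ := by positivity
  set η : ℝ := e * κ / 48 with hη
  have hη0 : 0 < η := by positivity
  filter_upwards [eventually_smooth hκ0, large_part hT hd hκ0 hη0, eventually_gt_atTop 0] with N h1 h2 hNpos
  have hN : (0 : ℝ) < N := by exact_mod_cast hNpos
  have h3 : ∑ n ∈ Icc 1 N, (ind T (gpf n) - δ) =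
      ∑ n ∈ (Icc 1 N).filter (fun n => gpf n ≤ cut κ N), (ind T (gpf n) - δ) +
      ∑ n ∈ (Icc 1 N).filter (fun n => cut κ N < gpf n), (ind T (gpf n) - δ) := by
    rw [← Finset.sum_filter_add_sum_filter_not _ (fun n => gpf n ≤ cut κ N)]
    simp only [not_le]
  have h4 : |∑ n ∈ (Icc 1 N).filter (fun n => gpf n ≤ cut κ N), (ind T (gpf n) - δ)| ≤ e / 4 * N := by
    refine (Finset.abs_sum_le_sum_abs _ _).trans ?_
    calc _ ≤ ∑ n ∈ (Icc 1 N).filter (fun n => gpf n ≤ cut κ N), (1 + |δ|) := by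
          apply Finset.sum_le_sum
          intro n _
          refine (abs_sub _ _).trans ?_
          rw [abs_of_nonneg (ind_nonneg T _)]
          linarith [ind_le_one T (gpf n)]
      _ = (((Icc 1 N).filter (fun n => gpf n ≤ cut κ N)).card : ℝ) * (1 + |δ|) := by
          rw [Finset.sum_const, nsmul_eq_mul]
      _ ≤ 3 * κ * N * (1 + |δ|) := by gcongr
      _ = e / 4 * N := by rw [hκ]; field_simp; norm_num
  have h5 : 12 * η / κ * N = e / 4 * N := by rw [hη]; field_simp; norm_num
  rw [h5] at h2
  have h6 : (∑ n ∈ Icc 1 N, ind T (gpf n)) / N - δ = (∑ n ∈ Icc 1 N, (ind T (gpf n) - δ)) / N := by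
    rw [Finset.sum_sub_distrib]
    simp
    field_simp
  rw [Real.dist_eq, h6, abs_div, abs_of_pos hN, div_lt_iff₀ hN, h3]
  refine (abs_add_le _ _).trans_lt ?_
  have : 0 < e * N := by positivity
  linarith

lemma tendsto_gg_div {c : ℕ → ℝ} (hc : Adm c) {T : Set ℕ} (hT : ∀ p ∈ T, p.Prime) {δ : ℝ} (hd : HasDens T δ) :
    Tendsto (fun N : ℕ => ∑ d ∈ Icc 1 N, gg c T d / d) atTop (𝓝 (-δ)) := by
  have hE : Tendsto (fun N : ℕ => (∑ n ∈ Icc 1 N, (∑ d ∈ n.divisors, gg c T d + ind T (gpf n))) / N) atTop (𝓝 0) := by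
    rw [Metric.tendsto_nhds]
    intro e he
    set κ : ℝ := e / 48 with hκ
    have hκ0 : 0 < κ := by positivity
    have hcut : ∀ᶠ N : ℕ in atTop, 16 / e ≤ (cut κ N : ℝ) :=
      (tendsto_natCast_atTop_atTop.comp (tendsto_cut hκ0)).eventually_ge_atTop _
    filter_upwards [eventually_smooth hκ0, hcut, eventually_gt_atTop 0] with N h1 h2 hNpos
    have hN : (0 : ℝ) < N := by exact_mod_cast hNpos
    have hcp : (0 : ℝ) < cut κ N := lt_of_lt_of_le (by positivity) h2
    have h3 : ∀ n ∈ Icc 1 N, |∑ d ∈ n.divisors, gg c T d + ind T (gpf n)| ≤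
        (if gpf n ≤ cut κ N then 4 else 0) + 4 / (cut κ N : ℝ) := by
      intro n hn
      have hn1 := (mem_Icc.1 hn).1
      split_ifs with h
      · have e1 := sum_gg_le hc hT (n := n) (by omega)
        have e2 := ind_nonneg T (gpf n)
        have e3 := ind_le_one T (gpf n)
        have e4 : 0 ≤ 4 / (cut κ N : ℝ) := by positivity
        rw [abs_le] at *
        constructor <;> linarith
      · have hn2 : 2 ≤ n := by
          by_contra h5
          have : n = 1 := by omega
          subst this
          rw [gpf_one] at h
          omega
        rw [zero_add]
        refine (sum_gg_near hc hT hn2).trans ?_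
        have h6 : ((cut κ N + 1 : ℕ) : ℝ) ≤ gpf n := by exact_mod_cast (by omega : cut κ N + 1 ≤ gpf n)
        push_cast at h6
        gcongr
        linarith
    rw [Real.dist_eq, sub_zero, abs_div, abs_of_pos hN, div_lt_iff₀ hN]
    refine ((Finset.abs_sum_le_sum_abs _ _).trans (Finset.sum_le_sum h3)).trans_lt ?_
    rw [Finset.sum_add_distrib, ← Finset.sum_filter, Finset.sum_const, Finset.sum_const, nsmul_eq_mul, nsmul_eq_mul,
      Nat.card_Icc, Nat.add_sub_cancel]
    have h7 : 4 / (cut κ N : ℝ) ≤ e / 4 := by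
      rw [div_le_iff₀ hcp]
      rw [div_le_iff₀ he] at h2
      linarith
    have h8 : (N : ℝ) * (4 / (cut κ N : ℝ)) ≤ N * (e / 4) := by gcongr
    have h9 : 3 * κ * N = e / 16 * N := by rw [hκ]; ring
    have : 0 < e * N := by positivity
    linarith
  have hlim := (hE.sub (tendsto_gpf hT hd)).add (tendsto_gg_frac hc hT)
  rw [zero_sub, add_zero] at hlim
  refine hlim.congr' ?_
  filter_upwards [eventually_gt_atTop 0] with N hNpos
  have hN : (0 : ℝ) < N := by exact_mod_cast hNpos
  have h1 := sum_divisors_floor (gg c T) N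
  rw [Finset.sum_add_distrib, h1, ← sub_div, ← add_div, add_sub_cancel_right, ← Finset.sum_add_distrib,
    Finset.sum_div]
  apply Finset.sum_congr rfl
  intro d hd
  field_simp
  ring

end Alladi


namespace Alladi

open Topology


noncomputable def ce (e p : ℕ) : ℝ := if p ∣ e then 1 else c0 p

lemma adm_ce (e : ℕ) : Adm (ce e) := by
  intro p hp
  have h := adm_c0 p hp
  unfold ce
  split_ifs
  · exact ⟨le_rfl, h.1.trans h.2⟩
  · exact h

lemma hh_c0_mul {d e : ℕ} (hd : d ≠ 0) (he : e ≠ 0) : hh c0 (d * e) = hh c0 e * hh (ce e) d := by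
  unfold hh
  rw [Nat.primeFactors_mul hd he, Finset.union_comm, ← Finset.union_sdiff_self_eq_union,
    Finset.prod_union Finset.disjoint_sdiff]
  congr 1
  have h1 : ∏ p ∈ d.primeFactors \ e.primeFactors, c0 p = ∏ p ∈ d.primeFactors \ e.primeFactors, ce e p := by
    apply Finset.prod_congr rfl
    intro p hp
    rw [Finset.mem_sdiff] at hp
    have hpp := Nat.prime_of_mem_primeFactors hp.1
    unfold ce
    rw [if_neg (fun h => hp.2 (Nat.mem_primeFactors.2 ⟨hpp, h, he⟩))]
  rw [h1]
  apply Finset.prod_subset Finset.sdiff_subset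
  intro p hp hp'
  rw [Finset.mem_sdiff, not_and_not_right] at hp'
  unfold ce
  rw [if_pos (Nat.dvd_of_mem_primeFactors (hp' hp))]

lemma inv_totient {n : ℕ} (hn : n ≠ 0) : (1 : ℝ) / n.totient = hh c0 n / n := by
  have hn' : (n : ℝ) ≠ 0 := by exact_mod_cast hn
  have h1 : (n.totient : ℝ) = n * ∏ p ∈ n.primeFactors, (1 - (p : ℝ)⁻¹) := by
    have h2 := congrArg (fun q : ℚ => (q : ℝ)) (Nat.totient_eq_mul_prod_factors n)
    push_cast at h2
    exact h2
  have h2 : (∏ p ∈ n.primeFactors, (1 - (p : ℝ)⁻¹)) * hh c0 n = 1 := by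
    unfold hh
    rw [← Finset.prod_mul_distrib]
    apply Finset.prod_eq_one
    intro p hp
    have := prime_ge (Nat.prime_of_mem_primeFactors hp)
    have h3 : (p : ℝ) - 1 ≠ 0 := by linarith
    have h4 : (p : ℝ) ≠ 0 := by linarith
    unfold c0
    field_simp
    ring
  have h3 : (n.totient : ℝ) ≠ 0 := by
    exact_mod_cast (Nat.totient_pos.2 (Nat.pos_of_ne_zero hn)).ne'
  rw [div_eq_div_iff h3 hn', h1]
  linear_combination (-(n : ℝ)) * h2

lemma inv_totient_mul {d e : ℕ} (hd : d ≠ 0) (he : e ≠ 0) :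
    (1 : ℝ) / (d * e).totient = 1 / e.totient * (hh (ce e) d / d) := by
  rw [inv_totient (Nat.mul_ne_zero hd he), inv_totient he, hh_c0_mul hd he]
  push_cast
  rw [mul_comm (d : ℝ), mul_div_mul_comm]

lemma summable_totient {α : ℝ} (hα : 0 < α) :
    Summable (fun e : ℕ => (e : ℝ) ^ (-α) * (1 / (e.totient : ℝ))) := by
  have h1 : LSeriesSummable (fun n => ((hh c0 n : ℝ) : ℂ)) ((1 + α : ℝ) : ℂ) := by
    apply LSeriesSummable_of_sum_norm_bigO (r := 1)
    · apply Asymptotics.IsBigO.of_bound CC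
      refine Eventually.of_forall (fun N => ?_)
      rw [Real.rpow_one, Real.norm_of_nonneg (Finset.sum_nonneg (fun _ _ => norm_nonneg _)), Real.norm_natCast]
      refine le_trans (le_of_eq ?_) (mean_le adm_c0 N)
      apply Finset.sum_congr rfl
      intro d _
      rw [Complex.norm_real, Real.norm_of_nonneg (zero_le_one.trans (hh_ge_one adm_c0 d))]
    · norm_num
    · rw [Complex.ofReal_re]; linarith
  have h2 := h1.norm
  refine h2.congr (fun e => ?_)
  rw [LSeries.norm_term_eq]
  split_ifs with h
  · subst h; simp
  · have he : (0 : ℝ) < e := by exact_mod_cast Nat.pos_of_ne_zero h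
    rw [inv_totient h, Complex.ofReal_re, Complex.norm_real,
      Real.norm_of_nonneg (zero_le_one.trans (hh_ge_one adm_c0 e)), Real.rpow_add he, Real.rpow_one,
      Real.rpow_neg he.le]
    field_simp

lemma dens_cofinite {T : Set ℕ} (hT : ∀ p ∈ T, p.Prime) (q : ℕ) (hq : ∀ p, p.Prime → q ≤ p → p ∈ T) :
    HasDens T 1 := by
  have hpi : Tendsto (fun x : ℕ => (Nat.primeCounting x : ℝ)) atTop atTop :=
    tendsto_natCast_atTop_atTop.comp Nat.tendsto_primeCounting
  have hlow : Tendsto (fun x : ℕ => 1 - (q : ℝ) / (Nat.primeCounting x : ℝ)) atTop (𝓝 1) := by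
    have := (tendsto_const_nhds (x := (q : ℝ))).div_atTop hpi
    simpa using (tendsto_const_nhds (x := (1 : ℝ))).sub this
  refine tendsto_of_tendsto_of_tendsto_of_le_of_le' hlow (tendsto_const_nhds (x := (1 : ℝ))) ?_ ?_
  · filter_upwards [hpi.eventually_gt_atTop 0] with x hx
    rw [le_div_iff₀ hx, sub_mul, one_mul, div_mul_cancel₀ _ hx.ne', sub_le_iff_le_add]
    rw [← card_pr]
    have : pr x ⊆ (Finset.range (x + 1)).filter (fun p => p ∈ T) ∪ range q := by
      intro p hp
      rw [mem_pr] at hp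
      rw [mem_union, mem_filter, mem_range, mem_range]
      by_cases h : p < q
      · exact Or.inr h
      · exact Or.inl ⟨by omega, hq p hp.2 (by omega)⟩
    have h2 := (Finset.card_le_card this).trans (Finset.card_union_le _ _)
    rw [Finset.card_range] at h2
    exact_mod_cast h2
  · filter_upwards [hpi.eventually_gt_atTop 0] with x hx
    rw [div_le_one hx, ← card_pr]
    norm_cast
    apply Finset.card_le_card
    intro p hp
    rw [mem_filter, mem_range] at hp
    exact mem_pr.2 ⟨by omega, hT p hp.2⟩

noncomputable def ww (S : Set ℕ) (e d : ℕ) : ℝ :=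
  if (d * e).minFac ∈ S then (ArithmeticFunction.moebius d : ℝ) * (hh (ce e) d / d) else 0

noncomputable def WW (S : Set ℕ) (e N : ℕ) : ℝ := ∑ d ∈ Icc 1 N, ww S e d

lemma WW_one (S : Set ℕ) (N : ℕ) : WW S 1 N = ∑ d ∈ Icc 1 N, gg (ce 1) S d / d := by
  unfold WW
  apply Finset.sum_congr rfl
  intro d _
  unfold ww gg
  rw [mul_one]
  split_ifs <;> ring

def Te (S : Set ℕ) (e : ℕ) : Set ℕ := {p | p.Prime ∧ (e.minFac ≤ p ∨ p ∈ S)}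

lemma minFac_mul_eq {d e : ℕ} (hd : 2 ≤ d) (he : 2 ≤ e) : (d * e).minFac = min d.minFac e.minFac := by
  have hd1 := Nat.minFac_prime (n := d) (by omega)
  have he1 := Nat.minFac_prime (n := e) (by omega)
  have hde : d * e ≠ 1 := by
    intro h
    have := Nat.eq_one_of_mul_eq_one_right h
    omega
  have hm := Nat.minFac_prime hde
  apply le_antisymm
  · apply le_min
    · exact Nat.minFac_le_of_dvd hd1.two_le ((Nat.minFac_dvd d).mul_right e)
    · exact Nat.minFac_le_of_dvd he1.two_le ((Nat.minFac_dvd e).mul_left d)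
  · rcases (Nat.Prime.dvd_mul hm).1 (Nat.minFac_dvd (d * e)) with h | h
    · exact (min_le_left _ _).trans (Nat.minFac_le_of_dvd hm.two_le h)
    · exact (min_le_right _ _).trans (Nat.minFac_le_of_dvd hm.two_le h)

lemma ww_eq {S : Set ℕ} {e d : ℕ} (he : 2 ≤ e) (heS : e.minFac ∈ S) (hd : 1 ≤ d) :
    ww S e d = (if d = 1 then 1 else 0) + gg (ce e) (Te S e) d / d := by
  rcases Nat.eq_or_lt_of_le hd with h | h
  · subst h
    rw [gg_one _ (fun p hp => hp.1)]
    simp [ww, heS, hh_one]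
  · have hdp := Nat.minFac_prime (n := d) (by omega)
    have hiff : (d * e).minFac ∈ S ↔ d.minFac ∈ Te S e := by
      rw [minFac_mul_eq h he]
      simp only [Te, Set.mem_ofPred_eq, hdp, true_and]
      rcases le_total e.minFac d.minFac with h1 | h1
      · rw [min_eq_right h1]; simp [heS, h1]
      · rw [min_eq_left h1]
        constructor
        · exact fun h => Or.inr h
        · rintro (h2 | h2)
          · rw [le_antisymm h1 h2]; exact heS
          · exact h2
    unfold ww gg
    rw [if_neg (by omega : ¬ d = 1)]
    simp only [hiff]
    split_ifs <;> ring

lemma WW_eq {S : Set ℕ} {e : ℕ} (he : 2 ≤ e) (heS : e.minFac ∈ S) (N : ℕ) :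
    WW S e N = (if 1 ≤ N then 1 else 0) + ∑ d ∈ Icc 1 N, gg (ce e) (Te S e) d / d := by
  unfold WW
  rw [Finset.sum_congr rfl (fun d hd => ww_eq he heS (mem_Icc.1 hd).1), Finset.sum_add_distrib,
    Finset.sum_ite_eq']
  simp

lemma WW_bound {S : Set ℕ} (hS : ∀ p ∈ S, p.Prime) {e : ℕ} (he : e = 1 ∨ 2 ≤ e ∧ e.minFac ∈ S) (N : ℕ) :
    |WW S e N| ≤ 4 + CC := by
  rcases he with h | ⟨h1, h2⟩
  · subst h
    rw [WW_one]
    linarith [sum_gg_div_le (adm_ce 1) hS N]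
  · rw [WW_eq h1 h2]
    have h3 := sum_gg_div_le (adm_ce e) (T := Te S e) (fun p hp => hp.1) N
    refine (abs_add_le _ _).trans ?_
    have : |if 1 ≤ N then (1 : ℝ) else 0| ≤ 1 := by split_ifs <;> simp
    linarith

lemma WW_tendsto_one {S : Set ℕ} (hS : ∀ p ∈ S, p.Prime) {δ : ℝ} (hd : HasDens S δ) :
    Tendsto (fun N => WW S 1 N) atTop (𝓝 (-δ)) := by
  simp only [WW_one]
  exact tendsto_gg_div (adm_ce 1) hS hd

lemma WW_tendsto {S : Set ℕ} {e : ℕ} (he : 2 ≤ e) (heS : e.minFac ∈ S) :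
    Tendsto (fun N => WW S e N) atTop (𝓝 0) := by
  have h1 := tendsto_gg_div (adm_ce e) (T := Te S e) (fun p hp => hp.1)
    (dens_cofinite (fun p hp => hp.1) e.minFac (fun p hp h => ⟨hp, Or.inl h⟩))
  have h2 := (tendsto_const_nhds (x := (1 : ℝ))).add h1
  rw [add_neg_cancel] at h2
  refine h2.congr' ?_
  filter_upwards [eventually_ge_atTop 1] with N hN
  rw [WW_eq he heS, if_pos hN]

lemma main_sum {S : Set ℕ} (hS : ∀ p ∈ S, p.Prime) (a : ℕ → ℂ) (x : ℕ) :
    ∑ n ∈ Finset.Icc 2 x,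
          (if n.minFac ∈ S then
            (∑ d ∈ n.divisors, (ArithmeticFunction.moebius d : ℂ) * a (n / d)) /
              (Nat.totient n : ℂ)
          else 0) = ∑ e ∈ Icc 1 x, a e * ((1 / (e.totient : ℝ) : ℝ) : ℂ) * ((WW S e (x / e) : ℝ) : ℂ) := by
  have h1S : (1 : ℕ) ∉ S := fun h => Nat.not_prime_one (hS 1 h)
  set F : ℕ → ℕ → ℂ := fun e d => a e * ((1 / (e.totient : ℝ) : ℝ) : ℂ) * ((ww S e d : ℝ) : ℂ) with hF
  have h1 : ∑ e ∈ Icc 1 x, a e * ((1 / (e.totient : ℝ) : ℝ) : ℂ) * ((WW S e (x / e) : ℝ) : ℂ) =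
      ∑ n ∈ Icc 1 x, ∑ e ∈ n.divisors, F e (n / e) := by
    rw [sum_divisors_swap F]
    apply Finset.sum_congr rfl
    intro e _
    simp only [hF, WW]
    push_cast
    rw [Finset.mul_sum]
  rw [h1]
  have h2 : ∀ n ∈ Icc 1 x, ∑ e ∈ n.divisors, F e (n / e) = (if n.minFac ∈ S then
            (∑ d ∈ n.divisors, (ArithmeticFunction.moebius d : ℂ) * a (n / d)) /
              (Nat.totient n : ℂ)
          else 0) := by
    intro n hn
    have hn1 := (mem_Icc.1 hn).1
    have h3 : ∀ e ∈ n.divisors, F e (n / e) = if n.minFac ∈ S then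
        ((ArithmeticFunction.moebius (n / e) : ℂ) * a (n / (n / e))) / (Nat.totient n : ℂ) else 0 := by
      intro e he
      have hed := Nat.dvd_of_mem_divisors he
      have he0 : 0 < e := Nat.pos_of_mem_divisors he
      have hq0 : n / e ≠ 0 := (Nat.div_pos (Nat.le_of_dvd hn1 hed) he0).ne'
      have hmul : n / e * e = n := Nat.div_mul_cancel hed
      have hi := inv_totient_mul hq0 he0.ne'
      rw [hmul] at hi
      simp only [hF, ww, hmul]
      rw [Nat.div_div_self hed (by omega)]
      split_ifs
      · have h5 : ((1 / (n.totient : ℝ) : ℝ) : ℂ) =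
            ((1 / (e.totient : ℝ) * (hh (ce e) (n / e) / ((n / e : ℕ) : ℝ)) : ℝ) : ℂ) := by rw [hi]
        rw [div_eq_mul_one_div _ (n.totient : ℂ)]
        push_cast at h5 ⊢
        rw [h5]
        ring
      · simp
    rw [Finset.sum_congr rfl h3]
    split_ifs
    · rw [Nat.sum_div_divisors n (fun d => ((ArithmeticFunction.moebius d : ℂ) * a (n / d)) / (Nat.totient n : ℂ)),
        Finset.sum_div]
    · simp
  rw [Finset.sum_congr rfl h2]
  apply Finset.sum_subset
  · intro n hn
    rw [mem_Icc] at *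
    omega
  · intro n hn hn'
    rw [mem_Icc] at *
    have : n = 1 := by omega
    subst this
    simp [h1S]

end Alladi

theorem alladi_convolution_totient (S : Set ℕ) (hS : ∀ p ∈ S, Nat.Prime p) (δ : ℝ)
    (hdens : Tendsto
      (fun x : ℕ => (((Finset.range (x + 1)).filter (fun p => p ∈ S)).card : ℝ) /
        (Nat.primeCounting x : ℝ)) atTop (nhds δ))
    (a : ℕ → ℂ) (ha1 : a 1 = 1)
    (hsupp : ∀ n : ℕ, 2 ≤ n → n.minFac ∉ S → a n = 0)
    (hdecay : ∃ α C : ℝ, 0 < α ∧ ∀ n : ℕ, 1 ≤ n → ‖a n‖ ≤ C * (n : ℝ) ^ (-α)) :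
    Tendsto
      (fun x : ℕ =>
        -∑ n ∈ Finset.Icc 2 x,
          (if n.minFac ∈ S then
            (∑ d ∈ n.divisors, (ArithmeticFunction.moebius d : ℂ) * a (n / d)) /
              (Nat.totient n : ℂ)
          else 0))
      atTop (nhds (δ : ℂ)) := by
  obtain ⟨α, C, hα, hC⟩ := hdecay
  have hC0 : 0 ≤ C := by
    have := (norm_nonneg _).trans (hC 1 le_rfl)
    simpa using this
  have hCC := Alladi.CC_pos
  have hdec : ∀ e : ℕ, 1 ≤ e → a e = 0 ∨ (e = 1 ∨ 2 ≤ e ∧ e.minFac ∈ S) := by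
    intro e he
    by_cases h1 : e = 1
    · exact Or.inr (Or.inl h1)
    · by_cases h2 : e.minFac ∈ S
      · exact Or.inr (Or.inr ⟨by omega, h2⟩)
      · exact Or.inl (hsupp e (by omega) h2)
  set F : ℕ → ℕ → ℂ := fun x e => if e ∈ Icc 1 x then
    a e * ((1 / (e.totient : ℝ) : ℝ) : ℂ) * ((Alladi.WW S e (x / e) : ℝ) : ℂ) else 0 with hF
  set L : ℕ → ℂ := fun e => if e = 1 then (-δ : ℂ) else 0 with hL
  have hlim : Tendsto (fun x => ∑' e, F x e) atTop (nhds (∑' e, L e)) := by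
    refine tendsto_tsum_of_dominated_convergence
      (bound := fun e : ℕ => C * (4 + Alladi.CC) * ((e : ℝ) ^ (-α) * (1 / (e.totient : ℝ))))
      ((Alladi.summable_totient hα).mul_left _) ?_ ?_
    · intro e
      rcases Nat.eq_zero_or_pos e with h0 | he
      · subst h0; simp [hF, hL]
      have hdiv := Nat.tendsto_div_const_atTop he.ne'
      have hFe : ∀ᶠ x in atTop, a e * ((1 / (e.totient : ℝ) : ℝ) : ℂ) * ((Alladi.WW S e (x / e) : ℝ) : ℂ) = F x e := by
        filter_upwards [eventually_ge_atTop e] with x hx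
        simp only [hF]
        rw [if_pos (mem_Icc.2 ⟨he, hx⟩)]
      refine Tendsto.congr' hFe ?_
      rcases hdec e he with h | h | ⟨h1, h2⟩
      · have : e ≠ 1 := by
          rintro rfl
          rw [ha1] at h
          exact one_ne_zero h
        simp [h, hL, this]
      · subst h
        have h3 := (Complex.continuous_ofReal.tendsto _).comp ((Alladi.WW_tendsto_one hS hdens).comp hdiv)
        simp only [hL, ha1]
        simpa [Function.comp_def] using h3
      · have h3 := (Complex.continuous_ofReal.tendsto _).comp ((Alladi.WW_tendsto h1 h2).comp hdiv)
        have h4 := h3.const_mul (a e * ((1 / (e.totient : ℝ) : ℝ) : ℂ))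
        simp only [hL]
        rw [if_neg (by omega)]
        simpa [Function.comp_def] using h4
    · refine Eventually.of_forall (fun x e => ?_)
      simp only [hF]
      split_ifs with h
      · have he := (mem_Icc.1 h).1
        rcases hdec e he with h0 | h1
        · rw [h0]; simp; positivity
        · rw [norm_mul, norm_mul, Complex.norm_real, Complex.norm_real, Real.norm_of_nonneg (by positivity),
            Real.norm_eq_abs]
          calc _ ≤ C * (e : ℝ) ^ (-α) * (1 / (e.totient : ℝ)) * (4 + Alladi.CC) := by
                gcongr
                · exact hC e he
                · exact Alladi.WW_bound hS h1 _
            _ = _ := by ring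
      · simp; positivity
  have hLs : ∑' e, L e = (-δ : ℂ) := by simp [hL]
  rw [hLs] at hlim
  have h5 := hlim.neg
  rw [neg_neg] at h5
  refine h5.congr (fun x => ?_)
  rw [Alladi.main_sum hS, tsum_eq_sum (s := Icc 1 x) (fun e he => by simp only [hF]; rw [if_neg he])]
  congr 1
  exact Finset.sum_congr rfl (fun e he => by simp only [hF]; rw [if_pos he])
end
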